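/- In the setting of the contour-deformation lemma, let h ∈ H^∞(U) and T ∈ L(H) satisfy σ(T) ∩ U = ∅ and sup over (clos Ω₀) \ ({λ₀} ∪ Ω) of |h(z)| ‖(zI−T)^{-1}‖ < ∞. For g ∈ H^∞(U) define A_g = (1/2πi) ∫_Γ g(z) h(z)(zI−T)^{-1} dz. Then A_g ∈ {T}'' and, for g₁, g₂ ∈ H^∞(U), A_{g₁} A_{g₂} = A_{g₂} A_{g₁} = (1/2πi) ∫_Γ g₁(z) g₂(z) h²(z)(zI−T)^{-1} dz. In particular, A_h^n (with g = 1) satisfies A^n = (1/2πi) ∫_Γ hⁿ(z)(zI−T)^{-1} dz. -/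

import Mathlib

open scoped Real
open MeasureTheory Filter

variable {H : Type*} [NormedAddCommGroup H] [NormedSpace ℂ H] [CompleteSpace H]

/-- The commutant of an operator `T`. -/
def commutant (T : H →L[ℂ] H) : Set (H →L[ℂ] H) := {A | A * T = T * A}

/-- The double commutant of an operator `T`. -/
def bicommutant (T : H →L[ℂ] H) : Set (H →L[ℂ] H) :=
  {A | ∀ B ∈ commutant T, A * B = B * A}

/-- A (closed) subspace invariant under every operator commuting with `T`. -/
def IsHyperinvariant (T : H →L[ℂ] H) (M : Submodule ℂ H) : Prop :=
  IsClosed (M : Set H) ∧ ∀ A ∈ commutant T, ∀ x ∈ M, A x ∈ M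

section
open scoped Topology

lemma p2_kernel {ε r0 : ℝ} (hε : 0 < ε) (hr : 0 < r0) (g : ℝ → ℝ) (hg : Integrable g)
    (h0 : ∀ u, 0 ≤ g u) (s δ : ℝ) (hδ : 0 ≤ δ)
    (hL : ∀ r, 0 < r → r ≤ r0 → ∫ u in Metric.closedBall s r, g u ≤ δ * r) :
    ∫ u, ε / (ε ^ 2 + (u - s) ^ 2) * g u ≤ 8 * δ + ε / r0 ^ 2 * ∫ u, g u := by
  obtain ⟨n, hn⟩ : ∃ n : ℕ, r0 / ε ≤ 2 ^ n := by
    obtain ⟨n, hn⟩ := pow_unbounded_of_one_lt (r0 / ε) (by norm_num : (1:ℝ) < 2)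
    exact ⟨n, hn.le⟩
  have hn' : r0 ≤ 2 ^ n * ε := by rwa [div_le_iff₀ hε] at hn
  set ρ : ℕ → ℝ := fun k => min (2 ^ k * ε) r0 with hρ
  have hρpos : ∀ k, 0 < ρ k := fun k => lt_min (by positivity) hr
  have key : ∀ u, ε / (ε ^ 2 + (u - s) ^ 2) * g u ≤
      (∑ k ∈ Finset.range (n + 1), (4 * (1/4) ^ k / ε) *
        (Metric.closedBall s (ρ k)).indicator g u) + ε / r0 ^ 2 * g u := by
    intro u
    have hsum0 : ∀ k ∈ Finset.range (n + 1), 0 ≤ (4 * (1/4 : ℝ) ^ k / ε) *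
        (Metric.closedBall s (ρ k)).indicator g u := fun k _ =>
      mul_nonneg (by positivity) (Set.indicator_nonneg (fun x _ => h0 x) _)
    by_cases hu : |u - s| ≤ r0
    · have hex : ∃ k, |u - s| ≤ 2 ^ k * ε := ⟨n, hu.trans hn'⟩
      classical
      set k := Nat.find hex with hk
      have hk1 : |u - s| ≤ 2 ^ k * ε := Nat.find_spec hex
      have hkn : k ≤ n := Nat.find_min' hex (hu.trans hn')
      have hle := Finset.single_le_sum hsum0 (Finset.mem_range.2 (Nat.lt_succ_of_le hkn))
      have hmem : u ∈ Metric.closedBall s (ρ k) := by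
        rw [Metric.mem_closedBall, Real.dist_eq]; exact le_min hk1 hu
      rw [Set.indicator_of_mem hmem] at hle
      have hK : ε / (ε ^ 2 + (u - s) ^ 2) ≤ 4 * (1/4) ^ k / ε := by
        rw [div_le_div_iff₀ (by positivity) hε]
        rcases Nat.eq_zero_or_pos k with h | h
        · rw [h]; nlinarith [sq_nonneg (u - s)]
        · obtain ⟨j, hj⟩ : ∃ j, k = j + 1 := ⟨k - 1, by omega⟩
          have := Nat.find_min hex (m := j) (by omega)
          rw [not_le] at this
          have h2 : (2 ^ j * ε) ^ 2 ≤ (u - s) ^ 2 := by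
            rw [← sq_abs (u - s)]; gcongr
          have h4 : (1/4 : ℝ) ^ j * (2 ^ j * ε) ^ 2 = ε ^ 2 := by
            rw [mul_pow, ← pow_mul, mul_comm j 2, pow_mul, ← mul_assoc, ← mul_pow]; norm_num
          have h5 : (1/4 : ℝ) ^ j * (2 ^ j * ε) ^ 2 ≤ (1/4 : ℝ) ^ j * (u - s) ^ 2 := by gcongr
          rw [hj, pow_succ]
          have : 0 ≤ (1/4 : ℝ) ^ j * ε ^ 2 := by positivity
          nlinarith
      have : 0 ≤ ε / r0 ^ 2 * g u := mul_nonneg (by positivity) (h0 u)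
      have := mul_le_mul_of_nonneg_right hK (h0 u)
      linarith
    · push Not at hu
      have hK : ε / (ε ^ 2 + (u - s) ^ 2) ≤ ε / r0 ^ 2 := by
        apply div_le_div_of_nonneg_left hε.le (by positivity)
        have : r0 ^ 2 ≤ (u - s) ^ 2 := by rw [← sq_abs (u - s)]; gcongr
        nlinarith [sq_nonneg ε]
      have := mul_le_mul_of_nonneg_right hK (h0 u)
      have := Finset.sum_nonneg hsum0
      linarith
  have hI : ∀ k, Integrable ((Metric.closedBall s (ρ k)).indicator g) := fun k =>
    hg.indicator measurableSet_closedBall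
  have hI1 : Integrable (fun u => (∑ k ∈ Finset.range (n + 1), (4 * (1/4 : ℝ) ^ k / ε) *
        (Metric.closedBall s (ρ k)).indicator g u)) :=
    integrable_finset_sum _ fun k _ => (hI k).const_mul _
  have hmono : ∫ u, ε / (ε ^ 2 + (u - s) ^ 2) * g u ≤ ∫ u, ((∑ k ∈ Finset.range (n + 1),
      (4 * (1/4 : ℝ) ^ k / ε) * (Metric.closedBall s (ρ k)).indicator g u)
        + ε / r0 ^ 2 * g u) :=
    integral_mono_of_nonneg (Eventually.of_forall fun u => mul_nonneg (by positivity) (h0 u))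
      (hI1.add (hg.const_mul _)) (Eventually.of_forall key)
  refine hmono.trans ?_
  rw [integral_add hI1 (hg.const_mul _), integral_const_mul,
    integral_finset_sum _ (fun k _ => (hI k).const_mul _)]
  gcongr
  calc _ ≤ ∑ k ∈ Finset.range (n + 1), 4 * δ * (1/2 : ℝ) ^ k := by
        refine Finset.sum_le_sum fun k _ => ?_
        rw [integral_const_mul, integral_indicator measurableSet_closedBall]
        have h1 := hL (ρ k) (hρpos k) (min_le_right _ _)
        have h2 : δ * ρ k ≤ δ * (2 ^ k * ε) := by gcongr; exact min_le_left _ _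
        calc _ ≤ (4 * (1/4 : ℝ) ^ k / ε) * (δ * (2 ^ k * ε)) := by gcongr; exact h1.trans h2
          _ = 4 * δ * ((1/4 : ℝ) ^ k * 2 ^ k) := by field_simp
          _ = _ := by rw [← mul_pow]; norm_num
    _ = 4 * δ * ∑ k ∈ Finset.range (n + 1), (1/2 : ℝ) ^ k := by rw [Finset.mul_sum]
    _ ≤ 4 * δ * 2 := by
        gcongr
        exact sum_geometric_two_le _
    _ = 8 * δ := by ring

lemma p2_poisson (g : ℝ → ℝ) (hg : Integrable g) (h0 : ∀ u, 0 ≤ g u) (s : ℝ)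
    (hL : Tendsto (fun r => r⁻¹ * ∫ u in Metric.closedBall s r, g u) (𝓝[>] 0) (𝓝 0)) :
    Tendsto (fun ε => ∫ u, ε / (ε ^ 2 + (u - s) ^ 2) * g u) (𝓝[>] 0) (𝓝 0) := by
  rw [Metric.tendsto_nhds]
  intro η hη
  have h1 : ∀ᶠ r in 𝓝[>] (0:ℝ), r⁻¹ * ∫ u in Metric.closedBall s r, g u < η / 16 :=
    hL.eventually_lt_const (by positivity)
  obtain ⟨r0, hr0, hr⟩ := mem_nhdsGT_iff_exists_Ioc_subset.1 h1
  have hr0 : 0 < r0 := hr0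
  have h2 : Tendsto (fun ε : ℝ => ε / r0 ^ 2 * ∫ u, g u) (𝓝[>] 0) (𝓝 0) := by
    have : Continuous (fun ε : ℝ => ε / r0 ^ 2 * ∫ u, g u) := by fun_prop
    have := this.tendsto 0
    simp only [zero_div, zero_mul] at this
    exact this.mono_left nhdsWithin_le_nhds
  filter_upwards [h2.eventually_lt_const (half_pos hη), self_mem_nhdsWithin] with ε hε hεp
  have hεp : 0 < ε := hεp
  have := p2_kernel hεp hr0 g hg h0 s (η / 16) (by positivity) (fun r hrp hrr => by
    have := hr ⟨hrp, hrr⟩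
    simp only [Set.mem_setOf_eq] at this
    rw [inv_mul_lt_iff₀ hrp] at this
    linarith)
  rw [Real.dist_eq, sub_zero, abs_of_nonneg
    (integral_nonneg fun u => mul_nonneg (by positivity) (h0 u))]
  linarith

lemma p2_lebesgue {E : Type*} [NormedAddCommGroup E] (f : ℝ → E)
    (hf : LocallyIntegrable f) :
    ∀ᵐ s, Tendsto (fun r => r⁻¹ * ∫ u in Metric.closedBall s r, ‖f u - f s‖) (𝓝[>] 0) (𝓝 0) := by
  filter_upwards [IsUnifLocDoublingMeasure.ae_tendsto_average_norm_sub volume hf 1] with s hs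
  have := hs (l := 𝓝[>] (0:ℝ)) (fun _ => s) id tendsto_id
    (by filter_upwards [self_mem_nhdsWithin] with r hr
        simp [le_of_lt (show (0:ℝ) < r from hr)])
  have := this.const_mul 2
  rw [mul_zero] at this
  refine this.congr' ?_
  filter_upwards [self_mem_nhdsWithin] with r hr
  have hr : 0 < r := hr
  rw [setAverage_eq, Measure.real]
  simp only [id, Real.volume_closedBall, smul_eq_mul]
  rw [ENNReal.toReal_ofReal (by positivity)]
  field_simp

lemma p4_ftc (G G' : ℝ → ℂ) (hG : LocallyLipschitz G) (a b : ℝ)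
    (hd : ∀ᵐ t, HasDerivAt G (G' t) t) :
    IntervalIntegrable G' volume a b ∧ ∫ t in a..b, G' t = G b - G a := by
  obtain ⟨C, hC⟩ := (hG.locallyLipschitzOn (s := Set.uIcc a b)).exists_lipschitzOnWith_of_compact
    isCompact_uIcc
  have hre : AbsolutelyContinuousOnInterval (fun t => (G t).re) a b := by
    have := (Complex.reCLM.lipschitz.comp_lipschitzOnWith hC)
    exact this.absolutelyContinuousOnInterval
  have him : AbsolutelyContinuousOnInterval (fun t => (G t).im) a b := by
    have := (Complex.imCLM.lipschitz.comp_lipschitzOnWith hC)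
    exact this.absolutelyContinuousOnInterval
  have hae : ∀ᵐ t, G' t = ((deriv (fun t => (G t).re) t : ℝ) : ℂ) +
      ((deriv (fun t => (G t).im) t : ℝ) : ℂ) * Complex.I := by
    filter_upwards [hd] with t ht
    have h1 : HasDerivAt (fun t => (G t).re) (G' t).re t :=
      Complex.reCLM.hasFDerivAt.comp_hasDerivAt t ht
    have h2 : HasDerivAt (fun t => (G t).im) (G' t).im t :=
      Complex.imCLM.hasFDerivAt.comp_hasDerivAt t ht
    rw [h1.deriv, h2.deriv, Complex.re_add_im]
  have i1 := hre.intervalIntegrable_deriv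
  have i2 := him.intervalIntegrable_deriv
  have i1' : IntervalIntegrable (fun t => ((deriv (fun t => (G t).re) t : ℝ) : ℂ)) volume a b :=
    ⟨i1.1.ofReal, i1.2.ofReal⟩
  have i2' : IntervalIntegrable (fun t => ((deriv (fun t => (G t).im) t : ℝ) : ℂ) * Complex.I) volume a b :=
    ⟨i2.1.ofReal.mul_const _, i2.2.ofReal.mul_const _⟩
  constructor
  · refine (i1'.add i2').congr_ae ?_
    exact ae_restrict_of_ae (hae.mono fun t ht => ht.symm)
  · rw [intervalIntegral.integral_congr_ae (hae.mono fun t ht _ => ht),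
      intervalIntegral.integral_add i1' i2', intervalIntegral.integral_mul_const,
      intervalIntegral.integral_ofReal, intervalIntegral.integral_ofReal,
      hre.integral_deriv_eq_sub, him.integral_deriv_eq_sub]
    apply Complex.ext <;> simp

lemma p4_locLip {ψ : ℝ → ℝ} (hψ : LocallyLipschitz ψ) :
    LocallyLipschitz (fun θ : ℝ => Complex.exp (ψ θ + θ * Complex.I)) := by
  have h1 : ContDiff ℝ 1 (fun p : ℝ × ℝ => Complex.exp (p.1 + p.2 * Complex.I)) := by
    have : ContDiff ℝ 1 (fun p : ℝ × ℝ => (p.1 : ℂ) + p.2 * Complex.I) := by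
      have a1 : ContDiff ℝ 1 (fun p : ℝ × ℝ => (p.1 : ℂ)) := Complex.ofRealCLM.contDiff.comp contDiff_fst
      have a2 : ContDiff ℝ 1 (fun p : ℝ × ℝ => (p.2 : ℂ)) := Complex.ofRealCLM.contDiff.comp contDiff_snd
      exact a1.add (a2.mul contDiff_const)
    exact this.cexp
  exact h1.locallyLipschitz.comp (hψ.prodMk LocallyLipschitz.id)

lemma p4_locLip_comp {V : Set ℂ} (hV : IsOpen V) {F : ℂ → ℂ} (hF : DifferentiableOn ℂ F V)
    {g : ℝ → ℂ} (hg : LocallyLipschitz g) (hgV : ∀ t, g t ∈ V) :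
    LocallyLipschitz (fun t => F (g t)) := by
  intro t
  have h1 : ContDiffAt ℂ 1 F (g t) :=
    ((hF.contDiffOn hV).contDiffAt (hV.mem_nhds (hgV t)))
  obtain ⟨K, s, hs, hK⟩ := h1.exists_lipschitzOnWith
  obtain ⟨K', s', hs', hK'⟩ := hg t
  refine ⟨K * K', s' ∩ g ⁻¹' s, inter_mem hs' (hg.continuous.continuousAt hs), ?_⟩
  exact hK.comp (hK'.mono Set.inter_subset_left) (fun x hx => hx.2)

lemma p4_hasDerivAt {ψ : ℝ → ℝ} {θ : ℝ} (h : DifferentiableAt ℝ ψ θ) :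
    HasDerivAt (fun θ : ℝ => Complex.exp (ψ θ + θ * Complex.I))
      (Complex.exp (ψ θ + θ * Complex.I) * (deriv ψ θ + Complex.I)) θ := by
  have h1 : HasDerivAt (fun θ : ℝ => (ψ θ : ℂ)) ((deriv ψ θ : ℝ) : ℂ) θ := h.hasDerivAt.ofReal_comp
  have h2 : HasDerivAt (fun θ : ℝ => (θ : ℂ) * Complex.I) (1 * Complex.I) θ :=
    (hasDerivAt_id θ).ofReal_comp.mul_const _
  have := (h1.add h2).cexp
  simpa using this

lemma p4_cauchy {ψ : ℝ → ℝ} {C : NNReal} (hψ : LipschitzWith C ψ)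
    (hper : ψ π = ψ (-π)) {V : Set ℂ} (hV : IsOpen V) {F : ℂ → ℂ}
    (hF : DifferentiableOn ℂ F V) {R : ℝ}
    (hin : ∀ θ l : ℝ, 0 ≤ l → l < R → (l : ℂ) * Complex.exp (ψ θ + θ * Complex.I) ∈ V)
    {l : ℝ} (hl0 : 0 ≤ l) (hlR : l < R) :
    ∫ θ in (-π)..π, F (l * Complex.exp (ψ θ + θ * Complex.I)) * (deriv ψ θ + Complex.I)
      = 2 * π * Complex.I * F 0 := by
  set w : ℝ → ℂ := fun θ => Complex.exp (ψ θ + θ * Complex.I) with hw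
  have hψd : ∀ᵐ θ, DifferentiableAt ℝ ψ θ := hψ.ae_differentiableAt_real
  have hwl : LocallyLipschitz w := p4_locLip hψ.locallyLipschitz
  have hwc : Continuous w := hwl.continuous
  have hwper : w π = w (-π) := by
    simp only [hw, hper, Complex.exp_add]
    congr 1
    simp [Complex.exp_pi_mul_I, Complex.exp_neg]
  have hψb : ∀ θ, ‖((deriv ψ θ : ℝ) : ℂ) + Complex.I‖ ≤ C + 1 := fun θ =>
    (norm_add_le _ _).trans (by
      simp only [Complex.norm_I, Complex.norm_real]
      gcongr
      exact norm_deriv_le_of_lipschitz hψ)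
  have hψm : Measurable (fun θ => ((deriv ψ θ : ℝ) : ℂ) + Complex.I) :=
    (Complex.measurable_ofReal.comp (measurable_deriv ψ)).add_const _
  have hzero : ∀ m : ℝ, 0 ≤ m → m < R →
      ∫ θ in (-π)..π, deriv F (m * w θ) * (w θ * (deriv ψ θ + Complex.I)) = 0 := by
    intro m hm0 hmR
    rcases hm0.eq_or_lt with h | h
    · have := (p4_ftc w (fun θ => w θ * (deriv ψ θ + Complex.I)) hwl (-π) π
        (hψd.mono fun θ h => p4_hasDerivAt h)).2
      subst h
      simp only [Complex.ofReal_zero, zero_mul]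
      rw [intervalIntegral.integral_const_mul, this, hwper, sub_self, mul_zero]
    · have hl2 : LocallyLipschitz (fun θ => (m:ℂ) * w θ) :=
        ((lipschitzWith_smul (m:ℂ)).locallyLipschitz.comp hwl)
      have := (p4_ftc (fun θ => F (m * w θ))
        (fun θ => m * (deriv F (m * w θ) * (w θ * (deriv ψ θ + Complex.I))))
        (p4_locLip_comp hV hF hl2 (fun θ => hin θ m hm0 hmR)) (-π) π (hψd.mono fun θ h => by
          have h1 := (hF.differentiableAt (hV.mem_nhds (hin θ m hm0 hmR))).hasDerivAt
          have h2 : HasDerivAt (fun θ => (m:ℂ) * w θ) _ θ := (p4_hasDerivAt h).const_mul (m:ℂ)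
          have := HasDerivAt.comp θ h1 h2
          refine this.congr_deriv ?_
          change deriv F (m * w θ) * (m * (w θ * (((deriv ψ θ : ℝ) : ℂ) + Complex.I))) = _
          ring)).2
      rw [hwper, sub_self, intervalIntegral.integral_const_mul] at this
      exact (mul_eq_zero.1 this).resolve_left (by exact_mod_cast h.ne')
  have hder : ∀ m : ℝ, 0 ≤ m → m < R → HasDerivAt
      (fun l : ℝ => ∫ θ in (-π)..π, F (l * w θ) * (deriv ψ θ + Complex.I)) 0 m := by
    intro m hm0 hmR
    have hdc : ∀ θ, ContinuousAt (deriv F) (m * w θ) := fun θ =>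
      ((hF.deriv hV).differentiableAt (hV.mem_nhds (hin θ m hm0 hmR))).continuousAt
    obtain ⟨M, hM⟩ : ∃ M, ∀ θ ∈ Set.Icc (-π) π, ‖deriv F (m * w θ)‖ < M := by
      have : ContinuousOn (fun θ => deriv F (m * w θ)) (Set.Icc (-π) π) := fun θ _ =>
        (ContinuousAt.comp (f := fun θ => (m:ℂ) * w θ) (hdc θ)
          (by fun_prop)).continuousWithinAt
      obtain ⟨M, hM⟩ := isCompact_Icc.exists_bound_of_continuousOn this
      exact ⟨M + 1, fun θ h => (hM θ h).trans_lt (lt_add_one _)⟩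
    obtain ⟨B, hB⟩ := isCompact_Icc.exists_bound_of_continuousOn (s := Set.Icc (-π) π) hwc.continuousOn
    have hev : ∀ᶠ l : ℝ in 𝓝 m, ∀ θ ∈ Set.Icc (-π) π, (l:ℂ) * w θ ∈ V ∧ ‖deriv F (l * w θ)‖ < M := by
      refine isCompact_Icc.eventually_forall_of_forall_eventually fun θ hθ => ?_
      have hc : Continuous (fun p : ℝ × ℝ => (p.1 : ℂ) * w p.2) := by fun_prop
      have h1 : ∀ᶠ p : ℝ × ℝ in 𝓝 (m, θ), (p.1 : ℂ) * w p.2 ∈ V :=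
        (hc.continuousAt (x := (m, θ))).eventually_mem (hV.mem_nhds (hin θ m hm0 hmR))
      have h2 := ContinuousAt.comp (f := fun p : ℝ × ℝ => (p.1 : ℂ) * w p.2) (x := (m, θ)) (hdc θ)
        hc.continuousAt
      have h3 := h2.norm.eventually_lt_const (hM θ hθ)
      exact h1.and h3
    have hIoc : ∀ {θ}, θ ∈ Set.uIoc (-π) π → θ ∈ Set.Icc (-π) π := fun h => by
      rw [Set.uIoc_of_le (by linarith [Real.pi_pos])] at h; exact ⟨h.1.le, h.2⟩
    have hmeas : ∀ {l : ℝ} {g : ℂ → ℂ}, ContinuousOn g V → (∀ θ ∈ Set.Icc (-π) π, (l:ℂ) * w θ ∈ V) →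
        AEStronglyMeasurable (fun θ => g (l * w θ)) (volume.restrict (Set.uIoc (-π) π)) := by
      intro l g hg hl
      have : ContinuousOn (fun θ => g (l * w θ)) (Set.uIoc (-π) π) :=
        hg.comp (by fun_prop) (fun θ hθ => hl θ (hIoc hθ))
      exact this.aestronglyMeasurable measurableSet_uIoc
    have hFi : IntervalIntegrable (fun θ => F (m * w θ) * (deriv ψ θ + Complex.I)) volume (-π) π := by
      have hc : Continuous (fun θ => F (m * w θ)) := by
        refine continuous_iff_continuousAt.2 fun θ => ?_
        exact ContinuousAt.comp (f := fun θ => (m:ℂ) * w θ)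
          (hF.differentiableAt (hV.mem_nhds (hin θ m hm0 hmR))).continuousAt (by fun_prop)
      obtain ⟨B', hB'⟩ := isCompact_Icc.exists_bound_of_continuousOn (s := Set.Icc (-π) π) hc.continuousOn
      refine (intervalIntegrable_const (c := (B' * (C + 1) : ℝ))).mono_fun
        (hc.aestronglyMeasurable.mul hψm.aestronglyMeasurable) ?_
      filter_upwards [ae_restrict_mem measurableSet_uIoc] with θ hθ
      rw [norm_mul]
      refine le_trans ?_ (Real.le_norm_self _)
      exact mul_le_mul (hB' θ (hIoc hθ)) (hψb θ) (norm_nonneg _)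
        ((norm_nonneg _).trans (hB' θ (hIoc hθ)))
    have := (intervalIntegral.hasDerivAt_integral_of_dominated_loc_of_deriv_le
      (μ := volume) (a := -π) (b := π) (x₀ := m)
      (F := fun (l : ℝ) θ => F (l * w θ) * (deriv ψ θ + Complex.I))
      (F' := fun (l : ℝ) θ => deriv F (l * w θ) * (w θ * (deriv ψ θ + Complex.I)))
      (bound := fun _ => M * (B * (C + 1))) hev
      (hev.mono fun l hl => (hmeas hF.continuousOn (fun θ h => (hl θ h).1)).mul
        hψm.aestronglyMeasurable) hFi
      ((hmeas (hF.deriv hV).continuousOn (fun θ _ => hin θ m hm0 hmR)).mul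
        (hwc.aestronglyMeasurable.mul hψm.aestronglyMeasurable))
      (Eventually.of_forall fun θ hθ l hl => by
        rw [norm_mul, norm_mul]
        have h1 := (hl θ (hIoc hθ)).2.le
        have h2 := hB θ (hIoc hθ)
        exact mul_le_mul h1 (mul_le_mul h2 (hψb θ) (norm_nonneg _) ((norm_nonneg _).trans h2))
          (by positivity) ((norm_nonneg _).trans h1))
      intervalIntegrable_const
      (Eventually.of_forall fun θ hθ l hl => by
        have h1 := (hF.differentiableAt (hV.mem_nhds (hl θ (hIoc hθ)).1)).hasDerivAt
        have h2 : HasDerivAt (fun l : ℝ => (l:ℂ) * w θ) (1 * w θ) l :=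
          ((hasDerivAt_id l).ofReal_comp).mul_const _
        have := (HasDerivAt.comp l h1 h2).mul_const (deriv ψ θ + Complex.I)
        refine this.congr_deriv ?_
        simp only [one_mul, mul_assoc])).2
    rwa [hzero m hm0 hmR] at this
  have hconst := constant_of_has_deriv_right_zero (a := 0) (b := l)
    (f := fun l : ℝ => ∫ θ in (-π)..π, F (l * w θ) * (deriv ψ θ + Complex.I))
    (fun x hx => (hder x hx.1 (hx.2.trans_lt hlR)).continuousAt.continuousWithinAt)
    (fun x hx => (hder x hx.1 (hx.2.trans hlR)).hasDerivWithinAt) l ⟨hl0, le_rfl⟩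
  refine hconst.trans ?_
  simp only [Complex.ofReal_zero, zero_mul]
  rw [intervalIntegral.integral_const_mul]
  have h3 := p4_ftc (fun θ => (ψ θ : ℂ) + θ * Complex.I) (fun θ => (deriv ψ θ + Complex.I))
    (by
      have h1 : LocallyLipschitz (fun θ => (ψ θ : ℂ)) :=
        (Complex.ofRealCLM.lipschitz.comp hψ).locallyLipschitz
      have h2 : LocallyLipschitz (fun θ : ℝ => (θ : ℂ) * Complex.I) := by
        have : ContDiff ℝ 1 (fun θ : ℝ => (θ : ℂ) * Complex.I) :=
          (Complex.ofRealCLM.contDiff).mul contDiff_const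
        exact this.locallyLipschitz
      have h4 : ContDiff ℝ 1 (fun p : ℂ × ℂ => p.1 + p.2) := contDiff_fst.add contDiff_snd
      exact h4.locallyLipschitz.comp (h1.prodMk h2)) (-π) π
    (hψd.mono fun θ h => by
      have h1 : HasDerivAt (fun θ : ℝ => (ψ θ : ℂ)) ((deriv ψ θ : ℝ) : ℂ) θ := h.hasDerivAt.ofReal_comp
      have h2 : HasDerivAt (fun θ : ℝ => (θ : ℂ) * Complex.I) (1 * Complex.I) θ :=
        (hasDerivAt_id θ).ofReal_comp.mul_const _
      exact (h1.fun_add h2).congr_deriv (by simp))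
  rw [h3.2, hper]
  push_cast
  ring

lemma p4_cauchyType {α E : Type*} [MeasurableSpace α] [NormedAddCommGroup E] [NormedSpace ℂ E]
    {μ : Measure α} {f : α → E} (hf : Integrable f μ) {w : α → ℂ} (hw : AEMeasurable w μ)
    {ζ : ℂ} {d : ℝ} (hd : 0 < d) (hwd : ∀ᵐ t ∂μ, d ≤ ‖w t - ζ‖) :
    DifferentiableAt ℂ (fun z => ∫ t, (w t - z)⁻¹ • f t ∂μ) ζ := by
  have hmeas : ∀ z : ℂ, AEStronglyMeasurable (fun t => (w t - z)⁻¹ • f t) μ := fun z =>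
    (hw.sub_const z).inv.aestronglyMeasurable.smul hf.aestronglyMeasurable
  have key : ∀ᵐ t ∂μ, ∀ x ∈ Metric.ball ζ (d / 2), d / 2 ≤ ‖w t - x‖ := by
    filter_upwards [hwd] with t ht x hx
    have h1 : ‖w t - ζ‖ ≤ ‖w t - x‖ + ‖x - ζ‖ := norm_sub_le_norm_sub_add_norm_sub _ _ _
    rw [mem_ball_iff_norm] at hx
    linarith
  have := hasDerivAt_integral_of_dominated_loc_of_deriv_le (𝕜 := ℂ) (μ := μ) (x₀ := ζ)
    (F := fun z t => (w t - z)⁻¹ • f t) (F' := fun z t => ((w t - z) ^ 2)⁻¹ • f t)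
    (bound := fun t => ((d / 2) ^ 2)⁻¹ * ‖f t‖) (Metric.ball_mem_nhds ζ (half_pos hd))
    (Eventually.of_forall hmeas)
    (by
      refine (hf.norm.const_mul (d⁻¹)).mono' (hmeas ζ) ?_
      filter_upwards [hwd] with t ht
      rw [norm_smul, norm_inv]
      gcongr)
    (((hw.sub_const ζ).pow_const 2).inv.aestronglyMeasurable.smul hf.aestronglyMeasurable)
    (by
      filter_upwards [key] with t ht x hx
      rw [norm_smul, norm_inv, norm_pow]
      have := ht x hx
      gcongr)
    (hf.norm.const_mul _)
    (by
      filter_upwards [key] with t ht x hx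
      have hne : w t - x ≠ 0 := norm_pos_iff.1 ((half_pos hd).trans_le (ht x hx))
      have h1 : HasDerivAt (fun z => w t - z) (-1) x := by
        simpa using (hasDerivAt_id x).const_sub (w t)
      have h2 := (h1.inv hne).smul_const (f t)
      refine h2.congr_deriv ?_
      simp)
  exact this.2.differentiableAt

lemma p4_sinh_le {y : ℝ} (hy : 0 ≤ y) : Real.sinh y ≤ y * Real.cosh y := by
  have hmono : MonotoneOn (fun y => y * Real.cosh y - Real.sinh y) (Set.Ici 0) := by
    refine monotoneOn_of_deriv_nonneg (convex_Ici 0) (by fun_prop) (by fun_prop) ?_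
    intro x hx
    rw [interior_Ici] at hx
    have h : HasDerivAt (fun y => y * Real.cosh y - Real.sinh y)
      (1 * Real.cosh x + x * Real.sinh x - Real.cosh x) x :=
      ((hasDerivAt_id x).mul (Real.hasDerivAt_cosh x)).sub (Real.hasDerivAt_sinh x)
    rw [h.deriv]
    have : 0 ≤ x * Real.sinh x := mul_nonneg (le_of_lt hx) (Real.sinh_nonneg_iff.2 (le_of_lt hx))
    linarith
  have := hmono (Set.mem_Ici.2 le_rfl) (Set.mem_Ici.2 hy) hy
  simp at this
  linarith

lemma p4_xcos {x : ℝ} (h0 : 0 ≤ x) (h1 : x ≤ π / 2) : x * Real.cos x ≤ Real.sin x := by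
  rcases h1.eq_or_lt with h | h
  · subst h; simp
  · have hc : 0 < Real.cos x := Real.cos_pos_of_mem_Ioo ⟨by linarith [Real.pi_pos], h⟩
    have := Real.le_tan h0 h
    rw [Real.tan_eq_sin_div_cos, le_div_iff₀ hc] at this
    exact this

lemma p4_half {x y : ℝ} (hx : |x| ≤ π / 2) (hy : |y| ≤ |x| / 2) :
    |Real.cos x * Real.sinh y| ≤ |Real.sin x * Real.cosh y| / 2 := by
  have hc : Real.cos x = Real.cos |x| := (Real.cos_abs x).symm
  have hs : |Real.sin x| = Real.sin |x| := by
    rw [Real.abs_sin_eq_sin_abs_of_abs_le_pi (by linarith [Real.pi_pos])]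
  have hsh : |Real.sinh y| = Real.sinh |y| := Real.abs_sinh y
  have hch : Real.cosh y = Real.cosh |y| := (Real.cosh_abs y).symm
  rw [abs_mul, abs_mul, hs, hsh, hc, hch, abs_of_pos (Real.cosh_pos _)]
  have hcp : 0 ≤ Real.cos |x| := Real.cos_nonneg_of_mem_Icc ⟨by linarith [abs_nonneg x, Real.pi_pos], hx⟩
  rw [abs_of_nonneg hcp]
  have h1 := p4_sinh_le (abs_nonneg y)
  have h2 := p4_xcos (abs_nonneg x) hx
  have h3 := Real.cosh_pos |y|
  calc Real.cos |x| * Real.sinh |y| ≤ Real.cos |x| * (|y| * Real.cosh |y|) := by gcongr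
    _ ≤ Real.cos |x| * (|x| / 2 * Real.cosh |y|) := by gcongr
    _ = (|x| * Real.cos |x|) * Real.cosh |y| / 2 := by ring
    _ ≤ _ := by gcongr

/-- kernel estimate -/
lemma p4_ker {l u v : ℝ} (hl : 0 < l) (hl1 : l < 1) (hu : |u| ≤ π) (hv : |v| ≤ |u| / 2) :
    ∃ D : ℂ, (1 - l * Complex.exp (v + u * Complex.I))⁻¹ -
        (1 - (l:ℂ)⁻¹ * Complex.exp (v + u * Complex.I))⁻¹ = (1 - (l:ℂ) ^ 2) / D ∧
      (1 - l) ^ 2 + 3 * l * (u / π) ^ 2 ≤ D.re ∧ |D.im| ≤ 4 / 3 * D.re := by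
  set s : ℂ := Complex.sin ((u : ℂ) / 2 - (v : ℂ) / 2 * Complex.I) with hs
  have hsre : s.re = Real.sin (u / 2) * Real.cosh (v / 2) := by
    rw [hs, show (u : ℂ) / 2 - (v : ℂ) / 2 * Complex.I = ((u / 2 : ℝ) : ℂ) + ((- (v / 2) : ℝ) : ℂ) * Complex.I by push_cast; ring]
    rw [Complex.sin_add_mul_I, ← Complex.ofReal_sin, ← Complex.ofReal_cos, ← Complex.ofReal_cosh,
      ← Complex.ofReal_sinh]
    rw [Complex.add_re, ← Complex.ofReal_mul, ← Complex.ofReal_mul, Complex.ofReal_re, Complex.re_ofReal_mul, Complex.I_re, Real.cosh_neg]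
    ring
  have hsim : s.im = -(Real.cos (u / 2) * Real.sinh (v / 2)) := by
    rw [hs, show (u : ℂ) / 2 - (v : ℂ) / 2 * Complex.I = ((u / 2 : ℝ) : ℂ) + ((- (v / 2) : ℝ) : ℂ) * Complex.I by push_cast; ring]
    rw [Complex.sin_add_mul_I, ← Complex.ofReal_sin, ← Complex.ofReal_cos, ← Complex.ofReal_cosh,
      ← Complex.ofReal_sinh]
    rw [Complex.add_im, ← Complex.ofReal_mul, ← Complex.ofReal_mul, Complex.ofReal_im, Complex.im_ofReal_mul, Complex.I_im, Real.sinh_neg]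
    ring
  have habs : |s.im| ≤ |s.re| / 2 := by
    rw [hsre, hsim, abs_neg]
    apply p4_half
    · rw [abs_div, abs_two]; linarith
    · rw [abs_div, abs_div, abs_two]; linarith
  have hlow : |u| / π ≤ |s.re| := by
    rw [hsre, abs_mul, abs_of_pos (Real.cosh_pos (v / 2))]
    have h1 : |Real.sin (u / 2)| = Real.sin |u / 2| := by
      rw [Real.abs_sin_eq_sin_abs_of_abs_le_pi (by rw [abs_div, abs_two]; linarith [Real.pi_pos])]
    have h2 := Real.mul_le_sin (abs_nonneg (u / 2)) (by rw [abs_div, abs_two]; linarith)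
    have h3 := Real.one_le_cosh (v / 2)
    rw [h1]
    have h4 : 2 / π * |u / 2| = |u| / π := by rw [abs_div, abs_two]; ring
    rw [h4] at h2
    have : 0 ≤ |u| / π := by positivity
    nlinarith
  have hsq1 : s.im ^ 2 ≤ s.re ^ 2 / 4 := by
    have : |s.im| ^ 2 ≤ (|s.re| / 2) ^ 2 := by gcongr
    rw [div_pow, sq_abs, sq_abs] at this
    linarith
  have hsq2 : (u / π) ^ 2 ≤ s.re ^ 2 := by
    have : (|u| / π) ^ 2 ≤ |s.re| ^ 2 := by gcongr
    rwa [div_pow, sq_abs, sq_abs, ← div_pow] at this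
  have hDre : ((1 - (l:ℂ)) ^ 2 + 4 * l * s ^ 2).re = (1 - l) ^ 2 + 4 * l * (s.re ^ 2 - s.im ^ 2) := by
    have : ((1 - (l:ℂ)) ^ 2 + 4 * l * s ^ 2) = (((1 - l) ^ 2 : ℝ) : ℂ) + ((4 * l : ℝ) : ℂ) * (s ^ 2) := by
      push_cast; ring
    rw [this, Complex.add_re, Complex.ofReal_re, Complex.re_ofReal_mul]
    congr 2
    rw [pow_two, Complex.mul_re]; ring
  have hDim : ((1 - (l:ℂ)) ^ 2 + 4 * l * s ^ 2).im = 4 * l * (2 * s.re * s.im) := by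
    have : ((1 - (l:ℂ)) ^ 2 + 4 * l * s ^ 2) = (((1 - l) ^ 2 : ℝ) : ℂ) + ((4 * l : ℝ) : ℂ) * (s ^ 2) := by
      push_cast; ring
    rw [this, Complex.add_im, Complex.ofReal_im, Complex.im_ofReal_mul, zero_add]
    congr 1
    rw [pow_two, Complex.mul_im]; ring
  have hre : (1 - l) ^ 2 + 3 * l * (u / π) ^ 2 ≤ ((1 - (l:ℂ)) ^ 2 + 4 * l * s ^ 2).re := by
    rw [hDre]; nlinarith
  refine ⟨(1 - (l:ℂ)) ^ 2 + 4 * l * s ^ 2, ?_, hre, ?_⟩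
  · set x := Complex.exp (v + u * Complex.I) with hx
    have hx0 : x ≠ 0 := Complex.exp_ne_zero _
    have hl0 : (l:ℂ) ≠ 0 := by exact_mod_cast hl.ne'
    have hD : (1 - (l:ℂ)) ^ 2 + 4 * l * s ^ 2 = (1 - l * x) * (1 - l * x⁻¹) := by
      have h4 : 4 * s ^ 2 = 2 - (x + x⁻¹) := by
        have hxx : x = Complex.exp (((u : ℂ) / 2 - (v : ℂ) / 2 * Complex.I) * Complex.I) ^ 2 := by
          rw [hx, ← Complex.exp_nat_mul]
          congr 1
          push_cast
          ring_nf
          rw [Complex.I_sq]; ring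
        have hxi : x⁻¹ = Complex.exp (-((u : ℂ) / 2 - (v : ℂ) / 2 * Complex.I) * Complex.I) ^ 2 := by
          rw [hxx, ← inv_pow, ← Complex.exp_neg]; congr 2; ring
        have h1 : Complex.exp (-((u : ℂ) / 2 - (v : ℂ) / 2 * Complex.I) * Complex.I) *
          Complex.exp (((u : ℂ) / 2 - (v : ℂ) / 2 * Complex.I) * Complex.I) = 1 := by
          rw [← Complex.exp_add, ← add_mul, neg_add_cancel, zero_mul, Complex.exp_zero]
        rw [hs, Complex.sin, hxi, hxx]
        set e1 := Complex.exp (((u : ℂ) / 2 - (v : ℂ) / 2 * Complex.I) * Complex.I)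
        set e2 := Complex.exp (-((u : ℂ) / 2 - (v : ℂ) / 2 * Complex.I) * Complex.I)
        have : 4 * ((e2 - e1) * Complex.I / 2) ^ 2 = (e2 - e1) ^ 2 * Complex.I ^ 2 := by ring
        rw [this, Complex.I_sq]
        linear_combination 2 * h1
      have : (1 - l * x) * (1 - l * x⁻¹) = 1 - l * (x + x⁻¹) + l ^ 2 * (x * x⁻¹) := by ring
      rw [this, mul_inv_cancel₀ hx0]
      linear_combination (l : ℂ) * h4
    have hDne : (1 - l * x) * (1 - l * x⁻¹) ≠ 0 := by
      rw [← hD]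
      intro h
      rw [h, Complex.zero_re] at hre
      have : 0 < (1 - l) ^ 2 := by have : 0 < 1 - l := by linarith
                                   positivity
      have : 0 ≤ 3 * l * (u / π) ^ 2 := by positivity
      linarith
    rw [hD]
    have hA := left_ne_zero_of_mul hDne
    have hB := right_ne_zero_of_mul hDne
    have hB' : 1 - (l:ℂ)⁻¹ * x ≠ 0 := by
      intro h
      apply hB
      field_simp at h ⊢
      linear_combination -h
    have e : (1 - (l:ℂ)⁻¹ * x)⁻¹ = - (l * x⁻¹) * (1 - l * x⁻¹)⁻¹ := by
      rw [inv_eq_iff_eq_inv, mul_inv, inv_inv]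
      field_simp
      ring
    rw [e, eq_div_iff hDne]
    have : ((1 - (l:ℂ) * x)⁻¹ - -((l:ℂ) * x⁻¹) * (1 - (l:ℂ) * x⁻¹)⁻¹) * ((1 - (l:ℂ) * x) * (1 - (l:ℂ) * x⁻¹))
      = ((1 - (l:ℂ) * x)⁻¹ * (1 - (l:ℂ) * x)) * (1 - (l:ℂ) * x⁻¹) + ((l:ℂ) * x⁻¹) *
        ((1 - (l:ℂ) * x⁻¹)⁻¹ * (1 - (l:ℂ) * x⁻¹)) * (1 - (l:ℂ) * x) := by ring
    rw [this, inv_mul_cancel₀ hA, inv_mul_cancel₀ hB]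
    have : x⁻¹ * x = 1 := inv_mul_cancel₀ hx0
    linear_combination (-(l:ℂ) ^ 2) * this
  · rw [hDre, hDim, abs_mul, abs_of_pos (by positivity : 0 < 4 * l), abs_mul, abs_mul, abs_two]
    have h1 : 0 ≤ |s.re| := abs_nonneg _
    have h2 : |s.re| * |s.im| ≤ s.re ^ 2 / 2 := by
      rw [← sq_abs s.re]; nlinarith
    have h3 : 0 ≤ (1 - l) ^ 2 := sq_nonneg _
    nlinarith

lemma p4_ker' {l u v : ℝ} (hl : 1 / 2 ≤ l) (hl1 : l < 1) (hu : |u| ≤ π) (hv : |v| ≤ |u| / 2) :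
    let k := (1 - l * Complex.exp (v + u * Complex.I))⁻¹ -
        (1 - (l:ℂ)⁻¹ * Complex.exp (v + u * Complex.I))⁻¹
    0 < k.re ∧ |k.im| ≤ 4 / 3 * k.re ∧ ‖k‖ ≤ 14 * ((1 - l) / ((1 - l) ^ 2 + u ^ 2)) := by
  intro k
  obtain ⟨D, hk, hre, him⟩ := p4_ker (by linarith) hl1 hu hv
  change k = _ at hk
  have hl2 : 0 < 1 - l ^ 2 := by nlinarith
  have h1l : 0 < 1 - l := by linarith
  have hpos : 0 < (1 - l) ^ 2 + 3 * l * (u / π) ^ 2 := by positivity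
  have hDre : 0 < D.re := hpos.trans_le hre
  have hD0 : D ≠ 0 := by rintro rfl; simp at hDre
  have hns : 0 < Complex.normSq D := Complex.normSq_pos.2 hD0
  have hk' : k = ((1 - l ^ 2 : ℝ) : ℂ) * D⁻¹ := by rw [hk]; push_cast; rw [div_eq_mul_inv]
  have kre : k.re = (1 - l ^ 2) * (D.re / Complex.normSq D) := by
    rw [hk', Complex.re_ofReal_mul, Complex.inv_re]
  have kim : k.im = (1 - l ^ 2) * (-D.im / Complex.normSq D) := by
    rw [hk', Complex.im_ofReal_mul, Complex.inv_im]
  refine ⟨by rw [kre]; positivity, ?_, ?_⟩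
  · rw [kre, kim, abs_mul, abs_of_pos hl2, abs_div, abs_neg, abs_of_pos hns]
    calc (1 - l ^ 2) * (|D.im| / Complex.normSq D) ≤ (1 - l ^ 2) * (4 / 3 * D.re / Complex.normSq D) := by
          gcongr
      _ = _ := by ring
  · rw [hk', norm_mul, norm_inv, Complex.norm_real, Real.norm_of_nonneg hl2.le]
    have h1 : D.re ≤ ‖D‖ := Complex.re_le_norm D
    have h2 : (1 - l) ^ 2 + 3 / 2 * (u / π) ^ 2 ≤ ‖D‖ := by
      have : 0 ≤ (l - 1/2) * (u / π) ^ 2 := mul_nonneg (by linarith) (sq_nonneg _)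
      linarith
    have hpi : π ^ 2 ≤ 10 := by nlinarith [Real.pi_lt_d2, Real.pi_pos]
    have h3 : u ^ 2 / 10 ≤ (u / π) ^ 2 := by
      rw [div_pow]; gcongr
    have h4 : ((1 - l) ^ 2 + u ^ 2) / 7 ≤ ‖D‖ := by nlinarith [sq_nonneg u, sq_nonneg (1 - l)]
    have h5 : 0 < (1 - l) ^ 2 + u ^ 2 := by positivity
    rw [← div_eq_mul_inv, ← mul_div_assoc, div_le_div_iff₀ (norm_pos_iff.2 hD0) h5]
    have h6 : 1 - l ^ 2 ≤ 2 * (1 - l) := by nlinarith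
    calc (1 - l ^ 2) * ((1 - l) ^ 2 + u ^ 2) ≤ (2 * (1 - l)) * (7 * ‖D‖) := by
          gcongr; linarith
      _ = _ := by ring

noncomputable def p4w (ψ : ℝ → ℝ) (θ : ℝ) : ℂ := Complex.exp (ψ θ + θ * Complex.I)

def p4Cls (ψ : ℝ → ℝ) : Set (ℂ → ℂ) := {F | ∃ (V : Set ℂ) (R : ℝ), IsOpen V ∧ 1 < R ∧
  DifferentiableOn ℂ F V ∧ ∀ θ l : ℝ, 0 ≤ l → l < R → (l : ℂ) * p4w ψ θ ∈ V}

lemma p4Cls_add {ψ : ℝ → ℝ} {F G : ℂ → ℂ} (hF : F ∈ p4Cls ψ) (hG : G ∈ p4Cls ψ) :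
    (fun z => F z + G z) ∈ p4Cls ψ := by
  obtain ⟨V, R, hV, hR, hd, h⟩ := hF
  obtain ⟨V', R', hV', hR', hd', h'⟩ := hG
  exact ⟨V ∩ V', min R R', hV.inter hV', lt_min hR hR',
    (hd.mono Set.inter_subset_left).add (hd'.mono Set.inter_subset_right),
    fun θ l h0 h1 => ⟨h θ l h0 (h1.trans_le (min_le_left _ _)), h' θ l h0 (h1.trans_le (min_le_right _ _))⟩⟩

lemma p4Cls_mul {ψ : ℝ → ℝ} {F G : ℂ → ℂ} (hF : F ∈ p4Cls ψ) (hG : G ∈ p4Cls ψ) :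
    (fun z => F z * G z) ∈ p4Cls ψ := by
  obtain ⟨V, R, hV, hR, hd, h⟩ := hF
  obtain ⟨V', R', hV', hR', hd', h'⟩ := hG
  exact ⟨V ∩ V', min R R', hV.inter hV', lt_min hR hR',
    (hd.mono Set.inter_subset_left).mul (hd'.mono Set.inter_subset_right),
    fun θ l h0 h1 => ⟨h θ l h0 (h1.trans_le (min_le_left _ _)), h' θ l h0 (h1.trans_le (min_le_right _ _))⟩⟩

lemma p4Cls_const {ψ : ℝ → ℝ} (c : ℂ) : (fun _ => c) ∈ p4Cls ψ :=
  ⟨Set.univ, 2, isOpen_univ, by norm_num, differentiableOn_const _, fun _ _ _ _ => trivial⟩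

lemma p4Cls_cont {ψ : ℝ → ℝ} (hψ : Continuous ψ) {F : ℂ → ℂ} (hF : F ∈ p4Cls ψ) :
    Continuous (fun θ => F (p4w ψ θ)) := by
  obtain ⟨V, R, hV, hR, hd, h⟩ := hF
  refine continuous_iff_continuousAt.2 fun θ => ?_
  have h1 : p4w ψ θ ∈ V := by simpa using h θ 1 zero_le_one hR
  exact ContinuousAt.comp (f := p4w ψ) (hd.differentiableAt (hV.mem_nhds h1)).continuousAt
    (by unfold p4w; fun_prop)

lemma p4_dens {ψ : ℝ → ℝ} (hψ : Continuous ψ) {S : Set ℝ} (hS : MeasurableSet S)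
    (hSs : S ⊆ Set.Ioc (-π) π) {c : ℝ}
    (hb : ∀ F ∈ p4Cls ψ, ‖F 0‖ ≤ c * ∫ θ in S, ‖F (p4w ψ θ)‖) :
    ∃ q : ℝ → ℝ, (∀ θ, 0 ≤ q θ) ∧ Integrable q ∧ (∀ θ, θ ∉ S → q θ = 0) ∧ ∫ θ, q θ = 1 ∧
      ∀ F ∈ p4Cls ψ, F 0 = 0 → ∫ θ, (q θ : ℂ) * F (p4w ψ θ) = 0 := by
  set μ : Measure ℝ := volume.restrict S with hμ
  have : IsFiniteMeasure μ := ⟨by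
    rw [hμ, Measure.restrict_apply_univ]
    exact (measure_mono hSs).trans_lt (by simp)⟩
  have hbd : ∀ F ∈ p4Cls ψ, ∃ B, ∀ᵐ θ ∂μ, ‖F (p4w ψ θ)‖ ≤ B := by
    intro F hF
    obtain ⟨B, hB⟩ := isCompact_Icc.exists_bound_of_continuousOn (s := Set.Icc (-π) π)
      (p4Cls_cont hψ hF).continuousOn
    refine ⟨B, ?_⟩
    rw [hμ]
    filter_upwards [ae_restrict_mem hS] with θ hθ
    exact hB θ (Set.Ioc_subset_Icc_self (hSs hθ))
  have hmem : ∀ F ∈ p4Cls ψ, MemLp (fun θ => F (p4w ψ θ)) 2 μ := by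
    intro F hF
    obtain ⟨B, hB⟩ := hbd F hF
    exact MemLp.of_bound (p4Cls_cont hψ hF).aestronglyMeasurable B hB
  let M0 : Submodule ℂ (Lp ℂ 2 μ) :=
    { carrier := {φ | ∃ F ∈ p4Cls ψ, F 0 = 0 ∧ φ =ᵐ[μ] fun θ => F (p4w ψ θ)}
      add_mem' := by
        rintro a b ⟨F, hF, hF0, ha⟩ ⟨G, hG, hG0, hb⟩
        refine ⟨_, p4Cls_add hF hG, by simp [hF0, hG0], ?_⟩
        filter_upwards [ha, hb, Lp.coeFn_add a b] with θ h1 h2 h3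
        rw [h3, Pi.add_apply, h1, h2]
      zero_mem' := ⟨fun _ => 0, p4Cls_const 0, rfl, Lp.coeFn_zero ℂ 2 μ⟩
      smul_mem' := by
        rintro k a ⟨F, hF, hF0, ha⟩
        refine ⟨_, p4Cls_mul (p4Cls_const k) hF, by simp [hF0], ?_⟩
        filter_upwards [ha, Lp.coeFn_smul k a] with θ h1 h3
        rw [h3, Pi.smul_apply, h1, smul_eq_mul] }
  have hM0 : ∀ φ, φ ∈ M0 ↔ ∃ F ∈ p4Cls ψ, F 0 = 0 ∧ φ =ᵐ[μ] fun θ => F (p4w ψ θ) := fun φ => Iff.rfl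
  let e : Lp ℂ 2 μ := (hmem _ (p4Cls_const 1)).toLp
  have he : e =ᵐ[μ] fun _ => (1:ℂ) := (hmem _ (p4Cls_const 1)).coeFn_toLp
  let K := M0.topologicalClosure
  have hKc : IsComplete (K : Set (Lp ℂ 2 μ)) := (M0.isClosed_topologicalClosure).isComplete
  have : CompleteSpace K := hKc.completeSpace_coe
  let P := K.starProjection e
  have hP : P ∈ K := K.starProjection_apply_mem e
  let s := e - P
  have hs : s ∈ Kᗮ := K.sub_starProjection_mem_orthogonal e
  have hs0 : s ≠ 0 := by
    intro h0
    have heK : e ∈ K := by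
      have : e = P := sub_eq_zero.1 h0
      rw [this]; exact hP
    have hcl : IsClosed {x : Lp ℂ 2 μ | 1 ≤ c * ∫ θ, ‖(e - x) θ‖ ∂μ} := by
      refine isClosed_le continuous_const (Continuous.mul continuous_const ?_)
      have h1 : ∀ x : Lp ℂ 2 μ, ∫ θ, ‖x θ‖ ∂μ = (eLpNorm x 1 μ).toReal := by
        intro x
        rw [eLpNorm_one_eq_lintegral_enorm, integral_norm_eq_lintegral_enorm (Lp.aestronglyMeasurable x)]
      have h2 : ∀ x : Lp ℂ 2 μ, ∫ θ, ‖x θ‖ ∂μ ≤ ‖x‖ * (μ Set.univ).toReal ^ (1 / 2 : ℝ) := by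
        intro x
        rw [h1]
        have h3 := eLpNorm_le_eLpNorm_mul_rpow_measure_univ (p := 1) (q := 2) (μ := μ) (by norm_num)
          (Lp.aestronglyMeasurable x)
        have h4 := ENNReal.toReal_mono (ENNReal.mul_ne_top (Lp.eLpNorm_ne_top x)
          (ENNReal.rpow_ne_top_of_nonneg (by norm_num) (measure_ne_top μ _))) h3
        rw [ENNReal.toReal_mul, ← ENNReal.toReal_rpow] at h4
        rw [Lp.norm_def]
        convert h4 using 3
        norm_num
      have hi : ∀ x : Lp ℂ 2 μ, Integrable x μ := fun x =>
        (Lp.memLp x).integrable (by norm_num)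
      have h5 : LipschitzWith (Real.toNNReal ((μ Set.univ).toReal ^ (1 / 2 : ℝ)))
          (fun x : Lp ℂ 2 μ => ∫ θ, ‖x θ‖ ∂μ) := by
        refine LipschitzWith.of_dist_le_mul fun x y => ?_
        rw [Real.dist_eq, ← integral_sub (hi x).norm (hi y).norm, dist_eq_norm,
          Real.coe_toNNReal _ (by positivity), mul_comm]
        refine le_trans ?_ (h2 (x - y))
        rw [← Real.norm_eq_abs]
        refine (norm_integral_le_integral_norm (fun θ => ‖x θ‖ - ‖y θ‖)).trans ?_
        refine integral_mono_of_nonneg (Eventually.of_forall fun _ => norm_nonneg _) (hi _).norm ?_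
        filter_upwards [Lp.coeFn_sub x y] with θ h
        rw [h, Pi.sub_apply]
        exact abs_norm_sub_norm_le _ _
      exact h5.continuous.comp (continuous_const.sub continuous_id)
    have hsub : (M0 : Set (Lp ℂ 2 μ)) ⊆ {x : Lp ℂ 2 μ | 1 ≤ c * ∫ θ, ‖(e - x) θ‖ ∂μ} := by
      rintro x ⟨F, hF, hF0, hx⟩
      have h1 := hb _ (p4Cls_add (p4Cls_const 1) (p4Cls_mul (p4Cls_const (-1)) hF))
      simp only [hF0, mul_zero, add_zero, norm_one] at h1
      change 1 ≤ c * ∫ θ, ‖(e - x) θ‖ ∂μ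
      rw [integral_congr_ae (g := fun θ => ‖1 + -1 * F (p4w ψ θ)‖)]
      · exact h1
      · filter_upwards [hx, he, Lp.coeFn_sub e x] with θ h1 h2 h3
        simp only [h3, Pi.sub_apply, h1, h2]
        ring_nf
    have h2 := closure_minimal hsub hcl heK
    have h3 : 1 ≤ c * ∫ θ, ‖(e - e) θ‖ ∂μ := h2
    rw [sub_self, integral_congr_ae (g := fun _ => 0) (by
      filter_upwards [Lp.coeFn_zero ℂ 2 μ] with θ h
      rw [h]; simp)] at h3
    simp at h3
    linarith
  have hmain : ∀ F ∈ p4Cls ψ, F 0 = 0 → ∫ θ, ((‖s θ‖ ^ 2 : ℝ) : ℂ) * F (p4w ψ θ) ∂μ = 0 := by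
    intro F hF hF0
    obtain ⟨B, hB⟩ := hbd F hF
    have hT : MemLp (fun θ => s θ * (starRingEnd ℂ) (F (p4w ψ θ))) 2 μ := by
      refine MemLp.of_le_mul (c := B) (Lp.memLp s) ((Lp.aestronglyMeasurable s).mul
        (Complex.continuous_conj.comp (p4Cls_cont hψ hF)).aestronglyMeasurable) ?_
      filter_upwards [hB] with θ h
      rw [norm_mul, RCLike.norm_conj, mul_comm]
      gcongr
    have hTe := hT.coeFn_toLp
    set T := hT.toLp
    have hcl : IsClosed {x : Lp ℂ 2 μ | inner ℂ T (e - x) = 0} :=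
      isClosed_eq (continuous_const.inner (continuous_const.sub continuous_id)) continuous_const
    have hsub : (M0 : Set (Lp ℂ 2 μ)) ⊆ {x : Lp ℂ 2 μ | inner ℂ T (e - x) = 0} := by
      rintro x ⟨G, hG, hG0, hx⟩
      have hGF := p4Cls_mul (p4Cls_add (p4Cls_const 1) (p4Cls_mul (p4Cls_const (-1)) hG)) hF
      have hy : (hmem _ hGF).toLp ∈ M0 := ⟨_, hGF, by simp [hF0], (hmem _ hGF).coeFn_toLp⟩
      have horth : inner ℂ s (hmem _ hGF).toLp = 0 := by
        rw [← inner_conj_symm, hs _ (M0.le_topologicalClosure hy), map_zero]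
      change inner ℂ T (e - x) = 0
      rw [← horth, L2.inner_def, L2.inner_def]
      refine integral_congr_ae ?_
      filter_upwards [hx, he, Lp.coeFn_sub e x, hTe, (hmem _ hGF).coeFn_toLp] with θ h1 h2 h3 h4 h5
      rw [h3, h4, h5, Pi.sub_apply, h1, h2]
      simp only [RCLike.inner_apply, map_mul, Complex.conj_conj]
      ring
    have h2 : inner ℂ T (e - P) = 0 := closure_minimal hsub hcl hP
    change inner ℂ T s = 0 at h2
    rw [L2.inner_def] at h2
    rw [← h2]
    refine integral_congr_ae ?_
    filter_upwards [hTe] with θ h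
    rw [h]
    simp only [RCLike.inner_apply, map_mul, Complex.conj_conj]
    rw [← Complex.normSq_eq_norm_sq, Complex.normSq_eq_conj_mul_self]
    ring
  have hint : Integrable (fun θ => ‖s θ‖ ^ 2) μ := (Lp.memLp s).integrable_norm_pow (by norm_num)
  have hnorm : ∫ θ, ‖s θ‖ ^ 2 ∂μ ≠ 0 := by
    intro h
    apply hs0
    rw [integral_eq_zero_iff_of_nonneg (fun θ => by positivity) hint] at h
    rw [Lp.eq_zero_iff_ae_eq_zero]
    filter_upwards [h] with θ hθ
    simpa using hθ
  refine ⟨fun θ => S.indicator (fun θ => ‖s θ‖ ^ 2) θ / ∫ θ, ‖s θ‖ ^ 2 ∂μ, ?_, ?_, ?_, ?_, ?_⟩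
  · intro θ
    exact div_nonneg (Set.indicator_nonneg (fun _ _ => by positivity) _)
      (integral_nonneg fun _ => by positivity)
  · exact ((integrable_indicator_iff hS).2 hint).div_const _
  · intro θ hθ; simp [hθ]
  · rw [integral_div, integral_indicator hS, div_self hnorm]
  · intro F hF hF0
    have h1 := hmain F hF hF0
    have h2 : (fun θ => ((S.indicator (fun θ => ‖s θ‖ ^ 2) θ / ∫ θ, ‖s θ‖ ^ 2 ∂μ : ℝ) : ℂ) * F (p4w ψ θ))
      = fun θ => ((∫ θ, ‖s θ‖ ^ 2 ∂μ : ℝ) : ℂ)⁻¹ *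
        S.indicator (fun θ => ((‖s θ‖ ^ 2 : ℝ) : ℂ) * F (p4w ψ θ)) θ := by
      funext θ
      by_cases h : θ ∈ S
      · rw [Set.indicator_of_mem h, Set.indicator_of_mem h, Complex.ofReal_div]
        ring
      · simp [h]
    rw [h2, integral_const_mul, integral_indicator hS, h1, mul_zero]

noncomputable def p4l (n : ℕ) : ℝ := 1 - 1 / ((n:ℝ) + 2)

lemma p4l_half (n : ℕ) : 1 / 2 ≤ p4l n := by
  unfold p4l
  have : 1 / ((n:ℝ) + 2) ≤ 1 / 2 := by
    apply one_div_le_one_div_of_le (by norm_num)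
    have : (0:ℝ) ≤ n := n.cast_nonneg
    linarith
  linarith

lemma p4l_lt (n : ℕ) : p4l n < 1 := by
  unfold p4l
  have : 0 < 1 / ((n:ℝ) + 2) := by positivity
  linarith

lemma p4l_tendsto : Tendsto p4l atTop (𝓝 1) := by
  have h : Tendsto (fun n : ℕ => 1 / ((n:ℝ) + 2)) atTop (𝓝 0) :=
    tendsto_const_nhds.div_atTop (tendsto_natCast_atTop_atTop.atTop_add tendsto_const_nhds)
  have h2 := h.const_sub 1
  rw [sub_zero] at h2
  exact h2

lemma p4w_cont {ψ : ℝ → ℝ} (hψ : Continuous ψ) : Continuous (p4w ψ) := by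
  unfold p4w; fun_prop

lemma p4w_ne (ψ : ℝ → ℝ) (θ : ℝ) : p4w ψ θ ≠ 0 := Complex.exp_ne_zero _

lemma p4_boundA {ψ : ℝ → ℝ} (hψ : LipschitzWith (1/2) ψ) (hper : Function.Periodic ψ (2 * π))
    {V : Set ℂ} (hV : IsOpen V) {f : ℂ → ℂ} (hf : DifferentiableOn ℂ f V)
    (hin : ∀ θ l : ℝ, 0 ≤ l → l < 1 → (l : ℂ) * p4w ψ θ ∈ V) {M : ℝ}
    (hM : ∀ θ l : ℝ, 0 ≤ l → l < 1 → ‖f ((l : ℂ) * p4w ψ θ)‖ ≤ M)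
    {Z : Set ℝ} (hZ : MeasurableSet Z)
    (hZ0 : ∀ θ ∈ Z, Tendsto (fun n => f (p4l n * p4w ψ θ)) atTop (𝓝 0))
    {F : ℂ → ℂ} (hF : F ∈ p4Cls ψ) :
    2 * π * (‖f 0‖ * ‖F 0‖) ≤ 2 * M * ∫ θ in Set.Ioc (-π) π \ Z, ‖F (p4w ψ θ)‖ := by
  have hwc := p4w_cont hψ.continuous
  have hFc := p4Cls_cont hψ.continuous hF
  obtain ⟨V', R, hV', hR, hd, hin'⟩ := hF
  have hM0 : 0 ≤ M := (norm_nonneg _).trans (hM 0 0 le_rfl one_pos)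
  have hl0 : ∀ n, 0 ≤ p4l n := fun n => le_trans (by norm_num) (p4l_half n)
  have hψp : ψ π = ψ (-π) := by
    have := hper (-π); rw [← this]; congr 1; ring
  have hψb : ∀ θ, ‖((deriv ψ θ : ℝ) : ℂ) + Complex.I‖ ≤ 2 := fun θ =>
    (norm_add_le _ _).trans (by
      rw [Complex.norm_I, Complex.norm_real]
      have := norm_deriv_le_of_lipschitz hψ (x₀ := θ)
      norm_num at this ⊢
      linarith)
  obtain ⟨B, hB⟩ : ∃ B, ∀ l ∈ Set.Icc (0:ℝ) 1, ∀ θ ∈ Set.Icc (-π) π, ‖F (l * p4w ψ θ)‖ ≤ B := by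
    have hc : ContinuousOn (fun p : ℝ × ℝ => F (p.1 * p4w ψ p.2)) (Set.Icc (0:ℝ) 1 ×ˢ Set.Icc (-π) π) :=
      hd.continuousOn.comp (by fun_prop) (fun p hp => hin' p.2 p.1 hp.1.1 (hp.1.2.trans_lt hR))
    obtain ⟨B, hB⟩ := (isCompact_Icc.prod isCompact_Icc).exists_bound_of_continuousOn hc
    exact ⟨B, fun l hl θ hθ => hB (l, θ) ⟨hl, hθ⟩⟩
  have hB0 : 0 ≤ B := (norm_nonneg _).trans (hB 0 (by simp) 0 (by simp [Real.pi_pos.le]))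
  have hfc : ∀ n, Continuous (fun θ => f (p4l n * p4w ψ θ)) := fun n =>
    continuous_iff_continuousAt.2 fun θ => ContinuousAt.comp (f := fun θ => (p4l n : ℂ) * p4w ψ θ)
      (hf.differentiableAt (hV.mem_nhds (hin θ _ (hl0 n) (p4l_lt n)))).continuousAt (by fun_prop)
  have hFnc : ∀ n, Continuous (fun θ => F (p4l n * p4w ψ θ)) := fun n =>
    continuous_iff_continuousAt.2 fun θ => ContinuousAt.comp (f := fun θ => (p4l n : ℂ) * p4w ψ θ)
      (hd.differentiableAt (hV'.mem_nhds (hin' θ _ (hl0 n) ((p4l_lt n).trans hR)))).continuousAt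
      (by fun_prop)
  set h : ℕ → ℝ → ℝ := fun n => Z.indicator (fun θ => 2 * ‖F (p4l n * p4w ψ θ)‖ * ‖f (p4l n * p4w ψ θ)‖)
    + Zᶜ.indicator (fun θ => 2 * ‖F (p4l n * p4w ψ θ)‖ * M) with hh
  have hhZ : ∀ n, ∀ θ ∈ Z, h n θ = 2 * ‖F (p4l n * p4w ψ θ)‖ * ‖f (p4l n * p4w ψ θ)‖ := by
    intro n θ hθ; simp [hh, hθ]
  have hhZ' : ∀ n, ∀ θ ∉ Z, h n θ = 2 * ‖F (p4l n * p4w ψ θ)‖ * M := by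
    intro n θ hθ; simp [hh, hθ]
  have hfM : ∀ n θ, ‖f (p4l n * p4w ψ θ)‖ ≤ M := fun n θ => hM θ _ (hl0 n) (p4l_lt n)
  have hnorm : ∀ n, ∀ θ, 2 * ‖F (p4l n * p4w ψ θ)‖ * ‖f (p4l n * p4w ψ θ)‖ ≤ h n θ := by
    intro n θ
    by_cases hθ : θ ∈ Z
    · rw [hhZ n θ hθ]
    · rw [hhZ' n θ hθ]; gcongr; exact hfM n θ
  have hle : ∀ n, ∀ θ ∈ Set.Ioc (-π) π, ‖h n θ‖ ≤ 2 * B * M := by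
    intro n θ hθ
    have h1 := hB (p4l n) ⟨hl0 n, (p4l_lt n).le⟩ θ (Set.Ioc_subset_Icc_self hθ)
    rw [Real.norm_of_nonneg ((by positivity : 0 ≤ 2 * ‖F (p4l n * p4w ψ θ)‖ * ‖f (p4l n * p4w ψ θ)‖).trans (hnorm n θ))]
    by_cases hθ : θ ∈ Z
    · rw [hhZ n θ hθ]; gcongr; exact hfM n θ
    · rw [hhZ' n θ hθ]; gcongr
  have hmeas : ∀ n, AEStronglyMeasurable (h n) (volume.restrict (Set.Ioc (-π) π)) := by
    intro n
    have h1 := hfc n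
    have h2 := hFnc n
    exact (((continuous_const.mul h2.norm).mul h1.norm).aestronglyMeasurable.indicator hZ).add
      (((continuous_const.mul h2.norm).mul continuous_const).aestronglyMeasurable.indicator hZ.compl)
  have hint : ∀ n, IntegrableOn (h n) (Set.Ioc (-π) π) := by
    intro n
    refine Integrable.mono' (g := fun _ => 2 * B * M) (integrable_const _) (hmeas n) ?_
    filter_upwards [ae_restrict_mem measurableSet_Ioc] with θ hθ using hle n θ hθ
  have hlow : ∀ n, 2 * π * (‖f 0‖ * ‖F 0‖) ≤ ∫ θ in Set.Ioc (-π) π, h n θ := by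
    intro n
    have hc := p4_cauchy (F := fun z => F z * f z) hψ hψp (hV.inter hV')
      ((hd.mono Set.inter_subset_right).mul (hf.mono Set.inter_subset_left)) (R := 1)
      (fun θ l h0 h1 => ⟨hin θ l h0 h1, hin' θ l h0 (h1.trans hR)⟩) (hl0 n) (p4l_lt n)
    have h1 : 2 * π * (‖f 0‖ * ‖F 0‖) = ‖(2 * π * Complex.I * (F 0 * f 0) : ℂ)‖ := by
      simp [abs_of_pos Real.pi_pos]; ring
    rw [h1, ← hc, intervalIntegral.integral_of_le (by linarith [Real.pi_pos])]
    refine (norm_integral_le_integral_norm _).trans ?_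
    refine integral_mono_of_nonneg (Eventually.of_forall fun _ => norm_nonneg _) (hint n) ?_
    refine Eventually.of_forall fun θ => ?_
    refine le_trans ?_ (hnorm n θ)
    simp only [norm_mul]
    change ‖F (p4l n * p4w ψ θ)‖ * ‖f (p4l n * p4w ψ θ)‖ * _ ≤ _
    have := hψb θ
    have h3 : 0 ≤ ‖F (p4l n * p4w ψ θ)‖ * ‖f (p4l n * p4w ψ θ)‖ := by positivity
    nlinarith
  set hlim : ℝ → ℝ := Zᶜ.indicator (fun θ => 2 * ‖F (p4w ψ θ)‖ * M) with hhl
  have htend : Tendsto (fun n => ∫ θ in Set.Ioc (-π) π, h n θ) atTop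
      (𝓝 (∫ θ in Set.Ioc (-π) π, hlim θ)) := by
    refine tendsto_integral_of_dominated_convergence (fun _ => 2 * B * M) hmeas (integrable_const _)
      (fun n => ?_) ?_
    · filter_upwards [ae_restrict_mem measurableSet_Ioc] with θ hθ using hle n θ hθ
    · filter_upwards [ae_restrict_mem measurableSet_Ioc] with θ hθ
      have hFt : Tendsto (fun n => F (p4l n * p4w ψ θ)) atTop (𝓝 (F (p4w ψ θ))) := by
        have h1 : p4w ψ θ ∈ V' := by simpa using hin' θ 1 zero_le_one hR
        have h2 := (hd.differentiableAt (hV'.mem_nhds h1)).continuousAt.tendsto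
        refine h2.comp ?_
        have h3 : Tendsto (fun n => (p4l n : ℂ)) atTop (𝓝 ((1:ℝ):ℂ)) :=
          (Complex.continuous_ofReal.tendsto 1).comp p4l_tendsto
        simpa using h3.mul_const (p4w ψ θ)
      by_cases hz : θ ∈ Z
      · have : hlim θ = 0 := by simp [hhl, hz]
        rw [this]
        have h4 := (hFt.norm.const_mul 2).mul (hZ0 θ hz).norm
        rw [norm_zero, mul_zero] at h4
        exact h4.congr fun n => (hhZ n θ hz).symm
      · have : hlim θ = 2 * ‖F (p4w ψ θ)‖ * M := by simp [hhl, hz]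
        rw [this]
        exact ((hFt.norm.const_mul 2).mul_const M).congr fun n => (hhZ' n θ hz).symm
  have hfin := ge_of_tendsto' htend hlow
  refine hfin.trans (le_of_eq ?_)
  rw [hhl, setIntegral_indicator hZ.compl, ← Set.sdiff_eq, ← integral_const_mul]
  refine integral_congr_ae (Eventually.of_forall fun θ => ?_)
  simp only []
  ring

lemma p4_ker2 {l u v : ℝ} (hl : 0 < l) (hl1 : l < 1) (hu : |u| ≤ π) (hv : |v| ≤ |u| / 2) :
    let k := (1 - l * Complex.exp (v + u * Complex.I))⁻¹ -
        (1 - (l:ℂ)⁻¹ * Complex.exp (v + u * Complex.I))⁻¹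
    0 < k.re ∧ |k.im| ≤ 4 / 3 * k.re ∧ ‖k‖ ≤ 2 / (1 - l) := by
  intro k
  obtain ⟨D, hk, hre, him⟩ := p4_ker hl hl1 hu hv
  change k = _ at hk
  have hl2 : 0 < 1 - l ^ 2 := by nlinarith
  have h1l : 0 < 1 - l := by linarith
  have hpos : 0 < (1 - l) ^ 2 + 3 * l * (u / π) ^ 2 := by positivity
  have hDre : 0 < D.re := hpos.trans_le hre
  have hD0 : D ≠ 0 := by rintro rfl; simp at hDre
  have hns : 0 < Complex.normSq D := Complex.normSq_pos.2 hD0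
  have hk' : k = ((1 - l ^ 2 : ℝ) : ℂ) * D⁻¹ := by rw [hk]; push_cast; rw [div_eq_mul_inv]
  have kre : k.re = (1 - l ^ 2) * (D.re / Complex.normSq D) := by
    rw [hk', Complex.re_ofReal_mul, Complex.inv_re]
  have kim : k.im = (1 - l ^ 2) * (-D.im / Complex.normSq D) := by
    rw [hk', Complex.im_ofReal_mul, Complex.inv_im]
  refine ⟨by rw [kre]; positivity, ?_, ?_⟩
  · rw [kre, kim, abs_mul, abs_of_pos hl2, abs_div, abs_neg, abs_of_pos hns]
    calc (1 - l ^ 2) * (|D.im| / Complex.normSq D) ≤ (1 - l ^ 2) * (4 / 3 * D.re / Complex.normSq D) := by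
          gcongr
      _ = _ := by ring
  · rw [hk', norm_mul, norm_inv, Complex.norm_real, Real.norm_of_nonneg hl2.le]
    have h1 : D.re ≤ ‖D‖ := Complex.re_le_norm D
    have h2 : (1 - l) ^ 2 ≤ ‖D‖ := by
      have : 0 ≤ 3 * l * (u / π) ^ 2 := by positivity
      linarith
    rw [← div_eq_mul_inv, div_le_div_iff₀ (norm_pos_iff.2 hD0) h1l]
    nlinarith

lemma p4w_per {ψ : ℝ → ℝ} (hper : Function.Periodic ψ (2 * π)) :
    Function.Periodic (p4w ψ) (2 * π) := by
  intro θ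
  unfold p4w
  rw [hper θ]
  push_cast
  rw [show (ψ θ : ℂ) + (θ + 2 * π) * Complex.I = (ψ θ + θ * Complex.I) + 2 * π * Complex.I by ring]
  exact Complex.exp_periodic _

lemma p4_rel {ψ : ℝ → ℝ} (hψ : LipschitzWith (1/2) ψ) (hper : Function.Periodic ψ (2 * π))
    {θ₀ θ : ℝ} (h0 : θ₀ ∈ Set.Icc (-π) π) (h1 : θ ∈ Set.Icc (-π) π) :
    ∃ u v : ℝ, |u| ≤ π ∧ |v| ≤ |u| / 2 ∧ p4w ψ θ₀ = p4w ψ θ * Complex.exp (v + u * Complex.I) ∧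
      (u = θ₀ - θ ∨ π - |θ₀| ≤ |u|) := by
  have hb : ∀ a b : ℝ, |ψ a - ψ b| ≤ |a - b| / 2 := by
    intro a b
    have := hψ.dist_le_mul a b
    rw [Real.dist_eq, Real.dist_eq] at this
    norm_num at this
    linarith
  have hkey : ∀ θ₁ : ℝ, p4w ψ θ₀ = p4w ψ θ₁ → |θ₁ - θ| ≤ π → (θ₁ - θ = θ₀ - θ ∨ π - |θ₀| ≤ |θ₁ - θ|) →
      ∃ u v : ℝ, |u| ≤ π ∧ |v| ≤ |u| / 2 ∧ p4w ψ θ₀ = p4w ψ θ * Complex.exp (v + u * Complex.I) ∧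
      (u = θ₀ - θ ∨ π - |θ₀| ≤ |u|) := by
    intro θ₁ h h2 h3
    refine ⟨θ₁ - θ, ψ θ₁ - ψ θ, h2, hb _ _, ?_, h3⟩
    rw [h]
    unfold p4w
    rw [← Complex.exp_add]
    congr 1
    push_cast
    ring
  have hp := p4w_per hper
  obtain ⟨h0a, h0b⟩ := h0
  obtain ⟨h1a, h1b⟩ := h1
  have hpi := Real.pi_pos
  by_cases hc : |θ₀ - θ| ≤ π
  · exact hkey θ₀ rfl hc (Or.inl rfl)
  · rcases le_total θ θ₀ with h | h
    · rw [abs_of_nonneg (by linarith)] at hc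
      refine hkey (θ₀ - 2 * π) (by rw [hp.sub_eq]) ?_ (Or.inr ?_)
      · rw [abs_le]; constructor <;> linarith
      · have := neg_abs_le (θ₀ - 2 * π - θ); have := le_abs_self θ₀; 
        rw [abs_of_nonpos (by linarith : θ₀ - 2 * π - θ ≤ 0)]; linarith
    · rw [abs_of_nonpos (by linarith)] at hc
      refine hkey (θ₀ + 2 * π) (by rw [hp θ₀]) ?_ (Or.inr ?_)
      · rw [abs_le]; constructor <;> linarith
      · have := neg_abs_le θ₀
        rw [abs_of_nonneg (by linarith : 0 ≤ θ₀ + 2 * π - θ)]; linarith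

lemma p4_sep {ψ : ℝ → ℝ} (hψ : LipschitzWith (1/2) ψ) (hper : Function.Periodic ψ (2 * π))
    (θ₀ θ : ℝ) {l : ℝ} (hl : 0 ≤ l) (hl1 : l < 1) : (l:ℂ) * p4w ψ θ₀ ≠ p4w ψ θ := by
  intro he
  have hp := p4w_per hper
  obtain ⟨a, ha, hae⟩ := hp.exists_mem_Ioc (by positivity : 0 < 2 * π) θ₀ (-π)
  obtain ⟨b, hb, hbe⟩ := hp.exists_mem_Ioc (by positivity : 0 < 2 * π) θ (-π)
  rw [show -π + 2 * π = π by ring] at ha hb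
  rw [hae, hbe] at he
  obtain ⟨u, v, hu, hv, hw, -⟩ := p4_rel hψ hper (Set.Ioc_subset_Icc_self ha) (Set.Ioc_subset_Icc_self hb)
  rw [hw] at he
  have h1 : (l:ℂ) * Complex.exp (v + u * Complex.I) = 1 := by
    have := p4w_ne ψ b
    field_simp
    apply mul_left_cancel₀ this
    linear_combination he
  rcases hl.eq_or_lt with h | h
  · rw [← h] at h1; simp at h1
  · have h2 : Complex.exp (Real.log l + (v + u * Complex.I)) = 1 := by
      rw [Complex.exp_add, ← Complex.ofReal_exp, Real.exp_log h, h1]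
    obtain ⟨n, hn⟩ := Complex.exp_eq_one_iff.1 h2
    have him := congrArg Complex.im hn
    have hre := congrArg Complex.re hn
    simp at him hre
    have hpi := Real.pi_pos
    have hn0 : n = 0 := by
      by_contra hne
      have h3 : (1:ℝ) ≤ |(n:ℝ)| := by exact_mod_cast Int.one_le_abs hne
      rw [him, abs_mul, abs_of_pos (by positivity : 0 < 2 * π)] at hu
      nlinarith
    rw [hn0] at him
    simp at him
    rw [him] at hv
    simp at hv
    rw [hv, add_zero] at hre
    have := Real.log_neg h hl1
    simp at hre
    rcases hre with h | h | h <;> linarith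

lemma p4_null {ψ : ℝ → ℝ} (hψ : LipschitzWith (1/2) ψ) (hper : Function.Periodic ψ (2 * π))
    {q : ℝ → ℝ} (hq0 : ∀ θ, 0 ≤ q θ) (hqi : Integrable q) (hqS : ∀ θ, θ ∉ Set.Ioc (-π) π → q θ = 0)
    (hq1 : ∫ θ, q θ = 1)
    (hq : ∀ F ∈ p4Cls ψ, F 0 = 0 → ∫ θ, (q θ : ℂ) * F (p4w ψ θ) = 0)
    {Z : Set ℝ} (hZ : MeasurableSet Z) (hZs : Z ⊆ Set.Ioc (-π) π) (hqZ : ∀ θ ∈ Z, q θ = 0) :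
    volume Z = 0 := by
  have hpi := Real.pi_pos
  have hwc := p4w_cont hψ.continuous
  have hp := p4w_per hper
  set K := Set.Icc (-π) π with hK
  set μ : Measure ℝ := volume.restrict K with hμ
  have hwne := p4w_ne ψ
  set V0 : Set ℂ := (p4w ψ '' K)ᶜ with hV0
  have hV0o : IsOpen V0 := (isCompact_Icc.image hwc).isClosed.isOpen_compl
  have hout : ∀ (θ l : ℝ), 0 ≤ l → l < 1 → (l:ℂ) * p4w ψ θ ∈ V0 := by
    rintro θ l h0 h1 ⟨a, -, ha⟩
    exact p4_sep hψ hper θ a h0 h1 ha.symm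
  have hqK : ∀ θ, θ ∉ K → q θ = 0 := fun θ h => hqS θ (fun h' => h (Set.Ioc_subset_Icc_self h'))
  have hqc : IntegrableOn (fun θ => (q θ : ℂ)) K := hqi.ofReal.integrableOn
  set b : ℂ → ℂ := fun z => ∫ θ, (p4w ψ θ - z)⁻¹ • ((q θ : ℂ) * p4w ψ θ) ∂μ with hb
  have hbd : DifferentiableOn ℂ b V0 := by
    intro ζ hζ
    obtain ⟨d, hd, hball⟩ := Metric.isOpen_iff.1 hV0o ζ hζ
    refine (p4_cauchyType (hqc.mul_continuousOn hwc.continuousOn isCompact_Icc) hwc.aemeasurable hd ?_).differentiableWithinAt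
    filter_upwards [ae_restrict_mem measurableSet_Icc] with θ hθ
    by_contra hlt
    push Not at hlt
    exact hball (by rwa [mem_ball_iff_norm]) ⟨θ, hθ, rfl⟩
  have hb0 : b 0 = 1 := by
    have : ∀ θ, (p4w ψ θ - 0)⁻¹ • ((q θ : ℂ) * p4w ψ θ) = ((q θ : ℝ) : ℂ) := by
      intro θ
      have := hwne θ
      rw [sub_zero, smul_eq_mul]
      field_simp
    simp only [hb, this]
    rw [hμ, setIntegral_eq_integral_of_forall_compl_eq_zero (fun x hx => by rw [hqK x hx]; simp),
      integral_complex_ofReal, hq1]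
    simp
  -- the kernel
  let k : ℝ → ℝ → ℝ → ℂ := fun l θ₀ θ => (p4w ψ θ - l * p4w ψ θ₀)⁻¹ * p4w ψ θ -
    p4w ψ θ / (p4w ψ θ - (l:ℂ)⁻¹ * p4w ψ θ₀)
  have hkc : ∀ l θ₀ : ℝ, 0 < l → l < 1 → ContinuousOn (k l θ₀) K ∧
      b (l * p4w ψ θ₀) = ∫ θ in K, (q θ : ℂ) * k l θ₀ θ := by
    intro l θ₀ h0 h1
    have hl : (l:ℂ) ≠ 0 := by exact_mod_cast h0.ne'
    have n1 : ∀ θ, p4w ψ θ - l * p4w ψ θ₀ ≠ 0 := fun θ =>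
      sub_ne_zero.2 (p4_sep hψ hper θ₀ θ h0.le h1).symm
    have n2 : ∀ r : ℝ, 0 ≤ r → r < l⁻¹ → ∀ θ, r * p4w ψ θ - (l:ℂ)⁻¹ * p4w ψ θ₀ ≠ 0 := by
      intro r hr hr1 θ h
      refine p4_sep hψ hper θ θ₀ (l := l * r) (by positivity) ?_ ?_
      · calc l * r < l * l⁻¹ := by gcongr
          _ = 1 := mul_inv_cancel₀ h0.ne'
      · push_cast
        rw [mul_assoc, sub_eq_zero.1 h, mul_inv_cancel_left₀ hl]
    have hli : 1 < l⁻¹ := (one_lt_inv₀ h0).2 h1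
    have n3 : ∀ θ, p4w ψ θ - (l:ℂ)⁻¹ * p4w ψ θ₀ ≠ 0 := fun θ => by
      simpa using n2 1 zero_le_one hli θ
    have c1 : Continuous (fun θ => (p4w ψ θ - l * p4w ψ θ₀)⁻¹ * p4w ψ θ) :=
      ((hwc.sub continuous_const).inv₀ n1).mul hwc
    have c2 : Continuous (fun θ => p4w ψ θ / (p4w ψ θ - (l:ℂ)⁻¹ * p4w ψ θ₀)) :=
      hwc.div (hwc.sub continuous_const) n3
    refine ⟨(c1.sub c2).continuousOn, ?_⟩
    have hF : (fun z => z / (z - (l:ℂ)⁻¹ * p4w ψ θ₀)) ∈ p4Cls ψ := by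
      refine ⟨{(l:ℂ)⁻¹ * p4w ψ θ₀}ᶜ, l⁻¹, isOpen_compl_singleton, hli, ?_, ?_⟩
      · intro z hz
        have h5 : DifferentiableAt ℂ (fun z : ℂ => z - (l:ℂ)⁻¹ * p4w ψ θ₀) z := by fun_prop
        exact (differentiableAt_id.div h5 (sub_ne_zero.2 hz)).differentiableWithinAt
      · intro θ r hr hr1 h
        exact n2 r hr hr1 θ (sub_eq_zero.2 h)
    have h3 := hq _ hF (by simp)
    rw [← setIntegral_eq_integral_of_forall_compl_eq_zero (s := K) (fun x hx => by rw [hqK x hx]; simp)] at h3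
    have i1 := hqc.mul_continuousOn c1.continuousOn isCompact_Icc
    have i2 := hqc.mul_continuousOn c2.continuousOn isCompact_Icc
    have : ∫ θ in K, (q θ : ℂ) * k l θ₀ θ = (∫ θ in K, (q θ : ℂ) * ((p4w ψ θ - l * p4w ψ θ₀)⁻¹ * p4w ψ θ)) -
        ∫ θ in K, (q θ : ℂ) * (p4w ψ θ / (p4w ψ θ - (l:ℂ)⁻¹ * p4w ψ θ₀)) := by
      rw [← integral_sub i1 i2]
      congr 1; funext θ; simp only [k]; ring
    rw [this, h3, sub_zero]
    simp only [hb, smul_eq_mul]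
    congr 1; funext θ; ring
  have hkk : ∀ l θ₀ θ : ℝ, 0 < l → l < 1 → θ₀ ∈ K → θ ∈ K →
      ∃ u v : ℝ, |u| ≤ π ∧ |v| ≤ |u| / 2 ∧ k l θ₀ θ = (1 - l * Complex.exp (v + u * Complex.I))⁻¹ -
        (1 - (l:ℂ)⁻¹ * Complex.exp (v + u * Complex.I))⁻¹ ∧ (u = θ₀ - θ ∨ π - |θ₀| ≤ |u|) := by
    intro l θ₀ θ h0 h1 ha hb'
    obtain ⟨u, v, hu, hv, hw, hor⟩ := p4_rel hψ hper ha hb'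
    refine ⟨u, v, hu, hv, ?_, hor⟩
    simp only [k]
    rw [hw]
    have e : ∀ c : ℂ, p4w ψ θ - c * (p4w ψ θ * Complex.exp (v + u * Complex.I)) =
      p4w ψ θ * (1 - c * Complex.exp (v + u * Complex.I)) := fun c => by ring
    have hne := hwne θ
    rw [e, e, mul_inv, mul_comm (p4w ψ θ)⁻¹, mul_assoc, inv_mul_cancel₀ hne, mul_one, div_eq_mul_inv,
      mul_inv, ← mul_assoc, mul_inv_cancel₀ hne, one_mul]
  have hbre : ∀ l θ₀ : ℝ, 0 < l → l < 1 → θ₀ ∈ K →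
      0 < (b (l * p4w ψ θ₀)).re ∧ |(b (l * p4w ψ θ₀)).im| ≤ 4 / 3 * (b (l * p4w ψ θ₀)).re := by
    intro l θ₀ h0 h1 hθ₀
    obtain ⟨hc, he⟩ := hkc l θ₀ h0 h1
    have hk1 : ∀ θ ∈ K, 0 < (k l θ₀ θ).re ∧ |(k l θ₀ θ).im| ≤ 4 / 3 * (k l θ₀ θ).re := by
      intro θ hθ
      obtain ⟨u, v, hu, hv, hke, -⟩ := hkk l θ₀ θ h0 h1 hθ₀ hθ
      have := p4_ker2 h0 h1 hu hv
      simp only [← hke] at this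
      exact ⟨this.1, this.2.1⟩
    have hi : IntegrableOn (fun θ => (q θ : ℂ) * k l θ₀ θ) K := hqc.mul_continuousOn hc isCompact_Icc
    have hre : (b (l * p4w ψ θ₀)).re = ∫ θ in K, q θ * (k l θ₀ θ).re := by
      rw [he]
      have := integral_re hi
      simp only [RCLike.re_eq_complex_re, Complex.re_ofReal_mul] at this
      exact this.symm
    have him : (b (l * p4w ψ θ₀)).im = ∫ θ in K, q θ * (k l θ₀ θ).im := by
      rw [he]
      have := integral_im hi
      simp only [RCLike.im_eq_complex_im, Complex.im_ofReal_mul] at this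
      exact this.symm
    have hire : IntegrableOn (fun θ => q θ * (k l θ₀ θ).re) K := by
      have := hi.re
      simp only [RCLike.re_eq_complex_re, Complex.re_ofReal_mul] at this
      exact this
    have hnn : 0 ≤ᵐ[volume.restrict K] fun θ => q θ * (k l θ₀ θ).re := by
      filter_upwards [ae_restrict_mem measurableSet_Icc] with θ hθ
      exact mul_nonneg (hq0 θ) (hk1 θ hθ).1.le
    constructor
    · rw [hre]
      refine lt_of_le_of_ne (integral_nonneg_of_ae hnn) (fun h => ?_)
      have h2 := (integral_eq_zero_iff_of_nonneg_ae hnn hire).1 h.symm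
      have h3 : (∫ θ in K, q θ) = 0 := by
        refine integral_eq_zero_of_ae ?_
        filter_upwards [h2, ae_restrict_mem measurableSet_Icc] with θ h4 hθ
        have := (hk1 θ hθ).1
        simp at h4 ⊢
        rcases h4 with h | h
        · exact h
        · linarith
      rw [setIntegral_eq_integral_of_forall_compl_eq_zero hqK, hq1] at h3
      norm_num at h3
    · rw [hre, him, ← integral_const_mul]
      refine (abs_integral_le_integral_abs).trans ?_
      refine integral_mono_of_nonneg (Eventually.of_forall fun _ => abs_nonneg _) (hire.const_mul _) ?_
      filter_upwards [ae_restrict_mem measurableSet_Icc] with θ hθ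
      rw [abs_mul, abs_of_nonneg (hq0 θ)]
      have := mul_le_mul_of_nonneg_left (hk1 θ hθ).2 (hq0 θ)
      linarith
  have hbn : ∀ l θ₀ : ℝ, 1 / 2 ≤ l → l < 1 → θ₀ ∈ Set.Ioo (-π) π →
      ‖b (l * p4w ψ θ₀)‖ ≤ 14 * (∫ θ, (1 - l) / ((1 - l) ^ 2 + (θ - θ₀) ^ 2) * q θ) +
        14 * (1 - l) / (π - |θ₀|) ^ 2 := by
    intro l θ₀ h0 h1 hθ₀
    have hd : 0 < π - |θ₀| := by have := abs_lt.2 hθ₀; linarith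
    obtain ⟨hc, he⟩ := hkc l θ₀ (by linarith) h1
    have h1l : 0 < 1 - l := by linarith
    have hcont : Continuous fun θ : ℝ => (1 - l) / ((1 - l) ^ 2 + (θ - θ₀) ^ 2) :=
      continuous_const.div (by fun_prop) (fun θ => by positivity)
    have hPi : IntegrableOn (fun θ => (1 - l) / ((1 - l) ^ 2 + (θ - θ₀) ^ 2) * q θ) K :=
      IntegrableOn.continuousOn_mul hcont.continuousOn hqi.integrableOn isCompact_Icc
    have hgi : IntegrableOn (fun θ => 14 * ((1 - l) / ((1 - l) ^ 2 + (θ - θ₀) ^ 2) * q θ) +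
        14 * (1 - l) / (π - |θ₀|) ^ 2 * q θ) K := (hPi.const_mul 14).add (hqi.integrableOn.const_mul _)
    rw [he]
    refine (norm_integral_le_of_norm_le hgi ?_).trans (le_of_eq ?_)
    · filter_upwards [ae_restrict_mem measurableSet_Icc] with θ hθ
      obtain ⟨u, v, hu, hv, hke, hor⟩ := hkk l θ₀ θ (by linarith) h1 (Set.Ioo_subset_Icc_self hθ₀) hθ
      have := p4_ker' h0 h1 hu hv
      simp only [← hke] at this
      rw [norm_mul, Complex.norm_real, Real.norm_of_nonneg (hq0 θ)]
      have hb2 : (1 - l) / ((1 - l) ^ 2 + u ^ 2) ≤ (1 - l) / ((1 - l) ^ 2 + (θ - θ₀) ^ 2) +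
          (1 - l) / (π - |θ₀|) ^ 2 := by
        rcases hor with h | h
        · rw [h, show (θ₀ - θ) ^ 2 = (θ - θ₀) ^ 2 by ring]
          have : 0 ≤ (1 - l) / (π - |θ₀|) ^ 2 := by positivity
          linarith
        · have h5 : (1 - l) / ((1 - l) ^ 2 + u ^ 2) ≤ (1 - l) / (π - |θ₀|) ^ 2 := by
            gcongr
            have : (π - |θ₀|) ^ 2 ≤ |u| ^ 2 := by gcongr
            rw [sq_abs] at this
            nlinarith [sq_nonneg (1 - l)]
          have : 0 ≤ (1 - l) / ((1 - l) ^ 2 + (θ - θ₀) ^ 2) := by positivity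
          linarith
      calc q θ * ‖k l θ₀ θ‖ ≤ q θ * (14 * ((1 - l) / ((1 - l) ^ 2 + (θ - θ₀) ^ 2) +
          (1 - l) / (π - |θ₀|) ^ 2)) := by
            refine mul_le_mul_of_nonneg_left (this.2.2.trans ?_) (hq0 θ)
            gcongr
        _ = _ := by ring
    · rw [integral_add (hPi.const_mul 14) (hqi.integrableOn.const_mul _), integral_const_mul, integral_const_mul,
        setIntegral_eq_integral_of_forall_compl_eq_zero hqK, hq1, mul_one,
        setIntegral_eq_integral_of_forall_compl_eq_zero (fun x hx => by rw [hqK x hx]; simp)]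
  -- reciprocal
  have hl0 : ∀ n, 0 < p4l n := fun n => lt_of_lt_of_le (by norm_num) (p4l_half n)
  have hbne : ∀ θ l : ℝ, 0 ≤ l → l < 1 → b (l * p4w ψ θ) ≠ 0 := by
    intro θ l h0 h1 h
    rcases h0.eq_or_lt with h2 | h2
    · rw [← h2] at h; simp [hb0] at h
    · obtain ⟨a, ha, hae⟩ := hp.exists_mem_Ioc (by positivity : 0 < 2 * π) θ (-π)
      rw [show -π + 2 * π = π by ring] at ha
      rw [hae] at h
      have := (hbre l a h2 h1 (Set.Ioc_subset_Icc_self ha)).1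
      rw [h] at this
      simp at this
  have hgint : ∀ n, ∫⁻ θ in Z, ‖(b (p4l n * p4w ψ θ))⁻¹‖ₑ ≤ ENNReal.ofReal (10 * π) := by
    intro n
    have hV1 : IsOpen (V0 ∩ b ⁻¹' {0}ᶜ) := hbd.continuousOn.isOpen_inter_preimage hV0o isOpen_compl_singleton
    have hψp : ψ π = ψ (-π) := by
      have := hper (-π); rw [← this]; congr 1; ring
    have hgd : DifferentiableOn ℂ (fun z => (b z)⁻¹) (V0 ∩ b ⁻¹' {0}ᶜ) :=
      (hbd.mono Set.inter_subset_left).inv (fun z hz => hz.2)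
    have hc := p4_cauchy (F := fun z => (b z)⁻¹) hψ hψp hV1 hgd (R := 1)
      (fun θ l h0 h1 => ⟨hout θ l h0 h1, hbne θ l h0 h1⟩) (hl0 n).le (p4l_lt n)
    have hgc : Continuous (fun θ => (b (p4l n * p4w ψ θ))⁻¹) :=
      continuous_iff_continuousAt.2 fun θ => ContinuousAt.comp (f := fun θ => (p4l n : ℂ) * p4w ψ θ)
        (g := fun z => (b z)⁻¹)
        (hgd.differentiableAt (hV1.mem_nhds ⟨hout θ _ (hl0 n).le (p4l_lt n), hbne θ _ (hl0 n).le (p4l_lt n)⟩)).continuousAt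
        (by fun_prop)
    have hψb : ∀ θ, |deriv ψ θ| ≤ 1 / 2 := fun θ => by
      have := norm_deriv_le_of_lipschitz hψ (x₀ := θ)
      norm_num at this ⊢
      exact this
    have hIi : IntegrableOn (fun θ => (b (p4l n * p4w ψ θ))⁻¹ * (((deriv ψ θ : ℝ) : ℂ) + Complex.I)) (Set.Ioc (-π) π) := by
      have hgi : IntegrableOn (fun θ => (b (p4l n * p4w ψ θ))⁻¹) (Set.Ioc (-π) π) :=
        (hgc.integrableOn_Icc).mono_set Set.Ioc_subset_Icc_self
      refine hgi.mul_bdd (c := 2) ?_ ?_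
      · exact ((Complex.measurable_ofReal.comp (measurable_deriv ψ)).add_const _).aestronglyMeasurable
      · refine Eventually.of_forall fun θ => (norm_add_le _ _).trans ?_
        rw [Complex.norm_I, Complex.norm_real, Real.norm_eq_abs]
        linarith [hψb θ]
    have him := integral_im hIi
    rw [intervalIntegral.integral_of_le (by linarith)] at hc
    have hc' : (∫ θ in Set.Ioc (-π) π, (b (p4l n * p4w ψ θ))⁻¹ * (((deriv ψ θ : ℝ) : ℂ) + Complex.I)) = 2 * π * Complex.I := by
      rw [hb0] at hc
      simpa [p4w] using hc
    rw [hc'] at him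
    have hpt : ∀ θ ∈ Set.Ioc (-π) π, ‖(b (p4l n * p4w ψ θ))⁻¹‖ ≤
        5 * RCLike.im ((b (p4l n * p4w ψ θ))⁻¹ * (((deriv ψ θ : ℝ) : ℂ) + Complex.I)) := by
      intro θ hθ
      obtain ⟨h1, h2⟩ := hbre (p4l n) θ (hl0 n) (p4l_lt n) (Set.Ioc_subset_Icc_self hθ)
      have h3 := hψb θ
      set B := b (p4l n * p4w ψ θ)
      have hBpos : 0 < Complex.normSq B := Complex.normSq_pos.2 (fun h => by rw [h] at h1; simp at h1)
      have e1 : (B⁻¹ * (((deriv ψ θ : ℝ) : ℂ) + Complex.I)).im = (B.re - B.im * deriv ψ θ) / Complex.normSq B := by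
        simp [Complex.mul_im, Complex.inv_re, Complex.inv_im]; ring
      have e2 : ‖B⁻¹‖ = ‖B‖ / Complex.normSq B := by
        rw [norm_inv, Complex.normSq_eq_norm_sq]
        have : ‖B‖ ≠ 0 := by rw [norm_ne_zero_iff]; rintro h; rw [h] at h1; simp at h1
        field_simp
      change _ ≤ 5 * (B⁻¹ * (((deriv ψ θ : ℝ) : ℂ) + Complex.I)).im
      rw [e1, e2, ← mul_div_assoc]
      apply div_le_div_of_nonneg_right _ hBpos.le
      have h4 : |B.im * deriv ψ θ| ≤ 4 / 3 * B.re * (1 / 2) := by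
        rw [abs_mul]; gcongr
      have h5 : ‖B‖ ≤ 5 / 3 * B.re := by
        rw [← Real.sqrt_sq (by positivity : 0 ≤ 5 / 3 * B.re), ← Real.sqrt_sq (norm_nonneg B)]
        apply Real.sqrt_le_sqrt
        rw [← Complex.normSq_eq_norm_sq, Complex.normSq_apply]
        have : B.im * B.im ≤ (4 / 3 * B.re) ^ 2 := by
          rw [← abs_mul_abs_self, sq]; gcongr
        nlinarith
      have := (abs_le.1 h4).2
      linarith
    have hgi : IntegrableOn (fun θ => (b (p4l n * p4w ψ θ))⁻¹) (Set.Ioc (-π) π) :=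
        (hgc.integrableOn_Icc).mono_set Set.Ioc_subset_Icc_self
    calc ∫⁻ θ in Z, ‖(b (p4l n * p4w ψ θ))⁻¹‖ₑ ≤ ∫⁻ θ in Set.Ioc (-π) π, ‖(b (p4l n * p4w ψ θ))⁻¹‖ₑ :=
          lintegral_mono_set hZs
      _ = ENNReal.ofReal (∫ θ in Set.Ioc (-π) π, ‖(b (p4l n * p4w ψ θ))⁻¹‖) :=
          (ofReal_integral_norm_eq_lintegral_enorm hgi).symm
      _ ≤ _ := by
          apply ENNReal.ofReal_le_ofReal
          calc (∫ θ in Set.Ioc (-π) π, ‖(b (p4l n * p4w ψ θ))⁻¹‖) ≤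
              ∫ θ in Set.Ioc (-π) π, 5 * RCLike.im ((b (p4l n * p4w ψ θ))⁻¹ * (((deriv ψ θ : ℝ) : ℂ) + Complex.I)) :=
                setIntegral_mono_on hgi.norm (hIi.im.const_mul 5) measurableSet_Ioc hpt
            _ = 10 * π := by
                rw [integral_const_mul, him]
                simp; ring
  -- Fatou
  have hae : ∀ᵐ θ₀ ∂(volume.restrict Z), Tendsto (fun n => ‖(b (p4l n * p4w ψ θ₀))⁻¹‖ₑ) atTop (𝓝 ⊤) := by
    have hL := ae_restrict_of_ae (s := Z) (p2_lebesgue q hqi.locallyIntegrable)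
    have hne : ∀ᵐ θ ∂(volume.restrict Z), θ ≠ π := ae_restrict_of_ae (by simp [ae_iff])
    filter_upwards [hL, hne, ae_restrict_mem hZ] with θ₀ hLθ hnπ hθZ
    have hθI : θ₀ ∈ Set.Ioo (-π) π := ⟨(hZs hθZ).1, lt_of_le_of_ne (hZs hθZ).2 hnπ⟩
    rw [hqZ θ₀ hθZ] at hLθ
    have hL2 : Tendsto (fun r => r⁻¹ * ∫ u in Metric.closedBall θ₀ r, q u) (𝓝[>] 0) (𝓝 0) := by
      refine hLθ.congr fun r => ?_
      congr 2; funext u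
      rw [sub_zero, Real.norm_of_nonneg (hq0 u)]
    have hP := p2_poisson q hqi hq0 θ₀ hL2
    have hε : Tendsto (fun n => 1 - p4l n) atTop (𝓝[>] 0) := by
      refine tendsto_nhdsWithin_iff.2 ⟨?_, Eventually.of_forall fun n => by
        have := p4l_lt n; simp only [Set.mem_Ioi]; linarith⟩
      simpa using p4l_tendsto.const_sub 1
    have hbz : Tendsto (fun n => ‖b (p4l n * p4w ψ θ₀)‖) atTop (𝓝 0) := by
      have h1 := ((hP.comp hε).const_mul 14).add
        (((tendsto_nhdsWithin_iff.1 hε).1.const_mul 14).div_const ((π - |θ₀|) ^ 2))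
      simp only [mul_zero, zero_div, add_zero] at h1
      exact squeeze_zero (fun n => norm_nonneg _) (fun n => hbn _ θ₀ (p4l_half n) (p4l_lt n) hθI) h1
    have : Tendsto (fun n => (‖b (p4l n * p4w ψ θ₀)‖ₑ)⁻¹) atTop (𝓝 (0:ENNReal)⁻¹) := by
      refine tendsto_inv_iff.2 ?_
      have := ENNReal.tendsto_ofReal hbz
      simpa using this
    rw [ENNReal.inv_zero] at this
    refine this.congr fun n => ?_
    rw [enorm_inv (hbne _ _ (hl0 n).le (p4l_lt n))]
  have hmeas : ∀ n, Measurable (fun θ => ‖(b (p4l n * p4w ψ θ))⁻¹‖ₑ) := by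
    intro n
    have : Continuous (fun θ => b (p4l n * p4w ψ θ)) :=
      continuous_iff_continuousAt.2 fun θ => ContinuousAt.comp (f := fun θ => (p4l n : ℂ) * p4w ψ θ)
        (hbd.differentiableAt (hV0o.mem_nhds (hout θ _ (hl0 n).le (p4l_lt n)))).continuousAt
        (by fun_prop)
    exact this.measurable.inv.enorm
  have hF := lintegral_liminf_le (μ := volume.restrict Z) (u := atTop) hmeas
  have hF2 : ∫⁻ θ in Z, (⊤ : ENNReal) ≤ ENNReal.ofReal (10 * π) := by
    calc ∫⁻ θ in Z, (⊤ : ENNReal) = ∫⁻ θ in Z, liminf (fun n => ‖(b (p4l n * p4w ψ θ))⁻¹‖ₑ) atTop := by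
          refine lintegral_congr_ae ?_
          filter_upwards [hae] with θ hθ using hθ.liminf_eq.symm
      _ ≤ _ := hF
      _ ≤ _ := by
          refine liminf_le_of_frequently_le' (Frequently.of_forall hgint)
  by_contra hne
  rw [lintegral_const, Measure.restrict_apply_univ, ENNReal.top_mul hne] at hF2
  exact absurd hF2 (not_le.2 ENNReal.ofReal_lt_top)

lemma p4_zero0 {ψ : ℝ → ℝ} (hψ : LipschitzWith (1/2) ψ) (hper : Function.Periodic ψ (2 * π))
    {V : Set ℂ} (hV : IsOpen V) {f : ℂ → ℂ} (hf : DifferentiableOn ℂ f V)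
    (hin : ∀ θ l : ℝ, 0 ≤ l → l < 1 → (l : ℂ) * p4w ψ θ ∈ V) {M : ℝ}
    (hM : ∀ θ l : ℝ, 0 ≤ l → l < 1 → ‖f ((l : ℂ) * p4w ψ θ)‖ ≤ M)
    {K : Set ℝ} (hKs : K ⊆ Set.Ioc (-π) π) (hK : volume K ≠ 0)
    (hK0 : ∀ θ ∈ K, Tendsto (fun l : ℝ => f (l * p4w ψ θ)) (𝓝[<] 1) (𝓝 0)) : f 0 = 0 := by
  by_contra hf0
  have hpi := Real.pi_pos
  have hl0 : ∀ n, 0 ≤ p4l n := fun n => le_trans (by norm_num) (p4l_half n)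
  have hwc := p4w_cont hψ.continuous
  have hfc : ∀ n, Continuous (fun θ => f (p4l n * p4w ψ θ)) := fun n =>
    continuous_iff_continuousAt.2 fun θ => ContinuousAt.comp (f := fun θ => (p4l n : ℂ) * p4w ψ θ)
      (hf.differentiableAt (hV.mem_nhds (hin θ _ (hl0 n) (p4l_lt n)))).continuousAt (by fun_prop)
  set Z : Set ℝ := {θ | Tendsto (fun n => f (p4l n * p4w ψ θ)) atTop (𝓝 0)} ∩ Set.Ioc (-π) π with hZd
  have hZ : MeasurableSet Z :=
    (measurableSet_tendsto (𝓝 (0:ℂ)) (fun n => (hfc n).measurable)).inter measurableSet_Ioc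
  have hKZ : K ⊆ Z := by
    intro θ hθ
    refine ⟨?_, hKs hθ⟩
    have hl : Tendsto p4l atTop (𝓝[<] 1) :=
      tendsto_nhdsWithin_iff.2 ⟨p4l_tendsto, Eventually.of_forall fun n => p4l_lt n⟩
    exact (hK0 θ hθ).comp hl
  have hA := fun F hF => p4_boundA hψ hper hV hf hin hM hZ (fun θ hθ => hθ.1) (F := F) hF
  have hf0' : 0 < ‖f 0‖ := norm_pos_iff.2 hf0
  obtain ⟨q, hq0, hqi, hqS, hq1, hq⟩ := p4_dens hψ.continuous (measurableSet_Ioc.diff hZ)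
    Set.sdiff_subset (c := 2 * M / (2 * π * ‖f 0‖)) (fun F hF => by
      have := hA F hF
      rw [div_mul_eq_mul_div, le_div_iff₀ (by positivity)]
      linarith)
  have := p4_null hψ hper hq0 hqi (fun θ hθ => hqS θ (fun h => hθ h.1)) hq1 hq hZ Set.inter_subset_right
    (fun θ hθ => hqS θ (fun h => h.2 hθ))
  exact hK (measure_mono_null hKZ this)

lemma p4_zero {ψ : ℝ → ℝ} (hψ : LipschitzWith (1/2) ψ) (hper : Function.Periodic ψ (2 * π))
    {V : Set ℂ} (hV : IsOpen V) {f : ℂ → ℂ} (hf : DifferentiableOn ℂ f V)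
    (hin : ∀ θ l : ℝ, 0 ≤ l → l < 1 → (l : ℂ) * p4w ψ θ ∈ V) {M : ℝ}
    (hM : ∀ θ l : ℝ, 0 ≤ l → l < 1 → ‖f ((l : ℂ) * p4w ψ θ)‖ ≤ M)
    {K : Set ℝ} (hKs : K ⊆ Set.Ioc (-π) π) (hK : volume K ≠ 0)
    (hK0 : ∀ θ ∈ K, Tendsto (fun l : ℝ => f (l * p4w ψ θ)) (𝓝[<] 1) (𝓝 0)) :
    ∀ᶠ z in 𝓝 0, f z = 0 := by
  have h0V : (0:ℂ) ∈ V := by simpa using hin 0 0 le_rfl one_pos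
  have han : AnalyticAt ℂ f 0 := hf.analyticAt (hV.mem_nhds h0V)
  by_contra hne
  obtain ⟨n, g, hg, hg0, hfg⟩ := han.exists_eventuallyEq_pow_smul_nonzero_iff.2 hne
  have hpi := Real.pi_pos
  set G : ℂ → ℂ := fun z => if z = 0 then g 0 else f z / z ^ n with hG
  have hGg : G =ᶠ[𝓝 0] g := by
    filter_upwards [hfg] with z hz
    by_cases h : z = 0
    · simp [hG, h]
    · simp only [hG, h, if_false, hz, sub_zero, smul_eq_mul]
      field_simp
  have hGd : DifferentiableOn ℂ G V := by
    intro z hz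
    by_cases h : z = 0
    · subst h
      exact (hg.differentiableAt.congr_of_eventuallyEq hGg).differentiableWithinAt
    · have h1 : G =ᶠ[𝓝 z] fun z => f z / z ^ n := by
        filter_upwards [isOpen_compl_singleton.mem_nhds (show z ∈ ({0}ᶜ : Set ℂ) from h)] with y hy
        have : y ≠ 0 := hy
        simp [hG, this]
      have h2 : DifferentiableAt ℂ (fun z => f z / z ^ n) z :=
        (hf.differentiableAt (hV.mem_nhds hz)).div (by fun_prop) (pow_ne_zero _ h)
      exact (h2.congr_of_eventuallyEq h1).differentiableWithinAt
  -- lower bound for |w|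
  obtain ⟨m, hm, hmw⟩ : ∃ m > 0, ∀ θ, m ≤ ‖p4w ψ θ‖ := by
    obtain ⟨θ₁, -, h1⟩ := isCompact_Icc.exists_isMinOn (s := Set.Icc (-π) π) ⟨0, by constructor <;> linarith⟩
      (p4w_cont hψ.continuous).norm.continuousOn
    refine ⟨‖p4w ψ θ₁‖, norm_pos_iff.2 (p4w_ne ψ θ₁), fun θ => ?_⟩
    obtain ⟨a, ha, hae⟩ := (p4w_per hper).exists_mem_Ioc (by positivity : 0 < 2 * π) θ (-π)
    rw [show -π + 2 * π = π by ring] at ha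
    rw [hae]
    exact h1 (Set.Ioc_subset_Icc_self ha)
  obtain ⟨δ, hδ, hGb⟩ : ∃ δ > 0, ∀ z, ‖z‖ < δ → ‖G z‖ ≤ ‖g 0‖ + 1 := by
    have hc : ContinuousAt G 0 := (hGd.differentiableAt (hV.mem_nhds h0V)).continuousAt
    have : ∀ᶠ z in 𝓝 0, ‖G z‖ < ‖G 0‖ + 1 := hc.norm.eventually_lt_const (by linarith)
    obtain ⟨δ, hδ, h⟩ := Metric.eventually_nhds_iff.1 this
    refine ⟨δ, hδ, fun z hz => ?_⟩
    have := h (y := z) (by simpa using hz)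
    simp [hG] at this ⊢
    linarith
  have hM0 : 0 ≤ M := (norm_nonneg _).trans (hM 0 0 le_rfl one_pos)
  have hGM : ∀ θ l : ℝ, 0 ≤ l → l < 1 → ‖G ((l : ℂ) * p4w ψ θ)‖ ≤ ‖g 0‖ + 1 + M / δ ^ n := by
    intro θ l h0 h1
    have hp : 0 ≤ M / δ ^ n := by positivity
    by_cases h : ‖(l : ℂ) * p4w ψ θ‖ < δ
    · exact (hGb _ h).trans (by linarith)
    · push Not at h
      have hz : (l : ℂ) * p4w ψ θ ≠ 0 := fun hz => by rw [hz, norm_zero] at h; linarith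
      simp only [hG, hz, if_false]
      rw [norm_div, norm_pow]
      have : ‖f ((l : ℂ) * p4w ψ θ)‖ / ‖(l : ℂ) * p4w ψ θ‖ ^ n ≤ M / δ ^ n := by
        gcongr
        exact hM θ l h0 h1
      have := norm_nonneg (g 0)
      linarith
  have hK1 : ∀ θ ∈ K, Tendsto (fun l : ℝ => G (l * p4w ψ θ)) (𝓝[<] 1) (𝓝 0) := by
    intro θ hθ
    have h1 : Tendsto (fun l : ℝ => ((l : ℂ) * p4w ψ θ) ^ n) (𝓝[<] 1) (𝓝 ((((1:ℝ):ℂ) * p4w ψ θ) ^ n)) := by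
      have : Continuous (fun l : ℝ => ((l : ℂ) * p4w ψ θ) ^ n) := by fun_prop
      exact (this.tendsto 1).mono_left nhdsWithin_le_nhds
    have hne : (((1:ℝ):ℂ) * p4w ψ θ) ^ n ≠ 0 := by simp [p4w_ne]
    have h2 := (hK0 θ hθ).div h1 hne
    rw [zero_div] at h2
    refine h2.congr' ?_
    have : ∀ᶠ l : ℝ in 𝓝[<] 1, 0 < l := (eventually_gt_nhds one_pos).filter_mono nhdsWithin_le_nhds
    filter_upwards [this] with l hl
    have : (l : ℂ) * p4w ψ θ ≠ 0 := mul_ne_zero (by exact_mod_cast hl.ne') (p4w_ne ψ θ)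
    simp only [hG, this, if_false, Pi.div_apply]
  have := p4_zero0 hψ hper hV hGd hin hGM hKs hK hK1
  simp [hG] at this
  exact hg0 this

lemma p5_logC {g : ℂ → ℂ} (hg : Continuous g) (h0 : ∀ z, g z ≠ 0) :
    ∃ f : ℂ → ℂ, Continuous f ∧ ∀ z, Complex.exp (f z) = g z := by
  have hs : IsSimplyConnected (Set.univ : Set ℂ) := by
    have := (convex_univ (𝕜 := ℝ) (E := ℂ)).contractibleSpace ⟨0, trivial⟩
    exact (inferInstance : SimplyConnectedSpace (Set.univ : Set ℂ))
  obtain ⟨f, hf, he⟩ := Complex.exists_continuousOn_eqOn_exp_comp hs isOpen_univ hg.continuousOn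
    (by rintro ⟨z, -, hz⟩; exact h0 z hz)
  exact ⟨f, continuousOn_univ.1 hf, fun z => he (Set.mem_univ z)⟩

lemma p5_logR {g : ℝ → ℂ} (hg : Continuous g) (h0 : ∀ z, g z ≠ 0) :
    ∃ f : ℝ → ℂ, Continuous f ∧ ∀ z, Complex.exp (f z) = g z := by
  have hs : IsSimplyConnected (Set.univ : Set ℝ) := by
    have := (convex_univ (𝕜 := ℝ) (E := ℝ)).contractibleSpace ⟨0, trivial⟩
    exact (inferInstance : SimplyConnectedSpace (Set.univ : Set ℝ))
  obtain ⟨f, hf, he⟩ := Complex.exists_continuousOn_eqOn_exp_comp hs isOpen_univ hg.continuousOn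
    (by rintro ⟨z, -, hz⟩; exact h0 z hz)
  exact ⟨f, continuousOn_univ.1 hf, fun z => he (Set.mem_univ z)⟩

lemma p5_eq {X : Type*} [TopologicalSpace X] [PreconnectedSpace X] {f : X → ℂ}
    (hf : Continuous f) (he : ∀ x, Complex.exp (f x) = 1) (x y : X) : f x = f y := by
  have := Complex.isCoveringMap_exp.eq_of_comp_eq (g₁ := f) (g₂ := fun _ => f y) hf continuous_const
    (by ext z; simp [he]) y rfl
  exact congrFun this x

lemma p5_key {V S : Set ℂ} (hV : IsOpen V) (hVb : Bornology.IsBounded V) (hfr : frontier V ⊆ S)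
    {a b : ℂ} (ha : a ∈ V) (hb : b ∉ V) (hbS : b ∉ S) {m n : ℤ} {L : ℂ → ℂ} (hL : Continuous L)
    (hLS : ∀ z ∈ S, Complex.exp (L z) = (z - a) ^ m * (z - b) ^ n) : m = 0 := by
  classical
  have hbc : b ∉ closure V := by
    rw [closure_eq_self_union_frontier]
    rintro (h | h)
    · exact hb h
    · exact hbS (hfr h)
  set G : ℂ → ℂ := fun z => (z - a) ^ m * (z - b) ^ n with hG
  set e : ℂ → ℂ := fun ζ => b + Complex.exp ζ with he
  have hec : Continuous e := by fun_prop
  have hneb : ∀ ζ, e ζ - b ≠ 0 := fun ζ => by simp [he, Complex.exp_ne_zero]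
  have hnea : ∀ z, z ∉ V → z - a ≠ 0 := fun z hz h => hz (by rw [sub_eq_zero.1 h]; exact ha)
  set g : ℂ → ℂ := fun ζ => if e ζ ∈ V then Complex.exp (L (e ζ)) else G (e ζ) with hg
  have hgc : Continuous g := by
    refine continuous_if ?_ ?_ ?_
    · intro ζ hζ
      have : e ζ ∈ frontier V := hec.frontier_preimage_subset V hζ
      exact hLS _ (hfr this)
    · exact (Complex.continuous_exp.comp (hL.comp hec)).continuousOn
    · have hcl : IsClosed {ζ | ¬ e ζ ∈ V} := (hV.preimage hec).isClosed_compl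
      rw [hcl.closure_eq]
      intro ζ hζ
      refine ContinuousAt.continuousWithinAt ?_
      exact ((hec.continuousAt.sub continuousAt_const).zpow₀ m (Or.inl (hnea _ hζ))).mul
        ((hec.continuousAt.sub continuousAt_const).zpow₀ n (Or.inl (hneb _)))
  have hg0 : ∀ ζ, g ζ ≠ 0 := by
    intro ζ
    simp only [hg]
    split_ifs with h
    · exact Complex.exp_ne_zero _
    · exact mul_ne_zero (zpow_ne_zero _ (hnea _ h)) (zpow_ne_zero _ (hneb ζ))
  obtain ⟨Λ, hΛc, hΛ⟩ := p5_logC hgc hg0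
  have hper : ∀ ζ, g (ζ + 2 * π * Complex.I) = g ζ := by
    intro ζ
    have : e (ζ + 2 * π * Complex.I) = e ζ := by
      simp only [he]; rw [Complex.exp_periodic ζ]
    simp only [hg, this]
  have hD := p5_eq (f := fun ζ => Λ (ζ + 2 * π * Complex.I) - Λ ζ) (by fun_prop)
    (fun ζ => by rw [Complex.exp_sub, hΛ, hΛ, hper, div_self (hg0 ζ)])
  -- evaluation principle
  have hev : ∀ (X : ℝ) (φ : ℝ → ℂ) (k : ℤ), Continuous φ →
      (∀ t : ℝ, e (X + t * Complex.I) ∉ V) →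
      (∀ t : ℝ, Complex.exp (φ t) = G (e (X + t * Complex.I))) →
      φ (2 * π) - φ 0 = k * (2 * π * Complex.I) →
      Λ ((X : ℂ) + 2 * π * Complex.I) - Λ X = k * (2 * π * Complex.I) := by
    intro X φ k hφ hnV hexp hk
    have := p5_eq (f := fun t : ℝ => Λ (X + t * Complex.I) - φ t) (by fun_prop)
      (fun t => by
        rw [Complex.exp_sub, hΛ, hexp]
        simp only [hg, hnV t, if_false]
        refine div_self ?_
        have := hg0 (X + t * Complex.I)
        simpa only [hg, hnV t, if_false] using this) (2 * π) 0
    simp only [Complex.ofReal_mul, Complex.ofReal_ofNat, Complex.ofReal_zero, zero_mul, add_zero] at this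
    rw [← hk]
    linear_combination this
  have hab : b - a ≠ 0 := fun h => hb (by rw [sub_eq_zero.1 h]; exact ha)
  have hslit : ∀ x : ℂ, ‖x‖ < 1 → 1 + x ∈ Complex.slitPlane := by
    intro x hx
    left
    have := Complex.abs_re_le_norm x
    have := neg_abs_le x.re
    simp only [Complex.add_re, Complex.one_re]
    linarith
  have hne1 : ∀ x : ℂ, ‖x‖ < 1 → 1 + x ≠ 0 := fun x hx => Complex.slitPlane_ne_zero (hslit x hx)
  have hnexp : ∀ (X t : ℝ), ‖Complex.exp (X + t * Complex.I)‖ = Real.exp X := by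
    intro X t; rw [Complex.norm_exp]; simp
  have hcper : ∀ X : ℝ, Complex.exp (X + ((2 * π : ℝ) : ℂ) * Complex.I) = Complex.exp (X + ((0 : ℝ) : ℂ) * Complex.I) := by
    intro X
    push_cast
    rw [zero_mul, add_zero]
    exact Complex.exp_periodic _
  -- large
  obtain ⟨R, hR0, hR⟩ : ∃ R > 0, V ⊆ Metric.ball b R := by
    obtain ⟨R, hR⟩ := hVb.subset_ball b
    exact ⟨max R 1, by positivity, hR.trans (Metric.ball_subset_ball (le_max_left _ _))⟩
  set X1 := Real.log (max R (2 * ‖b - a‖)) with hX1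
  have hX1e : Real.exp X1 = max R (2 * ‖b - a‖) := Real.exp_log (by positivity)
  have hbpos : 0 < ‖b - a‖ := norm_pos_iff.2 hab
  have hlt1 : ∀ t : ℝ, ‖(b - a) / Complex.exp (X1 + t * Complex.I)‖ < 1 := by
    intro t
    rw [norm_div, hnexp, hX1e, div_lt_one (by positivity)]
    exact lt_of_lt_of_le (by linarith) (le_max_right _ _)
  have hlarge := hev X1 (fun t => ((m + n : ℤ) : ℂ) * (X1 + t * Complex.I) +
      m * Complex.log (1 + (b - a) / Complex.exp (X1 + t * Complex.I))) (m + n)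
    (by
      refine (by fun_prop : Continuous fun t : ℝ => ((m + n : ℤ) : ℂ) * (X1 + t * Complex.I)).add
        (continuous_const.mul (Continuous.clog ?_ (fun t => hslit _ (hlt1 t))))
      exact continuous_const.add (continuous_const.div (by fun_prop) (fun t => Complex.exp_ne_zero _)))
    (fun t ht => by
      have := hR ht
      rw [mem_ball_iff_norm] at this
      simp only [he, add_sub_cancel_left, hnexp, hX1e] at this
      exact absurd this (not_lt.2 (le_max_left _ _)))
    (fun t => by
      rw [Complex.exp_add, Complex.exp_int_mul, Complex.exp_int_mul, Complex.exp_log (hne1 _ (hlt1 t))]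
      have hE := Complex.exp_ne_zero (X1 + t * Complex.I)
      simp only [hG, he]
      rw [zpow_add₀ hE, show b + Complex.exp (X1 + t * Complex.I) - a =
        Complex.exp (X1 + t * Complex.I) * (1 + (b - a) / Complex.exp (X1 + t * Complex.I)) by field_simp; ring,
        mul_zpow, add_sub_cancel_left]
      ring)
    (by simp only [hcper]; push_cast; ring)
  -- small
  obtain ⟨r, hr0, hr⟩ : ∃ r > 0, Metric.ball b r ∩ V = ∅ := by
    obtain ⟨r, hr, h⟩ := Metric.isOpen_iff.1 isClosed_closure.isOpen_compl b hbc
    refine ⟨r, hr, ?_⟩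
    ext z; constructor
    · rintro ⟨h1, h2⟩; exact h h1 (subset_closure h2)
    · intro h; exact h.elim
  set X2 := Real.log (min (r / 2) (‖b - a‖ / 2)) with hX2
  have hX2e : Real.exp X2 = min (r / 2) (‖b - a‖ / 2) := Real.exp_log (by positivity)
  have hlt2 : ∀ t : ℝ, ‖Complex.exp (X2 + t * Complex.I) / (b - a)‖ < 1 := by
    intro t
    rw [norm_div, hnexp, hX2e, div_lt_one (by positivity)]
    exact lt_of_le_of_lt (min_le_right _ _) (by linarith)
  have hsmall := hev X2 (fun t => (n : ℂ) * (X2 + t * Complex.I) + m * Complex.log (b - a) +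
      m * Complex.log (1 + Complex.exp (X2 + t * Complex.I) / (b - a))) n
    (by
      refine (by fun_prop : Continuous fun t : ℝ => (n : ℂ) * (X2 + t * Complex.I) + m * Complex.log (b - a)).add
        (continuous_const.mul (Continuous.clog ?_ (fun t => hslit _ (hlt2 t))))
      fun_prop)
    (fun t ht => by
      have h1 : e (X2 + t * Complex.I) ∈ Metric.ball b r ∩ V := by
        refine ⟨?_, ht⟩
        rw [mem_ball_iff_norm]
        simp only [he, add_sub_cancel_left, hnexp, hX2e]
        exact lt_of_le_of_lt (min_le_left _ _) (by linarith)
      rw [hr] at h1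
      exact h1)
    (fun t => by
      rw [Complex.exp_add, Complex.exp_add, Complex.exp_int_mul, Complex.exp_int_mul, Complex.exp_int_mul,
        Complex.exp_log (hne1 _ (hlt2 t)), Complex.exp_log hab]
      simp only [hG, he]
      rw [show b + Complex.exp (X2 + t * Complex.I) - a =
        (b - a) * (1 + Complex.exp (X2 + t * Complex.I) / (b - a)) by field_simp; ring,
        mul_zpow, add_sub_cancel_left]
      ring)
    (by simp only [hcper]; push_cast; ring)
  have h3 := hD X1 X2
  rw [hlarge, hsmall] at h3
  have h2pi : (2 * π * Complex.I : ℂ) ≠ 0 := Complex.two_pi_I_ne_zero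
  have h4 := mul_right_cancel₀ h2pi h3
  have h5 : m + n = n := by exact_mod_cast h4
  omega

lemma p5_curve {Γ : ℝ → ℂ} (hc : ContinuousOn Γ (Set.Icc 0 1)) (hinj : Set.InjOn Γ (Set.Ico 0 1))
    (h01 : Γ 0 = Γ 1) {a b : ℂ} (ha : a ∉ Γ '' Set.Icc 0 1) (hb : b ∉ Γ '' Set.Icc 0 1) :
    ∃ (m n : ℤ) (L : ℂ → ℂ), (m ≠ 0 ∨ n ≠ 0) ∧ Continuous L ∧
      ∀ z ∈ Γ '' Set.Icc 0 1, Complex.exp (L z) = (z - a) ^ m * (z - b) ^ n := by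
  set P : ℝ → ℝ := fun t => (Set.projIcc (0:ℝ) 1 zero_le_one t : ℝ) with hP
  have hPm : ∀ t, P t ∈ Set.Icc (0:ℝ) 1 := fun t => (Set.projIcc (0:ℝ) 1 zero_le_one t).2
  have hPe : ∀ t ∈ Set.Icc (0:ℝ) 1, P t = t := fun t ht => by simp [hP, Set.projIcc_of_mem _ ht]
  have hPc : Continuous P := continuous_subtype_val.comp continuous_projIcc
  have hΓc : Continuous (fun t => Γ (P t)) := hc.comp_continuous hPc hPm
  have hlog : ∀ a : ℂ, a ∉ Γ '' Set.Icc 0 1 → ∃ (ℓ : ℝ → ℂ) (n : ℤ), Continuous ℓ ∧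
      (∀ t ∈ Set.Icc (0:ℝ) 1, Complex.exp (ℓ t) = Γ t - a) ∧ ℓ 1 - ℓ 0 = n * (2 * π * Complex.I) := by
    intro a ha
    obtain ⟨ℓ, hℓ, he⟩ := p5_logR (hΓc.sub continuous_const) (g := fun t => Γ (P t) - a)
      (fun t h => ha ⟨P t, hPm t, sub_eq_zero.1 h⟩)
    have he' : ∀ t ∈ Set.Icc (0:ℝ) 1, Complex.exp (ℓ t) = Γ t - a := by
      intro t ht; rw [he, hPe t ht]
    have : Complex.exp (ℓ 1 - ℓ 0) = 1 := by
      rw [Complex.exp_sub, he' 1 (by simp), he' 0 (by simp), h01]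
      exact div_self (sub_ne_zero.2 (fun h => ha ⟨1, by simp, h⟩))
    obtain ⟨n, hn⟩ := Complex.exp_eq_one_iff.1 this
    exact ⟨ℓ, n, hℓ, he', hn⟩
  obtain ⟨ℓ₁, n₁, hc₁, he₁, hn₁⟩ := hlog a ha
  obtain ⟨ℓ₂, n₂, hc₂, he₂, hn₂⟩ := hlog b hb
  obtain ⟨m, n, hmn, hsum⟩ : ∃ m n : ℤ, (m ≠ 0 ∨ n ≠ 0) ∧ m * n₁ + n * n₂ = 0 := by
    by_cases h : n₁ = 0
    · exact ⟨1, 0, by simp, by simp [h]⟩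
    · exact ⟨n₂, -n₁, Or.inr (by simpa using h), by ring⟩
  set ℓ : ℝ → ℂ := fun t => m * ℓ₁ t + n * ℓ₂ t with hℓ
  have hℓc : Continuous ℓ := by fun_prop
  have hℓ01 : ℓ 0 = ℓ 1 := by
    have : (m : ℂ) * n₁ + n * n₂ = 0 := by exact_mod_cast hsum
    simp only [hℓ]
    linear_combination -(m:ℂ) * hn₁ - n * hn₂ - (2 * π * Complex.I) * this
  set S := Γ '' Set.Icc 0 1 with hS
  have hcomp : IsCompact S := isCompact_Icc.image_of_continuousOn hc
  let Γr : Set.Icc (0:ℝ) 1 → S := fun t => ⟨Γ t, ⟨t, t.2, rfl⟩⟩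
  have hΓr : Continuous Γr := Continuous.subtype_mk (continuousOn_iff_continuous_domRestrict.1 hc) _
  have hsurj : Function.Surjective Γr := by
    rintro ⟨z, t, ht, rfl⟩; exact ⟨⟨t, ht⟩, rfl⟩
  have hq : Topology.IsQuotientMap Γr := (hΓr.isClosedMap).isQuotientMap hΓr hsurj
  have hfib : ∀ s t : Set.Icc (0:ℝ) 1, Γr s = Γr t → ℓ s = ℓ t := by
    rintro ⟨s, hs⟩ ⟨t, ht⟩ h
    have h' : Γ s = Γ t := congrArg Subtype.val h
    simp only
    rcases hs.2.eq_or_lt with h1 | h1 <;> rcases ht.2.eq_or_lt with h2 | h2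
    · rw [h1, h2]
    · subst h1; rw [← hℓ01]
      rw [← h01] at h'
      rw [hinj ⟨le_rfl, one_pos⟩ ⟨ht.1, h2⟩ h']
    · subst h2; rw [← hℓ01]
      rw [← h01] at h'
      rw [hinj ⟨hs.1, h1⟩ ⟨le_rfl, one_pos⟩ h']
    · rw [hinj ⟨hs.1, h1⟩ ⟨ht.1, h2⟩ h']
  let Linv : S → Set.Icc (0:ℝ) 1 := Function.surjInv hsurj
  let L0 : S → ℂ := fun z => ℓ (Linv z)
  have hL0 : ∀ t, L0 (Γr t) = ℓ t := fun t => hfib _ _ (Function.surjInv_eq hsurj (Γr t))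
  have hL0c : Continuous L0 := by
    rw [hq.continuous_iff]
    have : L0 ∘ Γr = fun t : Set.Icc (0:ℝ) 1 => ℓ t := funext hL0
    rw [this]
    exact hℓc.comp continuous_subtype_val
  obtain ⟨L, hL⟩ := ContinuousMap.exists_restrict_eq hcomp.isClosed ⟨L0, hL0c⟩
  refine ⟨m, n, L, hmn, L.continuous, ?_⟩
  rintro z ⟨t, ht, rfl⟩
  have h1 : L (Γ t) = ℓ t := by
    have := congrArg (fun F => F (Γr ⟨t, ht⟩)) hL
    simp only [ContinuousMap.coe_mk, hL0] at this
    exact this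
  rw [h1]
  simp only [hℓ]
  rw [Complex.exp_add, Complex.exp_int_mul, Complex.exp_int_mul, he₁ t ht, he₂ t ht]

lemma p5_conn {Γ : ℝ → ℂ} (hc : ContinuousOn Γ (Set.Icc 0 1)) (hinj : Set.InjOn Γ (Set.Ico 0 1))
    (h01 : Γ 0 = Γ 1) {Ω : Set ℂ} (hΩ : IsOpen Ω) (hΩb : Bornology.IsBounded Ω)
    (hne : Ω.Nonempty) (hfr : frontier Ω = Γ '' Set.Icc 0 1) : IsPreconnected (closure Ω)ᶜ := by
  set W := (closure Ω)ᶜ with hW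
  have hWo : IsOpen W := isClosed_closure.isOpen_compl
  obtain ⟨R, hR0, hR⟩ : ∃ R > 0, closure Ω ⊆ Metric.ball 0 R := by
    obtain ⟨R, hR⟩ := hΩb.closure.subset_ball 0
    exact ⟨max R 1, by positivity, hR.trans (Metric.ball_subset_ball (le_max_left _ _))⟩
  set O : Set ℂ := {z | R < ‖z‖} with hO
  have hOW : O ⊆ W := fun z hz h => by
    have := hR h
    rw [mem_ball_zero_iff] at this
    exact absurd this (not_lt.2 (le_of_lt hz))
  have hOc : IsPreconnected O := by
    have : O = Complex.exp '' {ζ | Real.log R < ζ.re} := by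
      ext z; constructor
      · intro hz
        have hz' : R < ‖z‖ := hz
        have h0 : z ≠ 0 := fun h => by rw [h, norm_zero] at hz'; linarith
        refine ⟨Complex.log z, ?_, Complex.exp_log h0⟩
        simp only [Set.mem_setOf_eq, Complex.log_re]
        exact Real.log_lt_log hR0 hz'
      · rintro ⟨ζ, h, rfl⟩
        simp only [hO, Set.mem_setOf_eq, Complex.norm_exp] at h ⊢
        rwa [← Real.log_lt_iff_lt_exp hR0]
    rw [this]
    exact ((convex_halfSpace_re_gt _).isPreconnected).image _ Complex.continuous_exp.continuousOn
  obtain ⟨o, ho⟩ : O.Nonempty := ⟨((R + 1 : ℝ) : ℂ), by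
    simp only [hO, Set.mem_setOf_eq, Complex.norm_real, Real.norm_eq_abs]
    rw [abs_of_pos (by linarith)]; linarith⟩
  refine isPreconnected_of_forall o fun y hy => ?_
  refine ⟨connectedComponentIn W y, connectedComponentIn_subset _ _, ?_, mem_connectedComponentIn hy,
    isPreconnected_connectedComponentIn⟩
  set C := connectedComponentIn W y with hC
  by_cases hCO : (C ∩ O).Nonempty
  · obtain ⟨x, hxC, hxO⟩ := hCO
    have : C = connectedComponentIn W x := connectedComponentIn_eq hxC
    rw [this]
    exact hOc.subset_connectedComponentIn hxO hOW ho
  · exfalso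
    have hCo : IsOpen C := hWo.connectedComponentIn
    have hCb : Bornology.IsBounded C := by
      refine (Metric.isBounded_closedBall (x := (0:ℂ)) (r := R)).subset fun z hz => ?_
      rw [mem_closedBall_zero_iff]
      by_contra h
      exact hCO ⟨z, hz, not_le.1 h⟩
    have hCW : C ⊆ W := connectedComponentIn_subset _ _
    have hCfr : frontier C ⊆ Γ '' Set.Icc 0 1 := by
      rw [← hfr]
      intro z hz
      by_cases hzW : z ∈ W
      · exfalso
        have hzo : IsOpen (connectedComponentIn W z) := hWo.connectedComponentIn
        obtain ⟨x, hx1, hx2⟩ := mem_closure_iff.1 (frontier_subset_closure hz) _ hzo (mem_connectedComponentIn hzW)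
        have h1 := connectedComponentIn_eq hx1
        have h2 : C = _ := connectedComponentIn_eq hx2
        have : z ∈ C := by rw [h2, ← h1]; exact mem_connectedComponentIn hzW
        rw [hCo.frontier_eq] at hz
        exact hz.2 this
      · have hzc : z ∈ closure Ω := not_not.1 hzW
        rw [hΩ.frontier_eq]
        refine ⟨hzc, fun hzΩ => ?_⟩
        obtain ⟨x, hx1, hx2⟩ := mem_closure_iff.1 (frontier_subset_closure hz) _ hΩ hzΩ
        exact hCW hx2 (subset_closure hx1)
    obtain ⟨a, ha⟩ := hne
    have hyC : y ∈ C := mem_connectedComponentIn hy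
    have haS : a ∉ Γ '' Set.Icc 0 1 := by
      rw [← hfr, hΩ.frontier_eq]; exact fun h => h.2 ha
    have hyS : y ∉ Γ '' Set.Icc 0 1 := by
      rw [← hfr]; exact fun h => hy (frontier_subset_closure h)
    obtain ⟨m, n, L, hmn, hL, hLS⟩ := p5_curve hc hinj h01 haS hyS
    have hm := p5_key hΩ hΩb hfr.le ha (fun h => hy (subset_closure h)) hyS hL hLS
    have hn := p5_key hCo hCb hCfr hyC (fun h => hCW h (subset_closure ha)) haS (m := n) (n := m) hL
      (fun z hz => by rw [hLS z hz, mul_comm])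
    rcases hmn with h | h
    · exact h hm
    · exact h hn

lemma p1_null {X : Type*} [EMetricSpace X] [MeasurableSpace X] [BorelSpace X] {f : ℝ → X} {K : NNReal}
    {s : Set ℝ} (hf : LipschitzOnWith K f s) (hs : volume s = 0) : (Measure.hausdorffMeasure 1 : Measure X) (f '' s) = 0 := by
  have := hf.hausdorffMeasure_image_le (d := 1) zero_le_one
  rw [hausdorffMeasure_real, hs] at this
  simpa using this

lemma p1_tau {G : ℝ → ℂ} (hc : Continuous G) (hv : LocallyBoundedVariationOn G Set.univ) :
    ∃ τ : ℝ ≃o ℝ, LipschitzWith 1 τ ∧ LipschitzWith 1 (G ∘ τ) ∧ τ 0 = 0 := by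
  set V := variationOnFromTo G Set.univ 0 with hV
  have hVm : Monotone V := fun a b hab =>
    variationOnFromTo.monotoneOn hv (Set.mem_univ _) (Set.mem_univ a) (Set.mem_univ b) hab
  have hVd : ∀ a b, a ≤ b → dist (G a) (G b) ≤ V b - V a := by
    intro a b hab
    rw [hV, variationOnFromTo.sub_right hv trivial trivial trivial, variationOnFromTo.eq_of_le _ _ hab,
      dist_edist]
    exact ENNReal.toReal_mono (hv a b trivial trivial)
      (eVariationOn.edist_le _ ⟨trivial, le_rfl, hab⟩ ⟨trivial, hab, le_rfl⟩)
  have hVc : Continuous V := by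
    rw [continuous_iff_continuousAt]
    intro b
    rw [continuousAt_iff_continuous_left'_right']
    constructor
    · have := variationOnFromTo.tendsto_left (f := G) (s := Set.univ) (a := 0) (b := b) trivial trivial hv
        (hc.continuousAt.tendsto.mono_left nhdsWithin_le_nhds)
      simpa [ContinuousWithinAt] using this
    · have := variationOnFromTo.tendsto_right (f := G) (s := Set.univ) (a := 0) (b := b) trivial trivial hv
        (hc.continuousAt.tendsto.mono_left nhdsWithin_le_nhds)
      simpa [ContinuousWithinAt] using this
  have hV0 : V 0 = 0 := variationOnFromTo.self _ _ _
  set σ : ℝ → ℝ := fun t => t + V t with hσ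
  have hσm : StrictMono σ := strictMono_id.add_monotone hVm
  have hσc : Continuous σ := continuous_id.add hVc
  have hσs : Function.Surjective σ := by
    apply hσc.surjective
    · refine tendsto_atTop_mono' _ ?_ tendsto_id
      filter_upwards [eventually_ge_atTop 0] with t ht
      have := hVm ht
      simp only [hσ, id]; linarith
    · refine tendsto_atBot_mono' _ ?_ tendsto_id
      filter_upwards [eventually_le_atBot 0] with t ht
      have := hVm ht
      simp only [hσ, id]; linarith
  let e := StrictMono.orderIsoOfSurjective σ hσm hσs
  have he : ∀ s, σ (e.symm s) = s := fun s => e.apply_symm_apply s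
  refine ⟨e.symm, ?_, ?_, ?_⟩
  · refine LipschitzWith.of_dist_le' (K := 1) ?_ |>.weaken (by simp)
    intro x y
    wlog hxy : x ≤ y generalizing x y
    · rw [dist_comm, dist_comm x]; exact this y x (le_of_not_ge hxy)
    have h1 := e.symm.monotone hxy
    have h2 := hVm h1
    have h3 := he x; have h4 := he y
    simp only [hσ] at h3 h4
    rw [dist_comm, dist_comm x, Real.dist_eq, Real.dist_eq, abs_of_nonneg (by linarith), abs_of_nonneg (by linarith)]
    linarith
  · refine LipschitzWith.of_dist_le' (K := 1) ?_ |>.weaken (by simp)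
    intro x y
    wlog hxy : x ≤ y generalizing x y
    · rw [dist_comm, dist_comm x]; exact this y x (le_of_not_ge hxy)
    have h1 := e.symm.monotone hxy
    have h2 := hVd _ _ h1
    have h3 := he x; have h4 := he y
    simp only [hσ] at h3 h4
    rw [dist_comm x, Real.dist_eq, abs_of_nonneg (by linarith)]
    simp only [Function.comp]
    linarith
  · rw [OrderIso.symm_apply_eq]
    change 0 = 0 + V 0
    simp [hV0]

structure P1D (S : Set ℂ) (γ κ : ℝ → ℂ) (L : ℝ) : Prop where
  pos : 0 < L
  lip : LipschitzWith 1 γ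
  img : γ '' Set.Icc 0 L = S
  inj : Set.InjOn γ (Set.Ico 0 L)
  ends : γ 0 = γ L
  meas : Measurable κ
  bd : ∀ s, ‖κ s‖ ≤ 1
  supp : ∀ s, s ∉ Set.Ioo 0 L → κ s = 0
  der : ∀ s, κ s = 0 ∨ HasDerivAt γ (κ s) s

lemma p1_cov {Γ κ γ : ℝ → ℂ} {τ : ℝ ≃o ℝ} {L : ℝ} (hτ : LipschitzWith 1 τ) (h0 : τ 0 = 0) (h1 : τ L = 1)
    (hγ : ∀ s ∈ Set.Ioo 0 L, γ s = Γ (τ s))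
    (hκ : ∀ s, κ s = Set.indicator (Set.Ioo 0 L) (fun s => ((deriv τ s : ℝ) : ℂ) * deriv Γ (τ s)) s)
    {E : Type*} [NormedAddCommGroup E] [NormedSpace ℂ E] (F : ℂ → E) :
    ∫ t in (0:ℝ)..1, deriv Γ t • F (Γ t) = ∫ s, κ s • F (γ s) := by
  set D := Set.Ioo 0 L ∩ {s | DifferentiableAt ℝ τ s} with hD
  have hDm : MeasurableSet D := measurableSet_Ioo.inter (measurableSet_of_differentiableAt ℝ τ)
  have hae : ∀ᵐ s : ℝ, DifferentiableAt ℝ τ s := hτ.ae_differentiableAt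
  have himg : τ '' Set.Ioo 0 L = Set.Ioo 0 1 := by rw [τ.image_Ioo, h0, h1]
  have hDae : (τ '' D : Set ℝ) =ᵐ[volume] Set.Ioo 0 1 := by
    rw [ae_eq_set]
    constructor
    · rw [Set.diff_eq_empty.2]; simp
      rw [← himg]; exact Set.image_mono Set.inter_subset_left
    · refine measure_mono_null (t := τ '' {s | ¬ DifferentiableAt ℝ τ s}) ?_ ?_
      · rw [← himg]
        rintro _ ⟨⟨s, hs, rfl⟩, hn⟩
        exact ⟨s, fun hd => hn ⟨s, ⟨hs, hd⟩, rfl⟩, rfl⟩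
      · rw [← hausdorffMeasure_real]
        exact p1_null (hτ.lipschitzOnWith (s := _)) hae
  have h2 := integral_image_eq_integral_abs_deriv_smul hDm (f := τ) (f' := deriv τ)
    (fun x hx => hx.2.hasDerivAt.hasDerivWithinAt) (τ.injective.injOn) (fun t => deriv Γ t • F (Γ t))
  rw [intervalIntegral.integral_of_le zero_le_one, integral_Ioc_eq_integral_Ioo, ← setIntegral_congr_set hDae, h2]
  have hD' : (D : Set ℝ) =ᵐ[volume] Set.Ioo 0 L := by
    filter_upwards [hae] with s hs
    apply propext
    exact ⟨fun h => h.1, fun h => ⟨h, hs⟩⟩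
  rw [setIntegral_congr_set hD', ← integral_indicator measurableSet_Ioo]
  congr 1
  ext s
  rw [hκ s]
  by_cases hs : s ∈ Set.Ioo 0 L
  · rw [Set.indicator_of_mem hs, Set.indicator_of_mem hs, hγ s hs, abs_of_nonneg τ.monotone.deriv_nonneg, mul_smul,
      Complex.coe_smul]
  · rw [Set.indicator_of_notMem hs, Set.indicator_of_notMem hs, zero_smul]

lemma p1_exists {Γ : ℝ → ℂ} (hc : ContinuousOn Γ (Set.Icc 0 1)) (hinj : Set.InjOn Γ (Set.Ico 0 1))
    (h01 : Γ 0 = Γ 1) (hr : eVariationOn Γ (Set.Icc 0 1) ≠ ⊤)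
    (E : Type*) [NormedAddCommGroup E] [NormedSpace ℂ E] :
    ∃ γ κ L, P1D (Γ '' Set.Icc 0 1) γ κ L ∧ γ 0 = Γ 0 ∧
      (∀ F : ℂ → ℂ, ∫ t in (0:ℝ)..1, deriv Γ t • F (Γ t) = ∫ s, κ s • F (γ s)) ∧
      (∀ F : ℂ → E, ∫ t in (0:ℝ)..1, deriv Γ t • F (Γ t) = ∫ s, κ s • F (γ s)) := by
  set G : ℝ → ℂ := Set.IccExtend (zero_le_one' ℝ) (fun t : Set.Icc (0:ℝ) 1 => Γ t) with hG
  have hGeq : ∀ t ∈ Set.Icc (0:ℝ) 1, G t = Γ t := fun t ht => by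
    rw [hG, Set.IccExtend_of_mem _ _ ht]
  have hGc : Continuous G := (continuousOn_iff_continuous_restrict.1 hc).Icc_extend'
  have hGv : LocallyBoundedVariationOn G Set.univ := by
    apply BoundedVariationOn.locallyBoundedVariationOn
    refine ne_top_of_le_ne_top hr ?_
    have := eVariationOn.comp_le_of_monotoneOn Γ (s := Set.Icc 0 1) (t := Set.univ)
      (fun t => ((Set.projIcc (0:ℝ) 1 zero_le_one t : Set.Icc (0:ℝ) 1) : ℝ))
      (fun a _ b _ hab => Set.monotone_projIcc _ hab) (fun t _ => Subtype.coe_prop _)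
    exact this
  obtain ⟨τ, hτ, hGτ, h0⟩ := p1_tau hGc hGv
  obtain ⟨L, h1⟩ := τ.surjective 1
  have hL : 0 < L := by rw [← τ.lt_iff_lt, h0, h1]; exact one_pos
  have hIcc : ∀ s, s ∈ Set.Icc 0 L ↔ τ s ∈ Set.Icc (0:ℝ) 1 := fun s => by
    rw [Set.mem_Icc, Set.mem_Icc, ← τ.le_iff_le, ← τ.le_iff_le (x := s), h0, h1]
  have hIoo : ∀ s, s ∈ Set.Ioo 0 L ↔ τ s ∈ Set.Ioo (0:ℝ) 1 := fun s => by
    rw [Set.mem_Ioo, Set.mem_Ioo, ← τ.lt_iff_lt, ← τ.lt_iff_lt (x := s), h0, h1]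
  set κ : ℝ → ℂ := Set.indicator (Set.Ioo 0 L) (fun s => ((deriv τ s : ℝ) : ℂ) * deriv Γ (τ s)) with hκ
  have hder : ∀ s, κ s = 0 ∨ HasDerivAt (G ∘ τ) (κ s) s := by
    intro s
    by_cases hs : s ∈ Set.Ioo 0 L
    swap
    · left; rw [hκ, Set.indicator_of_notMem hs]
    by_cases h2 : DifferentiableAt ℝ τ s
    swap
    · left; rw [hκ, Set.indicator_of_mem hs, deriv_zero_of_not_differentiableAt h2]; simp
    by_cases h3 : DifferentiableAt ℝ Γ (τ s)
    swap
    · left; rw [hκ, Set.indicator_of_mem hs, deriv_zero_of_not_differentiableAt h3]; simp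
    right
    rw [hκ, Set.indicator_of_mem hs]
    have h4 : HasDerivAt G (deriv Γ (τ s)) (τ s) := h3.hasDerivAt.congr_of_eventuallyEq (by
      filter_upwards [Ioo_mem_nhds ((hIoo s).1 hs).1 ((hIoo s).1 hs).2] with t ht
      exact hGeq t (Set.Ioo_subset_Icc_self ht))
    have := HasDerivAt.scomp s h4 h2.hasDerivAt
    rwa [Complex.real_smul] at this
  have hγ0 : G (τ 0) = Γ 0 := by rw [h0]; exact hGeq 0 (by simp)
  have hco : ∀ s ∈ Set.Ioo 0 L, (G ∘ τ) s = Γ (τ s) := fun s hs =>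
    hGeq _ (Set.Ioo_subset_Icc_self ((hIoo s).1 hs))
  refine ⟨G ∘ τ, κ, L, ⟨hL, hGτ, ?_, ?_, ?_, ?_, ?_, ?_, hder⟩, hγ0,
    p1_cov hτ h0 h1 hco (fun _ => rfl), p1_cov hτ h0 h1 hco (fun _ => rfl)⟩
  · rw [Set.image_comp, τ.image_Icc, h0, h1]
    exact Set.image_congr hGeq
  · intro a ha b hb hab
    have h' : ∀ s ∈ Set.Ico 0 L, τ s ∈ Set.Ico (0:ℝ) 1 := fun s hs => by
      rw [← h0, ← h1]; exact ⟨τ.le_iff_le.2 hs.1, τ.lt_iff_lt.2 hs.2⟩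
    simp only [Function.comp] at hab
    rw [hGeq _ (Set.Ico_subset_Icc_self (h' a ha)), hGeq _ (Set.Ico_subset_Icc_self (h' b hb))] at hab
    exact τ.injective (hinj (h' a ha) (h' b hb) hab)
  · simp only [Function.comp]
    rw [h0, h1, hGeq 0 (by simp), hGeq 1 (by simp), h01]
  · refine Measurable.indicator ?_ measurableSet_Ioo
    exact (Complex.measurable_ofReal.comp (measurable_deriv _)).mul ((measurable_deriv Γ).comp τ.continuous.measurable)
  · intro s
    rcases hder s with h | h
    · simp [h]
    · simpa using h.le_of_lipschitz hGτ
  · intro s hs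
    rw [hκ, Set.indicator_of_notMem hs]

lemma p3_cone {β : ℝ} (hβ : 0 < β) (x : ℂ) (hx : β * |x.re| ≤ |x.im|) (v : ℝ) :
    |v| + ‖x‖ ≤ (3 + 2 / β) * ‖(v:ℂ) - x‖ := by
  have h1 : |x.im| ≤ ‖(v:ℂ) - x‖ := by
    have := Complex.abs_im_le_norm ((v:ℂ) - x)
    simpa using this
  have h2 : ‖x‖ ≤ |x.re| + |x.im| := Complex.norm_le_abs_re_add_abs_im x
  have h3 : |x.re| ≤ ‖(v:ℂ) - x‖ / β := by rw [le_div_iff₀ hβ]; nlinarith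
  have h4 : |v| ≤ ‖(v:ℂ) - x‖ + ‖x‖ := by
    have := norm_add_le ((v:ℂ) - x) x
    simpa using this
  have : (3 + 2 / β) * ‖(v:ℂ) - x‖ = 3 * ‖(v:ℂ) - x‖ + 2 * (‖(v:ℂ) - x‖ / β) := by ring
  rw [this]; linarith

lemma p3_lower {g : ℝ → ℂ} (hg : Continuous g) {s L : ℝ} (hs : s ∈ Set.Ioo 0 L) (hd : HasDerivAt g 1 s)
    (h0 : g s = 0) (hne : ∀ u ∈ Set.Icc 0 L, u ≠ s → g u ≠ 0) {β : ℝ} (hβ : 0 < β) :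
    ∃ r > 0, ∃ c > 0, ∀ x : ℂ, ‖x‖ < r → β * |x.re| ≤ |x.im| → ∀ u ∈ Set.Icc 0 L,
      c * (|u - s| + ‖x‖) ≤ ‖g u - x‖ := by
  set B := 3 + 2 / β with hB
  have hBpos : 0 < B := by positivity
  have h1 := (hasDerivAt_iff_isLittleO.1 hd).def (c := 1 / (2 * B)) (by positivity)
  obtain ⟨δ, hδ, h1⟩ := Metric.eventually_nhds_iff.1 h1
  have hcpt : IsCompact (Set.Icc 0 L \ Metric.ball s δ) := isCompact_Icc.diff Metric.isOpen_ball
  obtain ⟨m, hm, hm2⟩ : ∃ m > 0, ∀ u ∈ Set.Icc 0 L \ Metric.ball s δ, m ≤ ‖g u‖ := by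
    rcases (Set.Icc 0 L \ Metric.ball s δ).eq_empty_or_nonempty with he | hn
    · exact ⟨1, one_pos, by simp [he]⟩
    · obtain ⟨u0, hu0, hmin⟩ := hcpt.exists_isMinOn hn hg.norm.continuousOn
      refine ⟨‖g u0‖, norm_pos_iff.2 (hne u0 hu0.1 ?_), fun u hu => hmin hu⟩
      rintro rfl; exact hu0.2 (Metric.mem_ball_self hδ)
  have hL : 0 < L := hs.1.trans hs.2
  refine ⟨m / 2, by positivity, min (1 / (2 * B)) (m / 2 / (L + m / 2)), by positivity, ?_⟩
  intro x hxr hx u hu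
  by_cases hus : dist u s < δ
  · have h2 := h1 hus
    rw [h0] at h2
    have h3 := p3_cone hβ x hx (u - s)
    have h4 : ‖((u - s : ℝ) : ℂ) - x‖ ≤ ‖g u - x‖ + 1 / (2 * B) * |u - s| := by
      have h5 : ((u - s : ℝ) : ℂ) - x = (g u - x) - (g u - 0 - (u - s) • 1) := by
        simp
      rw [h5]
      refine (norm_sub_le _ _).trans ?_
      have h2' : ‖g u - 0 - (u - s) • (1:ℂ)‖ ≤ 1 / (2 * B) * |u - s| := by simpa using h2
      linarith
    have h6 : (|u - s| + ‖x‖) / B ≤ ‖g u - x‖ + 1 / (2 * B) * |u - s| := by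
      refine le_trans ?_ h4
      rw [div_le_iff₀ hBpos]; linarith
    have h7 : (|u - s| + ‖x‖) / B = 1 / (2 * B) * (|u - s| + ‖x‖) + 1 / (2 * B) * |u - s| + 1 / (2 * B) * ‖x‖ := by
      field_simp; ring
    have h8 : 0 ≤ 1 / (2 * B) * ‖x‖ := by positivity
    calc _ ≤ 1 / (2 * B) * (|u - s| + ‖x‖) := by gcongr; exact min_le_left _ _
      _ ≤ _ := by linarith
  · have h2 := hm2 u ⟨hu, hus⟩
    have h3 : |u - s| ≤ L := by rw [abs_le]; constructor <;> linarith [hu.1, hu.2, hs.1, hs.2]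
    calc _ ≤ m / 2 / (L + m / 2) * (L + m / 2) := by
            gcongr
            exact min_le_right _ _
      _ = m / 2 := by field_simp
      _ ≤ ‖g u‖ - ‖x‖ := by linarith
      _ ≤ _ := norm_sub_norm_le _ _

lemma p3_line {a b : ℝ} (ha : a < 0) (hb : 0 < b) :
    Tendsto (fun x : ℂ => ∫ v in a..b, (((v:ℂ) - x)⁻¹ - ((v:ℂ) + x)⁻¹)) (𝓝[{x : ℂ | 0 < x.im}] 0)
      (𝓝 (2 * π * Complex.I)) := by
  have key : ∀ x : ℂ, 0 < x.im → ∫ v in a..b, (((v:ℂ) - x)⁻¹ - ((v:ℂ) + x)⁻¹) =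
      (Complex.log (b - x) - Complex.log (b + x)) - (Complex.log (a - x) - Complex.log (a + x)) := by
    intro x hx
    have hm : ∀ v : ℝ, (v:ℂ) - x ∈ Complex.slitPlane := fun v => by
      rw [Complex.mem_slitPlane_iff]; right; simp; exact hx.ne'
    have hp : ∀ v : ℝ, (v:ℂ) + x ∈ Complex.slitPlane := fun v => by
      rw [Complex.mem_slitPlane_iff]; right; simp; exact hx.ne'
    refine intervalIntegral.integral_eq_sub_of_hasDerivAt (f := fun v : ℝ => Complex.log (v - x) - Complex.log (v + x)) ?_ ?_
    · intro v _
      have h1 : HasDerivAt (fun v : ℝ => (v:ℂ) - x) 1 v := (Complex.ofRealCLM.hasDerivAt (x := v)).sub_const x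
      have h2 : HasDerivAt (fun v : ℝ => (v:ℂ) + x) 1 v := (Complex.ofRealCLM.hasDerivAt (x := v)).add_const x
      have := (h1.clog_real (hm v)).sub (h2.clog_real (hp v))
      simp only [one_div] at this
      exact this
    · apply Continuous.intervalIntegrable
      exact ((Complex.continuous_ofReal.sub continuous_const).inv₀ fun v => Complex.slitPlane_ne_zero (hm v)).sub
        ((Complex.continuous_ofReal.add continuous_const).inv₀ fun v => Complex.slitPlane_ne_zero (hp v))
  have hb' : (b:ℂ) ∈ Complex.slitPlane := Complex.ofReal_mem_slitPlane.2 hb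
  have t1 : Tendsto (fun x : ℂ => Complex.log (b - x)) (𝓝[{x : ℂ | 0 < x.im}] 0) (𝓝 (Complex.log b)) := by
    refine (Tendsto.comp (y := 𝓝 (b:ℂ)) (continuousAt_clog hb').tendsto ?_)
    refine tendsto_nhdsWithin_of_tendsto_nhds ?_
    exact Continuous.tendsto' (by fun_prop) _ _ (by simp)
  have t2 : Tendsto (fun x : ℂ => Complex.log (b + x)) (𝓝[{x : ℂ | 0 < x.im}] 0) (𝓝 (Complex.log b)) := by
    refine (Tendsto.comp (y := 𝓝 (b:ℂ)) (continuousAt_clog hb').tendsto ?_)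
    refine tendsto_nhdsWithin_of_tendsto_nhds ?_
    exact Continuous.tendsto' (by fun_prop) _ _ (by simp)
  have t3 : Tendsto (fun x : ℂ => Complex.log (a - x)) (𝓝[{x : ℂ | 0 < x.im}] 0) (𝓝 (Real.log ‖(a:ℂ)‖ - π * Complex.I)) := by
    refine (Complex.tendsto_log_nhdsWithin_im_neg_of_re_neg_of_im_zero (z := (a:ℂ)) (by simpa using ha) (by simp)).comp ?_
    refine tendsto_nhdsWithin_of_tendsto_nhds_of_eventually_within _ ?_ ?_
    · exact tendsto_nhdsWithin_of_tendsto_nhds (Continuous.tendsto' (by fun_prop) _ _ (by simp))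
    · filter_upwards [self_mem_nhdsWithin] with x hx
      simpa using hx
  have t4 : Tendsto (fun x : ℂ => Complex.log (a + x)) (𝓝[{x : ℂ | 0 < x.im}] 0) (𝓝 (Real.log ‖(a:ℂ)‖ + π * Complex.I)) := by
    refine (Complex.tendsto_log_nhdsWithin_im_nonneg_of_re_neg_of_im_zero (z := (a:ℂ)) (by simpa using ha) (by simp)).comp ?_
    refine tendsto_nhdsWithin_of_tendsto_nhds_of_eventually_within _ ?_ ?_
    · exact tendsto_nhdsWithin_of_tendsto_nhds (Continuous.tendsto' (by fun_prop) _ _ (by simp))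
    · filter_upwards [self_mem_nhdsWithin] with x hx
      have hx' : 0 < x.im := hx
      simpa using hx'.le
  have := ((t1.sub t2).sub (t3.sub t4))
  refine (this.congr' ?_).trans (by ring_nf; rfl)
  filter_upwards [self_mem_nhdsWithin] with x hx
  exact (key x hx).symm

lemma p3_avg {η : ℝ → ℝ} (hη : Continuous η) {s : ℝ} (h0 : η s = 0) :
    Tendsto (fun r => r⁻¹ * ∫ u in Metric.closedBall s r, η u) (𝓝[>] 0) (𝓝 0) := by
  rw [Metric.tendsto_nhds]
  intro ε hε
  obtain ⟨δ, hδ, h1⟩ := Metric.eventually_nhds_iff.1 (Metric.tendsto_nhds.1 hη.continuousAt.tendsto (ε / 4) (by positivity))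
  filter_upwards [Ioo_mem_nhdsGT hδ] with r hr
  have h2 : ‖∫ u in Metric.closedBall s r, η u‖ ≤ ε / 4 * volume.real (Metric.closedBall s r) := by
    refine norm_setIntegral_le_of_norm_le_const (isCompact_closedBall s r).measure_lt_top ?_
    intro u hu
    have := h1 (lt_of_le_of_lt hu hr.2)
    rw [h0, dist_zero_right] at this
    exact this.le
  rw [Real.volume_real_closedBall hr.1.le] at h2
  rw [dist_zero_right, norm_mul, norm_inv, Real.norm_of_nonneg hr.1.le]
  have hr0 := hr.1
  calc _ ≤ r⁻¹ * (ε / 4 * (2 * r)) := by gcongr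
    _ = ε / 2 := by field_simp; ring
    _ < ε := by linarith

set_option maxHeartbeats 800000 in
lemma p3_jump {g k : ℝ → ℂ} (hg : Continuous g) {s L : ℝ} (hs : s ∈ Set.Ioo 0 L) (hd : HasDerivAt g 1 s)
    (h0 : g s = 0) (hne : ∀ u ∈ Set.Icc 0 L, u ≠ s → g u ≠ 0)
    (hk : Integrable k) (hk0 : ∀ u, u ∉ Set.Ioo 0 L → k u = 0)
    (hL : Tendsto (fun r => r⁻¹ * ∫ u in Metric.closedBall s r, ‖k u - k s‖) (𝓝[>] 0) (𝓝 0)) {β : ℝ} (hβ : 0 < β) :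
    Tendsto (fun x : ℂ => (∫ u, k u / (g u - x)) - ∫ u, k u / (g u + x)) (𝓝[{x : ℂ | β * |x.re| < x.im}] 0)
      (𝓝 (2 * π * Complex.I * k s)) := by
  obtain ⟨r, hr, c, hc, hlow⟩ := p3_lower hg hs hd h0 hne hβ
  obtain ⟨r', hr', c', hc', hlow'⟩ := p3_lower (g := fun u => ((u - s : ℝ) : ℂ)) (by fun_prop) hs
    (by simpa using (Complex.ofRealCLM.hasDerivAt (x := s)).sub_const (s:ℂ)) (by simp)
    (fun u _ hu => by simpa [sub_eq_zero] using hu) hβ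
  set e := k s with he
  set η : ℝ → ℝ := fun u => ‖1 - (slope g s u) ^ 2‖ with hη
  have hηd : ∃ η' : ℝ → ℝ, Continuous η' ∧ η' s = 0 ∧ (∀ u, 0 ≤ η' u) ∧
      ∀ u, ‖((u - s : ℝ) : ℂ) ^ 2 - g u ^ 2‖ ≤ η' u * (u - s) ^ 2 := by
    refine ⟨fun u => ‖1 - (dslope g s u) ^ 2‖, ?_, ?_, fun u => norm_nonneg _, ?_⟩
    · refine (continuous_const.sub (Continuous.pow ?_ 2)).norm
      rw [continuous_iff_continuousAt]
      intro u
      rcases eq_or_ne u s with rfl | hu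
      · exact continuousAt_dslope_same.2 hd.differentiableAt
      · exact (continuousAt_dslope_of_ne hu).2 hg.continuousAt
    · simp [dslope_same, hd.deriv]
    · intro u
      have h1 : g u = ((u - s : ℝ) : ℂ) * dslope g s u := by
        have := sub_smul_dslope g s u
        rw [h0, sub_zero, Complex.real_smul] at this
        exact this.symm
      rw [h1, mul_pow, ← mul_one_sub, norm_mul, mul_comm, norm_pow, Complex.norm_real, Real.norm_eq_abs, sq_abs]
  clear hη
  clear η
  obtain ⟨η, hηc, hη0, hηn, hη⟩ := hηd
  set G : ℝ → ℝ := Set.indicator (Set.Icc 0 L) (fun u => ‖k u - e‖ + ‖e‖ * η u) with hG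
  have hGi : Integrable G := by
    rw [hG, integrable_indicator_iff measurableSet_Icc]
    refine Integrable.add ?_ (Continuous.integrableOn_Icc (by fun_prop))
    exact (hk.integrableOn.sub (by simp)).norm
  have hG0 : ∀ u, 0 ≤ G u := fun u => Set.indicator_nonneg (fun u _ => by have := hηn u; positivity) u
  have hGL : Tendsto (fun r => r⁻¹ * ∫ u in Metric.closedBall s r, G u) (𝓝[>] 0) (𝓝 0) := by
    have h1 := hL.add ((p3_avg hηc hη0).const_mul ‖e‖)
    rw [mul_zero, add_zero] at h1
    refine tendsto_of_tendsto_of_tendsto_of_le_of_le' tendsto_const_nhds h1 ?_ ?_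
    · filter_upwards [self_mem_nhdsWithin] with r hr
      exact mul_nonneg (inv_nonneg.2 (le_of_lt hr)) (integral_nonneg hG0)
    · filter_upwards [self_mem_nhdsWithin] with r hr
      have hr0 : 0 < r := hr
      have i1 : IntegrableOn (fun u => ‖k u - e‖) (Metric.closedBall s r) :=
        (hk.integrableOn.sub (continuous_const.continuousOn.integrableOn_compact (isCompact_closedBall s r))).norm
      have i2 : IntegrableOn (fun u => ‖e‖ * η u) (Metric.closedBall s r) :=
        ContinuousOn.integrableOn_compact (isCompact_closedBall s r) (by fun_prop)
      calc _ ≤ r⁻¹ * ∫ u in Metric.closedBall s r, (‖k u - e‖ + ‖e‖ * η u) := by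
            refine mul_le_mul_of_nonneg_left ?_ (inv_nonneg.2 hr0.le)
            refine integral_mono hGi.integrableOn (i1.add i2) fun u => ?_
            refine Set.indicator_le_self' (fun u _ => ?_) u
            have := hηn u; positivity
        _ = _ := by
            rw [integral_add i1 i2, integral_const_mul]; ring
  have hpois := p2_poisson G hGi hG0 s hGL
  set C : ℝ := 2 / c ^ 2 + 2 / (c ^ 2 * c' ^ 2) with hC
  have hmain : ∀ x : ℂ, β * |x.re| < x.im → ‖x‖ < min r r' →
      ‖((∫ u, k u / (g u - x)) - ∫ u, k u / (g u + x)) -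
        e * ∫ v in (-s)..(L - s), (((v:ℂ) - x)⁻¹ - ((v:ℂ) + x)⁻¹)‖ ≤
      C * ∫ u, ‖x‖ / (‖x‖ ^ 2 + (u - s) ^ 2) * G u := by
    intro x hx hxr
    have him : 0 < x.im := lt_of_le_of_lt (by positivity) hx
    have hx0 : 0 < ‖x‖ := norm_pos_iff.2 (by rintro rfl; simp at him)
    have hcone : β * |x.re| ≤ |x.im| := by rw [abs_of_pos him]; exact hx.le
    have hcone' : β * |(-x).re| ≤ |(-x).im| := by simpa using hcone
    have l1 : ∀ u ∈ Set.Icc 0 L, c * (|u - s| + ‖x‖) ≤ ‖g u - x‖ := hlow x (hxr.trans_le (min_le_left _ _)) hcone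
    have l2 : ∀ u ∈ Set.Icc 0 L, c * (|u - s| + ‖x‖) ≤ ‖g u + x‖ := fun u hu => by
      have := hlow (-x) (by rw [norm_neg]; exact hxr.trans_le (min_le_left _ _)) hcone' u hu
      rwa [norm_neg, sub_neg_eq_add] at this
    have l3 : ∀ u ∈ Set.Icc 0 L, c' * (|u - s| + ‖x‖) ≤ ‖((u - s : ℝ) : ℂ) - x‖ :=
      hlow' x (hxr.trans_le (min_le_right _ _)) hcone
    have l4 : ∀ u ∈ Set.Icc 0 L, c' * (|u - s| + ‖x‖) ≤ ‖((u - s : ℝ) : ℂ) + x‖ := fun u hu => by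
      have := hlow' (-x) (by rw [norm_neg]; exact hxr.trans_le (min_le_right _ _)) hcone' u hu
      rwa [norm_neg, sub_neg_eq_add] at this
    have hint : ∀ q : ℝ → ℂ, Continuous q → (∀ u ∈ Set.Icc 0 L, c * (|u - s| + ‖x‖) ≤ ‖q u‖) →
        Integrable (fun u => k u / q u) := by
      intro q hq hl
      refine Integrable.mono' (hk.norm.mul_const (c * ‖x‖)⁻¹) ?_ (ae_of_all _ fun u => ?_)
      · exact (hk.aestronglyMeasurable.aemeasurable.div hq.measurable.aemeasurable).aestronglyMeasurable
      · by_cases hu : u ∈ Set.Ioo 0 L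
        · rw [norm_div, div_eq_mul_inv]
          gcongr
          refine le_trans ?_ (hl u (Set.Ioo_subset_Icc_self hu))
          gcongr
          have := abs_nonneg (u - s); linarith
        · simp [hk0 u hu]
    have hi1 := hint (fun u => g u - x) (hg.sub continuous_const) l1
    have hi2 := hint (fun u => g u + x) (hg.add continuous_const) l2
    rw [← integral_sub hi1 hi2]
    have him1 : ∀ u : ℝ, ((u - s : ℝ) : ℂ) - x ≠ 0 := fun u h => by
      have := congrArg Complex.im h; simp at this; linarith
    have him2 : ∀ u : ℝ, ((u - s : ℝ) : ℂ) + x ≠ 0 := fun u h => by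
      have := congrArg Complex.im h; simp at this; linarith
    have hq : Continuous (fun u : ℝ => (((u - s : ℝ) : ℂ) - x)⁻¹ - (((u - s : ℝ) : ℂ) + x)⁻¹) :=
      (Continuous.inv₀ (by fun_prop) him1).sub (Continuous.inv₀ (by fun_prop) him2)
    have hsub : ∫ v in (-s)..(L - s), (((v:ℂ) - x)⁻¹ - ((v:ℂ) + x)⁻¹) =
        ∫ u, Set.indicator (Set.Icc 0 L) (fun u => (((u - s : ℝ) : ℂ) - x)⁻¹ - (((u - s : ℝ) : ℂ) + x)⁻¹) u := by
      rw [integral_indicator measurableSet_Icc, integral_Icc_eq_integral_Ioc,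
        ← intervalIntegral.integral_of_le (hs.1.trans hs.2).le,
        intervalIntegral.integral_comp_sub_right (f := fun v : ℝ => ((v:ℂ) - x)⁻¹ - ((v:ℂ) + x)⁻¹), zero_sub]
    rw [hsub, ← integral_const_mul, ← integral_sub (f := fun u => k u / (g u - x) - k u / (g u + x)) (hi1.sub hi2), ← integral_const_mul]
    swap
    · refine Integrable.const_mul ?_ _
      rw [integrable_indicator_iff measurableSet_Icc]
      exact hq.integrableOn_Icc
    refine norm_integral_le_of_norm_le ?_ (ae_of_all _ fun u => ?_)
    · refine Integrable.const_mul ?_ _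
      refine hGi.bdd_mul (c := 1 / ‖x‖) (Continuous.aestronglyMeasurable ?_) (ae_of_all _ fun u => ?_)
      · exact Continuous.div continuous_const (by fun_prop) (fun u => by positivity)
      · rw [Real.norm_of_nonneg (by positivity), div_le_div_iff₀ (by positivity) hx0]
        nlinarith [sq_nonneg (u - s)]
    · by_cases hu : u ∈ Set.Icc 0 L
      swap
      · have : u ∉ Set.Ioo 0 L := fun h => hu (Set.Ioo_subset_Icc_self h)
        simp [hk0 u this, Set.indicator_of_notMem hu, hG]
      simp only [hG, Set.indicator_of_mem hu]
      have L1 := l1 u hu; have L2 := l2 u hu; have L3 := l3 u hu; have L4 := l4 u hu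
      have L0 : 0 < |u - s| + ‖x‖ := by positivity
      set D := |u - s| + ‖x‖ with hD
      have n1 : 0 < ‖g u - x‖ := lt_of_lt_of_le (by positivity) L1
      have n2 : 0 < ‖g u + x‖ := lt_of_lt_of_le (by positivity) L2
      have z1 := norm_pos_iff.1 n1
      have z2 := norm_pos_iff.1 n2
      have z3 := him1 u
      have z4 := him2 u
      have hD2 : ‖x‖ ^ 2 + (u - s) ^ 2 ≤ D ^ 2 := by
        rw [hD, ← sq_abs (u - s)]; nlinarith [abs_nonneg (u - s)]
      have hid : k u / (g u - x) - k u / (g u + x) -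
          e * ((((u - s : ℝ) : ℂ) - x)⁻¹ - (((u - s : ℝ) : ℂ) + x)⁻¹) =
          (k u - e) * (2 * x / ((g u - x) * (g u + x))) + e * (2 * x * (((u - s : ℝ) : ℂ) ^ 2 - g u ^ 2) /
            ((g u - x) * (g u + x) * ((((u - s : ℝ) : ℂ) - x) * (((u - s : ℝ) : ℂ) + x)))) := by
        generalize ((u - s : ℝ) : ℂ) = v at *
        field_simp
        ring
      rw [hid]
      have b1 : ‖2 * x / ((g u - x) * (g u + x))‖ ≤ 2 / c ^ 2 * (‖x‖ / (‖x‖ ^ 2 + (u - s) ^ 2)) := by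
        rw [norm_div, norm_mul, norm_mul, Complex.norm_two]
        calc 2 * ‖x‖ / (‖g u - x‖ * ‖g u + x‖) ≤ 2 * ‖x‖ / ((c * D) * (c * D)) := by gcongr
          _ = 2 / c ^ 2 * (‖x‖ / D ^ 2) := by field_simp
          _ ≤ _ := by gcongr
      have b2 : ‖2 * x * (((u - s : ℝ) : ℂ) ^ 2 - g u ^ 2) /
            ((g u - x) * (g u + x) * ((((u - s : ℝ) : ℂ) - x) * (((u - s : ℝ) : ℂ) + x)))‖ ≤
          2 / (c ^ 2 * c' ^ 2) * (‖x‖ / (‖x‖ ^ 2 + (u - s) ^ 2)) * η u := by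
        rw [norm_div, norm_mul, norm_mul, norm_mul, norm_mul, norm_mul, Complex.norm_two]
        calc _ ≤ 2 * ‖x‖ * (η u * (u - s) ^ 2) / ((c * D) * (c * D) * ((c' * D) * (c' * D))) := by
              gcongr
              · have := hηn u; positivity
              · exact hη u
          _ = 2 / (c ^ 2 * c' ^ 2) * (‖x‖ / D ^ 2) * η u * ((u - s) ^ 2 / D ^ 2) := by field_simp
          _ ≤ 2 / (c ^ 2 * c' ^ 2) * (‖x‖ / (‖x‖ ^ 2 + (u - s) ^ 2)) * η u * 1 := by
              gcongr
              · have := hηn u; positivity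
              · exact hηn u
              · rw [div_le_one (by positivity)]; nlinarith [sq_nonneg ‖x‖]
          _ = _ := mul_one _
      set P := ‖x‖ / (‖x‖ ^ 2 + (u - s) ^ 2) with hP
      have hPn : 0 ≤ P := by positivity
      calc _ ≤ ‖k u - e‖ * (2 / c ^ 2 * P) + ‖e‖ * (2 / (c ^ 2 * c' ^ 2) * P * η u) := by
            refine (norm_add_le _ _).trans ?_
            rw [norm_mul, norm_mul]
            gcongr
        _ ≤ C * (P * (‖k u - e‖ + ‖e‖ * η u)) := by
            have e1 : 0 ≤ ‖k u - e‖ * (2 / (c ^ 2 * c' ^ 2) * P) := by positivity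
            have e2 : 0 ≤ ‖e‖ * (2 / c ^ 2 * P * η u) := by have := hηn u; positivity
            have e3 : C * (P * (‖k u - e‖ + ‖e‖ * η u)) = ‖k u - e‖ * (2 / c ^ 2 * P) + ‖e‖ * (2 / (c ^ 2 * c' ^ 2) * P * η u) +
                (‖k u - e‖ * (2 / (c ^ 2 * c' ^ 2) * P) + ‖e‖ * (2 / c ^ 2 * P * η u)) := by rw [hC]; ring
            rw [e3]; exact le_add_of_nonneg_right (add_nonneg e1 e2)
  have hnorm : Tendsto (fun x : ℂ => ‖x‖) (𝓝[{x : ℂ | β * |x.re| < x.im}] 0) (𝓝[>] 0) := by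
    refine tendsto_nhdsWithin_of_tendsto_nhds_of_eventually_within _ ?_ ?_
    · exact tendsto_nhdsWithin_of_tendsto_nhds (Continuous.tendsto' (by fun_prop) _ _ (by simp))
    · filter_upwards [self_mem_nhdsWithin] with x hx
      refine norm_pos_iff.2 ?_
      rintro rfl
      simp at hx
  have t1 := (hpois.comp hnorm).const_mul C
  rw [mul_zero] at t1
  have t2 : Tendsto (fun x : ℂ => ((∫ u, k u / (g u - x)) - ∫ u, k u / (g u + x)) -
        e * ∫ v in (-s)..(L - s), (((v:ℂ) - x)⁻¹ - ((v:ℂ) + x)⁻¹)) (𝓝[{x : ℂ | β * |x.re| < x.im}] 0) (𝓝 0) := by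
    refine squeeze_zero_norm' ?_ t1
    have : ∀ᶠ x in 𝓝[{x : ℂ | β * |x.re| < x.im}] (0:ℂ), x ∈ Metric.ball (0:ℂ) (min r r') :=
      nhdsWithin_le_nhds (Metric.ball_mem_nhds _ (lt_min hr hr'))
    filter_upwards [self_mem_nhdsWithin, this] with x hx hxr
    exact hmain x hx (by simpa using hxr)
  have t3 := (p3_line (a := -s) (b := L - s) (by linarith [hs.1]) (by linarith [hs.2])).mono_left
    (nhdsWithin_mono 0 (s := {x : ℂ | β * |x.re| < x.im}) (fun x hx => lt_of_le_of_lt (mul_nonneg hβ.le (abs_nonneg x.re)) hx))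
  have := t2.add (t3.const_mul e)
  rw [zero_add, mul_comm] at this
  exact this.congr fun x => by ring

lemma p6_x {ρ u : ℝ} (h0 : 0 ≤ ρ) (h : ρ < Real.exp (-|u| / 2)) :
    1 / 2 * |((ρ:ℂ) * Complex.exp (u * Complex.I)).im| < (1 - (ρ:ℂ) * Complex.exp (u * Complex.I)).re := by
  have h1 : ((ρ:ℂ) * Complex.exp (u * Complex.I)).im = ρ * Real.sin u := by
    simp [Complex.exp_ofReal_mul_I_im]
  have h2 : ((ρ:ℂ) * Complex.exp (u * Complex.I)).re = ρ * Real.cos u := by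
    simp [Complex.exp_ofReal_mul_I_re]
  rw [Complex.sub_re, h1, h2, Complex.one_re, abs_mul, abs_of_nonneg h0]
  have h3 : |Real.sin u| ≤ |u| := Real.abs_sin_le_abs
  have h4 := Real.cos_le_one u
  have h5 : 1 + |u| / 2 ≤ Real.exp (|u| / 2) := by have := Real.add_one_le_exp (|u| / 2); linarith
  have h6 : ρ * Real.exp (|u| / 2) < 1 := by
    calc _ < Real.exp (-|u| / 2) * Real.exp (|u| / 2) := by gcongr
      _ = 1 := by rw [← Real.exp_add]; simp [neg_div]
  nlinarith

lemma p6_star {W E : Set ℂ} (hW : IsOpen W) {f : ℂ → ℂ} (hf : DifferentiableOn ℂ f W) {M : ℝ}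
    (hEM : ∀ p ∈ E, ‖p‖ ≤ M) (hE0 : ∀ p ∈ E, p ≠ 0) (hEW : ∀ p ∈ E, p ∉ W)
    (hx : ∀ p ∈ E, ∀ x : ℂ, 1 / 2 * |x.im| < (1 - x).re → ‖x‖ ≤ 1 → p * x ∈ W ∧ ‖f (p * x)‖ ≤ 1)
    (hlim : ∀ p ∈ E, Tendsto (fun l : ℝ => f (p * l)) (𝓝[<] 1) (𝓝 0))
    (hvol : volume (Complex.re '' E) ≠ 0) : (0:ℂ) ∈ W ∧ ∀ᶠ z in 𝓝 0, f z = 0 := by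
  have hne : E.Nonempty := by
    by_contra h
    rw [Set.not_nonempty_iff_eq_empty] at h
    simp [h] at hvol
  obtain ⟨p0, hp0⟩ := hne
  have hW0 : (0:ℂ) ∈ W := by simpa using (hx p0 hp0 0 (by simp) (by simp)).1
  refine ⟨hW0, ?_⟩
  set b : E → ℝ → ℝ := fun p θ => Real.log ‖(p:ℂ)‖ - 1 / 2 * ‖((θ - Complex.arg p : ℝ) : AddCircle (2 * π))‖ with hb
  have hbM : ∀ p θ, b p θ ≤ Real.log M := fun p θ => by
    have h1 := Real.log_le_log (norm_pos_iff.2 (hE0 p p.2)) (hEM p p.2)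
    have h2 : 0 ≤ ‖((θ - Complex.arg p : ℝ) : AddCircle (2 * π))‖ := norm_nonneg _
    simp only [hb]; linarith
  have hbb : ∀ θ, BddAbove (Set.range fun p => b p θ) := fun θ => ⟨Real.log M, by rintro _ ⟨p, rfl⟩; exact hbM p θ⟩
  have hbl : ∀ p θ θ', b p θ ≤ b p θ' + 1 / 2 * |θ - θ'| := by
    intro p θ θ'
    have h1 : ((θ' - Complex.arg p : ℝ) : AddCircle (2 * π)) = ((θ - Complex.arg p : ℝ) : AddCircle (2 * π)) -
      ((θ - θ' : ℝ) : AddCircle (2 * π)) := by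
      rw [← AddCircle.coe_sub]; congr 1; ring
    have h2 := norm_sub_le ((θ - Complex.arg p : ℝ) : AddCircle (2 * π)) ((θ - θ' : ℝ) : AddCircle (2 * π))
    rw [← h1] at h2
    have h3 : ‖((θ - θ' : ℝ) : AddCircle (2 * π))‖ ≤ |θ - θ'| := QuotientAddGroup.norm_mk_le_norm
    simp only [hb]; linarith
  haveI : Nonempty E := ⟨⟨p0, hp0⟩⟩
  set ψ : ℝ → ℝ := fun θ => ⨆ p, b p θ with hψ
  have hψl : LipschitzWith (1 / 2) ψ := by
    refine LipschitzWith.of_le_add_mul (1/2) fun θ θ' => ?_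
    refine ciSup_le fun p => ?_
    refine (hbl p θ θ').trans ?_
    have := le_ciSup (hbb θ') p
    rw [Real.dist_eq]
    simp only [hψ]
    push_cast
    linarith
  have hψp : Function.Periodic ψ (2 * π) := by
    intro θ
    simp only [hψ, hb]
    congr 1
    ext p
    congr 3
    rw [show θ + 2 * π - Complex.arg p = (θ - Complex.arg p) + 2 * π by ring, AddCircle.coe_add, AddCircle.coe_period, add_zero]
  have hrep : ∀ θ l : ℝ, 0 ≤ l → l < 1 → ∃ p ∈ E, ∃ x : ℂ, 1 / 2 * |x.im| < (1 - x).re ∧ ‖x‖ ≤ 1 ∧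
      (l:ℂ) * p4w ψ θ = p * x := by
    intro θ l hl0 hl1
    rcases hl0.eq_or_lt with rfl | hl
    · exact ⟨p0, hp0, 0, by simp, by simp, by simp⟩
    have h1 : Real.log l + ψ θ < ψ θ := by linarith [Real.log_neg hl hl1]
    obtain ⟨p, hp⟩ := exists_lt_of_lt_ciSup h1
    have hpn : 0 < ‖(p:ℂ)‖ := norm_pos_iff.2 (hE0 p p.2)
    set a := θ - Complex.arg p with ha
    set u := a - round ((2 * π)⁻¹ * a) * (2 * π) with hu
    have hnu : ‖(a : AddCircle (2 * π))‖ = |u| := AddCircle.norm_eq _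
    simp only [hb] at hp
    rw [← ha, hnu] at hp
    set ρ := l * Real.exp (ψ θ) / ‖(p:ℂ)‖ with hρ
    have hρ0 : 0 ≤ ρ := by positivity
    have hρ1 : ρ < Real.exp (-|u| / 2) := by
      rw [hρ, div_lt_iff₀ hpn]
      have := Real.exp_lt_exp.2 hp
      rw [Real.exp_add, Real.exp_log hl, Real.exp_sub, Real.exp_log hpn] at this
      refine this.trans_le (le_of_eq ?_)
      rw [div_eq_mul_inv, ← Real.exp_neg, mul_comm]
      congr 2; ring
    refine ⟨p, p.2, (ρ:ℂ) * Complex.exp (u * Complex.I), p6_x hρ0 hρ1, ?_, ?_⟩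
    · rw [norm_mul, Complex.norm_exp_ofReal_mul_I, mul_one, Complex.norm_real, Real.norm_of_nonneg hρ0]
      refine hρ1.le.trans (Real.exp_le_one_iff.2 ?_)
      have := abs_nonneg u; linarith
    · have e1 : Complex.exp (u * Complex.I) = Complex.exp (θ * Complex.I) * Complex.exp (-(Complex.arg p) * Complex.I) := by
        rw [← Complex.exp_add, Complex.exp_eq_exp_iff_exists_int]
        refine ⟨-round ((2 * π)⁻¹ * a), ?_⟩
        rw [hu, ha]; push_cast; ring
      have e2 := Complex.norm_mul_exp_arg_mul_I (p:ℂ)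
      have e3 : Complex.exp (Complex.arg p * Complex.I) * Complex.exp (-(Complex.arg p) * Complex.I) = 1 := by
        rw [← Complex.exp_add]; simp
      rw [e1, p4w, Complex.exp_add, hρ]
      push_cast
      have hpn' : (‖(p:ℂ)‖ : ℂ) * (‖(p:ℂ)‖ : ℂ)⁻¹ = 1 := mul_inv_cancel₀ (by exact_mod_cast hpn.ne')
      rw [div_eq_mul_inv]
      generalize Complex.exp (Complex.arg p * Complex.I) = A at *
      generalize Complex.exp (-(Complex.arg p) * Complex.I) = B at *
      generalize (‖(p:ℂ)‖ : ℂ)⁻¹ = Q at *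
      linear_combination ((l:ℂ) * Complex.exp (ψ θ) * Complex.exp (θ * Complex.I)) * (Q * B * e2 - e3 - A * B * hpn')
  have hin : ∀ θ l : ℝ, 0 ≤ l → l < 1 → (l:ℂ) * p4w ψ θ ∈ W := fun θ l h0 h1 => by
    obtain ⟨p, hp, x, h2, h3, h4⟩ := hrep θ l h0 h1
    rw [h4]; exact (hx p hp x h2 h3).1
  have hM1 : ∀ θ l : ℝ, 0 ≤ l → l < 1 → ‖f ((l:ℂ) * p4w ψ θ)‖ ≤ 1 := fun θ l h0 h1 => by
    obtain ⟨p, hp, x, h2, h3, h4⟩ := hrep θ l h0 h1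
    rw [h4]; exact (hx p hp x h2 h3).2
  have hw : ∀ p ∈ E, p4w ψ (Complex.arg p) = p := by
    intro p hp
    have hpn : 0 < ‖p‖ := norm_pos_iff.2 (hE0 p hp)
    have h1 : Real.log ‖p‖ ≤ ψ (Complex.arg p) := by
      have := le_ciSup (hbb (Complex.arg p)) ⟨p, hp⟩
      refine le_trans (le_of_eq ?_) this
      simp [hb]
    have h2 : p = (Real.exp (Real.log ‖p‖ - ψ (Complex.arg p)) : ℝ) * p4w ψ (Complex.arg p) := by
      conv_lhs => rw [← Complex.norm_mul_exp_arg_mul_I p]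
      rw [p4w, Complex.exp_add, Real.exp_sub, Real.exp_log hpn]
      push_cast
      field_simp [Complex.exp_ne_zero]
    rcases h1.eq_or_lt with h | h
    · rw [← h, sub_self, Real.exp_zero, Complex.ofReal_one, one_mul] at h2
      exact h2.symm
    · exfalso
      apply hEW p hp
      rw [h2]
      exact hin _ _ (Real.exp_pos _).le (by rw [Real.exp_lt_one_iff]; linarith)
  refine p4_zero hψl hψp hW hf hin hM1 (K := Complex.arg '' E) ?_ ?_ ?_
  · rintro _ ⟨p, -, rfl⟩; exact Complex.arg_mem_Ioc p
  · intro hK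
    apply hvol
    have hloc : LocallyLipschitz (p4w ψ) := p4_locLip hψl.locallyLipschitz
    obtain ⟨C, hC⟩ := hloc.locallyLipschitzOn.exists_lipschitzOnWith_of_compact (isCompact_Icc (a := -π) (b := π))
    have hC' : LipschitzOnWith (1 * C) (fun θ => (p4w ψ θ).re) (Complex.arg '' E) := by
      refine LipschitzWith.comp_lipschitzOnWith (f := Complex.re) ?_ (hC.mono ?_)
      · exact LipschitzWith.of_dist_le_mul fun x y => by
          rw [Real.dist_eq, ← Complex.sub_re, dist_eq_norm]; simpa using Complex.abs_re_le_norm (x - y)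
      · rintro _ ⟨p, -, rfl⟩; exact Set.Ioc_subset_Icc_self (Complex.arg_mem_Ioc p)
    have := p1_null hC' hK
    rw [hausdorffMeasure_real] at this
    refine measure_mono_null ?_ this
    rintro _ ⟨p, hp, rfl⟩
    exact ⟨_, ⟨p, hp, rfl⟩, by simp only [hw p hp]⟩
  · rintro _ ⟨p, hp, rfl⟩
    rw [hw p hp]
    simpa only [mul_comm] using hlim p hp

noncomputable def p6N (γ κ : ℝ → ℂ) (z : ℂ) : ℂ := (2 * π * Complex.I)⁻¹ * ∫ u, κ u / (γ u - z)

lemma p6_inj {S : Set ℂ} {γ κ : ℝ → ℂ} {L : ℝ} (h : P1D S γ κ L) {s : ℝ} (hs : s ∈ Set.Ioo 0 L) :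
    ∀ u ∈ Set.Icc 0 L, u ≠ s → γ u ≠ γ s := by
  intro u hu hus he
  rcases hu.2.eq_or_lt with h1 | h1
  · rw [h1, ← h.ends] at he
    exact hs.1.ne (h.inj ⟨le_rfl, h.pos⟩ ⟨hs.1.le, hs.2⟩ he)
  · exact hus (h.inj ⟨hu.1, h1⟩ ⟨hs.1.le, hs.2⟩ he)

lemma p6_fr {t s : Set ℂ} (ht : IsPreconnected t) (h1 : (t ∩ s).Nonempty) (h2 : (t ∩ sᶜ).Nonempty) :
    (t ∩ frontier s).Nonempty := by
  by_contra hn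
  have hd : ∀ x ∈ t, x ∉ frontier s := fun x hx hf => hn ⟨x, hx, hf⟩
  obtain ⟨a, ha, ha'⟩ := h1
  obtain ⟨b, hb, hb'⟩ := h2
  have e1 : ∀ x ∈ t, x ∈ s → x ∈ interior s := fun x hx hxs => by
    by_contra h; exact hd x hx ⟨subset_closure hxs, h⟩
  have e2 : ∀ x ∈ t, x ∉ s → x ∈ (closure s)ᶜ := fun x hx hxs h =>
    hd x hx ⟨h, fun h' => hxs (interior_subset h')⟩
  obtain ⟨x, -, hx1, hx2⟩ := ht _ _ isOpen_interior isClosed_closure.isOpen_compl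
    (fun x hx => (em (x ∈ s)).imp (e1 x hx) (e2 x hx)) ⟨a, ha, e1 a ha ha'⟩ ⟨b, hb, e2 b hb hb'⟩
  exact hx2 (interior_subset_closure hx1)

lemma p6_int {S : Set ℂ} {γ κ : ℝ → ℂ} {L : ℝ} (h : P1D S γ κ L) : Integrable κ := by
  have : κ = Set.indicator (Set.Ioo 0 L) κ := by
    ext s; by_cases hs : s ∈ Set.Ioo 0 L
    · rw [Set.indicator_of_mem hs]
    · rw [Set.indicator_of_notMem hs, h.supp s hs]
  rw [this, integrable_indicator_iff measurableSet_Ioo]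
  exact IntegrableOn.of_bound (by simp) h.meas.aestronglyMeasurable 1 (ae_of_all _ h.bd)

lemma p6_local {Ω : Set ℂ} {γ κ : ℝ → ℂ} {L : ℝ} (h : P1D (frontier Ω) γ κ L)
    (hN : ∀ z ∈ Ω, p6N γ κ z = 1) {s : ℝ} (hs : s ∈ Set.Ioo 0 L) {ω : ℂ} (hω : HasDerivAt γ ω s) (hre : ω.re ≠ 0)
    (hL : Tendsto (fun r => r⁻¹ * ∫ u in Metric.closedBall s r, ‖κ u - κ s‖) (𝓝[>] 0) (𝓝 0))
    (hup : ∀ t : ℝ, 0 ≤ t → γ s + t * Complex.I ∉ Ω)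
    (hdown : ∀ ε > 0, ∃ t : ℝ, 0 < t ∧ t < ε ∧ γ s - t * Complex.I ∈ Ω) :
    ∃ ν : ℂ, ν ≠ 0 ∧ ∃ c ∈ ({0, 1, 2} : Set ℂ), ∃ r > 0,
      (∀ ζ : ℂ, ‖ζ‖ < r → |(ζ / ν).im| < 4 * (ζ / ν).re → γ s + ζ ∉ closure Ω) ∧
      Tendsto (fun ζ => p6N γ κ (γ s + ζ)) (𝓝[{ζ : ℂ | |(ζ / ν).im| < 4 * (ζ / ν).re}] 0) (𝓝 c) := by
  have hω0 : ω ≠ 0 := by rintro rfl; simp at hre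
  set p := γ s with hp
  set β : ℝ := min (1 / 4) (|ω.re| / (2 * (|ω.im| + 1))) with hβ
  have hre' : 0 < |ω.re| := abs_pos.2 hre
  have hβ0 : 0 < β := by positivity
  have hβ1 : β ≤ 1 / 4 := min_le_left _ _
  have hβ2 : β * |ω.im| < |ω.re| := by
    have h1 : β ≤ |ω.re| / (2 * (|ω.im| + 1)) := min_le_right _ _
    rw [le_div_iff₀ (by positivity)] at h1
    nlinarith [abs_nonneg ω.im]
  set g : ℝ → ℂ := fun u => (γ u - p) / ω with hg
  have hgc : Continuous g := (h.lip.continuous.sub continuous_const).div_const _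
  have hgd : HasDerivAt g 1 s := by
    have := (hω.sub_const p).div_const ω
    rwa [div_self hω0] at this
  have hg0 : g s = 0 := by simp [hg, hp]
  have hgne : ∀ u ∈ Set.Icc 0 L, u ≠ s → g u ≠ 0 := fun u hu hus =>
    div_ne_zero (sub_ne_zero.2 (p6_inj h hs u hu hus)) hω0
  obtain ⟨r, hr, c, hc, hlow⟩ := p3_lower hgc hs hgd hg0 hgne hβ0
  have hF : ∀ x : ℂ, x ≠ 0 → ‖x‖ < r → β * |x.re| ≤ |x.im| → p + ω * x ∉ frontier Ω := by
    intro x hx0 hxr hx hf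
    rw [← h.img] at hf
    obtain ⟨u, hu, hu2⟩ := hf
    have h1 := hlow x hxr hx u hu
    have h2 : g u - x = 0 := by simp only [hg, hu2]; field_simp; ring
    rw [h2, norm_zero] at h1
    have : 0 < ‖x‖ := norm_pos_iff.2 hx0
    have : 0 < c * (|u - s| + ‖x‖) := by positivity
    linarith
  have hJ := p3_jump hgc hs hgd hg0 hgne ((p6_int h).div_const ω) (fun u hu => by simp [h.supp u hu]) (by
    have := hL.const_mul (‖ω‖⁻¹)
    rw [mul_zero] at this
    refine this.congr fun r => ?_
    rw [mul_left_comm, ← integral_const_mul]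
    congr 2
    ext u
    rw [← sub_div, norm_div, div_eq_inv_mul]) hβ0
  have hJ' : Tendsto (fun x : ℂ => p6N γ κ (p + ω * x) - p6N γ κ (p - ω * x)) (𝓝[{x : ℂ | β * |x.re| < x.im}] 0)
      (𝓝 (κ s / ω)) := by
    have h1 := hJ.const_mul (2 * π * Complex.I)⁻¹
    have h2 : (2 * π * Complex.I : ℂ) ≠ 0 := by simp [Real.pi_ne_zero]
    rw [inv_mul_cancel_left₀ h2] at h1
    refine h1.congr fun x => ?_
    rw [mul_sub, p6N, p6N]
    congr 3
    · ext u
      rw [div_div]; congr 1; simp only [hg]; field_simp; ring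
    · ext u
      rw [div_div]; congr 1; simp only [hg]; field_simp; ring
  have he : κ s / ω = 0 ∨ κ s / ω = 1 := by
    rcases h.der s with h1 | h1
    · left; simp [h1]
    · right; rw [h1.unique hω, div_self hω0]
  obtain ⟨w, hw0, hwre, hwβ, hwF, e, hee, hwJ⟩ : ∃ w : ℂ, w ≠ 0 ∧ 0 < w.re ∧ β * |w.im| < w.re ∧
      (∀ x : ℂ, x ≠ 0 → ‖x‖ < r → β * |x.re| ≤ |x.im| → p + w * x ∉ frontier Ω) ∧
      ∃ e : ℂ, 1 + e ∈ ({0, 1, 2} : Set ℂ) ∧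
      Tendsto (fun x : ℂ => p6N γ κ (p + w * x) - p6N γ κ (p - w * x)) (𝓝[{x : ℂ | β * |x.re| < x.im}] 0) (𝓝 e) := by
    rcases hre.lt_or_gt with h1 | h1
    · refine ⟨-ω, neg_ne_zero.2 hω0, by simpa using h1, ?_, ?_, -(κ s / ω), ?_, ?_⟩
      · rw [abs_of_neg h1] at hβ2; simpa using hβ2
      · intro x hx0 hxr hx
        have := hF (-x) (neg_ne_zero.2 hx0) (by simpa using hxr) (by simpa using hx)
        rwa [mul_neg, ← neg_mul] at this
      · rcases he with h2 | h2 <;> simp [h2]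
      · refine hJ'.neg.congr fun x => ?_
        rw [neg_sub, neg_mul, sub_neg_eq_add, ← sub_eq_add_neg]
    · refine ⟨ω, hω0, h1, ?_, hF, κ s / ω, ?_, hJ'⟩
      · rwa [abs_of_pos h1] at hβ2
      · rcases he with h2 | h2 <;> simp [h2]; norm_num
  set C : Set ℂ := Metric.ball 0 r ∩ {x : ℂ | β * |x.re| < x.im} with hC
  have hCpre : IsPreconnected C := by
    refine Convex.isPreconnected ((convex_ball (0:ℂ) r).inter ?_)
    intro x hx y hy a b ha hb hab
    simp only [Set.mem_setOf_eq, Complex.add_re, Complex.add_im, Complex.real_smul, Complex.re_ofReal_mul, Complex.im_ofReal_mul] at *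
    have h1 : |a * x.re + b * y.re| ≤ a * |x.re| + b * |y.re| := by
      refine (abs_add_le _ _).trans ?_
      rw [abs_mul, abs_mul, abs_of_nonneg ha, abs_of_nonneg hb]
    rcases ha.eq_or_lt with rfl | ha'
    · have : b = 1 := by linarith
      subst this; simpa using hy
    · nlinarith
  have hCi : ∀ x ∈ C, 0 < x.im := fun x hx => lt_of_le_of_lt (by positivity) hx.2
  have hC0 : ∀ x ∈ C, x ≠ 0 := fun x hx h0 => by have := hCi x hx; simp [h0] at this
  have hvert : ∀ t : ℝ, 0 < t → t < r * ‖w‖ → (t * Complex.I / w) ∈ C := by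
    intro t ht0 ht
    have hwn : 0 < ‖w‖ := norm_pos_iff.2 hw0
    have hns : 0 < Complex.normSq w := Complex.normSq_pos.2 hw0
    refine ⟨?_, ?_⟩
    · rw [mem_ball_zero_iff, norm_div, norm_mul, Complex.norm_I, mul_one, Complex.norm_real, Real.norm_of_nonneg ht0.le, div_lt_iff₀ hwn]
      exact ht
    · have e1 : (t * Complex.I / w).re = t * w.im / Complex.normSq w := by
        rw [Complex.div_re]; simp
      have e2 : (t * Complex.I / w).im = t * w.re / Complex.normSq w := by
        rw [Complex.div_im]; simp
      rw [Set.mem_setOf_eq, e1, e2, abs_div, abs_mul, abs_of_pos ht0, abs_of_pos hns, mul_div_assoc']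
      exact div_lt_div_of_pos_right (by linarith [mul_lt_mul_of_pos_left hwβ ht0]) hns
  have hrw : 0 < r * ‖w‖ := mul_pos hr (norm_pos_iff.2 hw0)
  have hupW : ∀ x ∈ C, p + w * x ∉ Ω := by
    intro x hx hxΩ
    have h1 : IsPreconnected ((fun x => p + w * x) '' C) := hCpre.image _ (by fun_prop)
    obtain ⟨z, ⟨y, hy, rfl⟩, hz2⟩ := p6_fr h1 (s := Ω) ⟨_, ⟨x, hx, rfl⟩, hxΩ⟩
      ⟨_, ⟨_, hvert (r * ‖w‖ / 2) (by positivity) (by linarith), rfl⟩, by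
        have := hup (r * ‖w‖ / 2) (by positivity)
        convert this using 2
        field_simp⟩
    refine hwF y (hC0 y hy) (by simpa using hy.1) ?_ hz2
    rw [abs_of_pos (hCi y hy)]; exact hy.2.le
  have hlowW : ∀ x ∈ C, p - w * x ∈ Ω := by
    intro x hx
    by_contra hxΩ
    have h1 : IsPreconnected ((fun x => p - w * x) '' C) := hCpre.image _ (by fun_prop)
    obtain ⟨t, ht0, ht1, ht⟩ := hdown _ hrw
    obtain ⟨z, ⟨y, hy, rfl⟩, hz2⟩ := p6_fr h1 (s := Ω)
      ⟨_, ⟨_, hvert t ht0 ht1, rfl⟩, by convert ht using 2; field_simp⟩ ⟨_, ⟨x, hx, rfl⟩, hxΩ⟩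
    refine hwF (-y) (neg_ne_zero.2 (hC0 y hy)) (by simpa using hy.1) ?_ (by simpa [sub_eq_add_neg] using hz2)
    rw [Complex.neg_im, abs_neg, Complex.neg_re, abs_neg, abs_of_pos (hCi y hy)]; exact hy.2.le
  have hcone : ∀ ζ : ℂ, |(ζ / (Complex.I * w)).im| < 4 * (ζ / (Complex.I * w)).re → β * |(ζ / w).re| < (ζ / w).im := by
    intro ζ hζ
    have e1 : ζ / (Complex.I * w) = -Complex.I * (ζ / w) := by
      field_simp; simp
    rw [e1] at hζ
    simp at hζ
    nlinarith [abs_nonneg (ζ / w).re]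
  refine ⟨Complex.I * w, mul_ne_zero Complex.I_ne_zero hw0, 1 + e, hee, r * ‖w‖, hrw, ?_, ?_⟩
  · intro ζ hζ hζ2
    have hxC : ζ / w ∈ C := ⟨by rw [mem_ball_zero_iff, norm_div, div_lt_iff₀ (norm_pos_iff.2 hw0)]; exact hζ, hcone ζ hζ2⟩
    have e1 : p + ζ = p + w * (ζ / w) := by field_simp
    rw [e1, closure_eq_self_union_frontier]
    rintro (h1 | h1)
    · exact hupW _ hxC h1
    · refine hwF _ (hC0 _ hxC) (by simpa using hxC.1) ?_ h1
      rw [abs_of_pos (hCi _ hxC)]; exact hxC.2.le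
  · have t1 : Tendsto (fun ζ : ℂ => ζ / w) (𝓝[{ζ : ℂ | |(ζ / (Complex.I * w)).im| < 4 * (ζ / (Complex.I * w)).re}] 0)
        (𝓝[{x : ℂ | β * |x.re| < x.im}] 0) := by
      refine tendsto_nhdsWithin_of_tendsto_nhds_of_eventually_within _ ?_ ?_
      · exact tendsto_nhdsWithin_of_tendsto_nhds (Continuous.tendsto' (by fun_prop) _ _ (by simp))
      · filter_upwards [self_mem_nhdsWithin] with ζ hζ using hcone ζ hζ
    have t2 : Tendsto (fun x : ℂ => p6N γ κ (p + w * x)) (𝓝[{x : ℂ | β * |x.re| < x.im}] 0) (𝓝 (1 + e)) := by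
      refine (hwJ.const_add 1).congr' ?_
      have : ∀ᶠ x in 𝓝[{x : ℂ | β * |x.re| < x.im}] (0:ℂ), x ∈ Metric.ball (0:ℂ) r :=
        nhdsWithin_le_nhds (Metric.ball_mem_nhds _ hr)
      filter_upwards [self_mem_nhdsWithin, this] with x hx hxr
      rw [hN _ (hlowW x ⟨hxr, hx⟩)]; ring
    refine (t2.comp t1).congr fun ζ => ?_
    simp only [Function.comp]
    congr 2
    field_simp

lemma p6_top {Ω : Set ℂ} (ho : IsOpen Ω) (hb : Bornology.IsBounded Ω) {x : ℝ} (hx : x ∈ Complex.re '' Ω) :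
    ∃ p ∈ frontier Ω, p.re = x ∧ (∀ t : ℝ, 0 ≤ t → p + t * Complex.I ∉ Ω) ∧
      ∀ ε > 0, ∃ t : ℝ, 0 < t ∧ t < ε ∧ p - t * Complex.I ∈ Ω := by
  obtain ⟨z, hz, rfl⟩ := hx
  set S : Set ℝ := {y | (z.re + y * Complex.I : ℂ) ∈ Ω} with hS
  have hSo : IsOpen S := ho.preimage (by fun_prop)
  have hSn : S.Nonempty := ⟨z.im, by simpa [hS, Complex.re_add_im] using hz⟩
  obtain ⟨M, hM⟩ := hb.exists_norm_le
  have hSb : BddAbove S := ⟨M, fun y hy => by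
    have := (Complex.abs_im_le_norm _).trans (hM _ hy)
    simp at this
    exact (le_abs_self y).trans this⟩
  have hm : sSup S ∉ S := by
    intro hm
    obtain ⟨ε, hε, hb⟩ := Metric.isOpen_iff.1 hSo _ hm
    have : sSup S + ε / 2 ∈ S := hb (by simp [abs_of_pos, hε])
    linarith [le_csSup hSb this]
  have hdown : ∀ ε > 0, ∃ t : ℝ, 0 < t ∧ t < ε ∧ (z.re + sSup S * Complex.I : ℂ) - t * Complex.I ∈ Ω := by
    intro ε hε
    obtain ⟨y, hy, hy2⟩ := exists_lt_of_lt_csSup hSn (show sSup S - ε < sSup S by linarith)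
    have h1 : y < sSup S := lt_of_le_of_ne (le_csSup hSb hy) (fun h => hm (h ▸ hy))
    refine ⟨sSup S - y, by linarith, by linarith, ?_⟩
    have hy' : (z.re + y * Complex.I : ℂ) ∈ Ω := hy
    convert hy' using 1
    push_cast; ring
  refine ⟨z.re + sSup S * Complex.I, ?_, by simp, ?_, hdown⟩
  · rw [ho.frontier_eq]
    refine ⟨Metric.mem_closure_iff.2 fun ε hε => ?_, hm⟩
    obtain ⟨t, h0, h1, h2⟩ := hdown ε hε
    exact ⟨_, h2, by simpa [dist_eq_norm, abs_of_pos h0] using h1⟩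
  · intro t ht hmem
    have h1 : sSup S + t ∈ S := by
      rw [hS, Set.mem_setOf_eq]; convert hmem using 1; push_cast; ring
    have h2 := le_csSup hSb h1
    have : t = 0 := by linarith
    subst this
    exact hm (by simpa using h1)

lemma p6_bad {S : Set ℂ} {γ κ : ℝ → ℂ} {L : ℝ} (h : P1D S γ κ L) :
    volume ((fun s => (γ s).re) '' {s | s ∈ Set.Icc 0 L ∧ ¬ (s ∈ Set.Ioo 0 L ∧ (∃ ω, HasDerivAt γ ω s ∧ ω.re ≠ 0) ∧
      Tendsto (fun r => r⁻¹ * ∫ u in Metric.closedBall s r, ‖κ u - κ s‖) (𝓝[>] 0) (𝓝 0))}) = 0 := by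
  have hlip : LipschitzWith 1 (fun s => (γ s).re) := by
    refine LipschitzWith.of_dist_le_mul fun x y => ?_
    refine le_trans ?_ (h.lip.dist_le_mul x y)
    rw [Real.dist_eq, dist_eq_norm, ← Complex.sub_re]
    exact Complex.abs_re_le_norm _
  have h1 : ∀ᵐ s, DifferentiableAt ℝ γ s := h.lip.ae_differentiableAt
  have h2 := p2_lebesgue κ (p6_int h).locallyIntegrable
  have h3 : ∀ᵐ s : ℝ, s ≠ 0 ∧ s ≠ L := by
    simp only [ae_iff, not_and_or, not_not]
    exact ((Set.finite_singleton L).insert 0).measure_zero volume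
  have hnull := h1.and (h2.and h3)
  rw [ae_iff] at hnull
  have n1 := p1_null (hlip.lipschitzOnWith (s := _)) hnull
  rw [hausdorffMeasure_real] at n1
  have n2 : volume ((fun s => (γ s).re) '' {s | HasDerivAt (fun s => (γ s).re) 0 s}) = 0 := by
    refine addHaar_image_eq_zero_of_det_fderivWithin_eq_zero volume (f' := fun _ => 0) ?_ (by simp)
    intro s hs
    have := (hs : HasDerivAt (fun s => (γ s).re) 0 s).hasFDerivAt.hasFDerivWithinAt (s := {s | HasDerivAt (fun s => (γ s).re) 0 s})
    rwa [show ContinuousLinearMap.toSpanSingleton ℝ (0:ℝ) = 0 by ext; simp] at this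
  refine measure_mono_null ?_ (measure_union_null n1 n2)
  rintro _ ⟨s, ⟨hs, hbad⟩, rfl⟩
  by_cases hg : DifferentiableAt ℝ γ s ∧ Tendsto (fun r => r⁻¹ * ∫ u in Metric.closedBall s r, ‖κ u - κ s‖) (𝓝[>] 0) (𝓝 0) ∧ s ≠ 0 ∧ s ≠ L
  · right
    refine ⟨s, ?_, rfl⟩
    obtain ⟨g1, g2, g3, g4⟩ := hg
    by_contra hc
    refine hbad ⟨⟨lt_of_le_of_ne hs.1 g3.symm, lt_of_le_of_ne hs.2 g4⟩, ⟨deriv γ s, g1.hasDerivAt, fun h0 => hc ?_⟩, g2⟩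
    have := Complex.reCLM.hasFDerivAt.comp_hasDerivAt s g1.hasDerivAt
    simpa [h0, Function.comp_def] using this
  · left; exact ⟨s, hg, rfl⟩

lemma p6_cone {ν ν' ζ : ℂ} (hν : ν ≠ 0) (h : ‖ν' - ν‖ < ‖ν‖ / 32) (hν' : ν' ≠ 0)
    (hz : |(ζ / ν').im| < 3 * (ζ / ν').re) : |(ζ / ν).im| < 4 * (ζ / ν).re := by
  set y := ζ / ν' with hy
  set δ := (ν' - ν) / ν with hδ
  have e : ζ / ν = y + y * δ := by simp only [hy, hδ]; field_simp; ring
  have hn : ‖δ‖ ≤ 1 / 32 := by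
    rw [hδ, norm_div, div_le_iff₀ (norm_pos_iff.2 hν)]; linarith
  have h1 : ‖y * δ‖ ≤ 4 * y.re * (1 / 32) := by
    rw [norm_mul]
    have := Complex.norm_le_abs_re_add_abs_im y
    have hp : 0 < y.re := by linarith [abs_nonneg y.im]
    rw [abs_of_pos hp] at this
    gcongr; linarith
  rw [e, Complex.add_re, Complex.add_im]
  have a1 := abs_le.1 ((Complex.abs_re_le_norm _).trans h1)
  have a2 := (Complex.abs_im_le_norm _).trans h1
  have a3 := abs_add_le y.im (y * δ).im
  linarith [a1.1, abs_nonneg y.im]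

lemma p6_cone2 {R : ℝ} {A x : ℂ} (hR : 0 < R) (hA : ‖A - R‖ ≤ R / 50) (hx : 1 / 2 * |x.im| < (1 - x).re) :
    |(A * (1 - x)).im| < 3 * (A * (1 - x)).re := by
  have a1 := abs_le.1 ((Complex.abs_re_le_norm _).trans hA)
  have a2 := abs_le.1 ((Complex.abs_im_le_norm _).trans hA)
  simp only [Complex.sub_re, Complex.sub_im, Complex.ofReal_re, Complex.ofReal_im, sub_zero, Complex.one_re] at a1 a2 hx
  simp only [Complex.mul_re, Complex.mul_im, Complex.sub_re, Complex.sub_im, Complex.one_re, Complex.one_im, zero_sub]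
  set u := 1 - x.re
  set v := x.im
  have hv := abs_lt.1 (show |v| < 2 * u by linarith)
  have hu : 0 < u := by linarith [abs_nonneg v]
  have b1 : |A.im * v| ≤ R / 50 * (2 * u) := by
    rw [abs_mul]; gcongr
    · exact abs_le.2 a2
    · exact (abs_lt.2 hv).le
  have b2 : |A.im * u| ≤ R / 50 * u := by
    rw [abs_mul, abs_of_pos hu]; gcongr; exact abs_le.2 a2
  have b3 : |A.re * v| ≤ (51 / 50 * R) * (2 * u) := by
    rw [abs_mul]; gcongr
    · rw [abs_of_nonneg (by linarith)]; linarith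
    · exact (abs_lt.2 hv).le
  have b4 : 49 / 50 * R * u ≤ A.re * u := by gcongr; linarith
  have := mul_pos hR hu
  rw [abs_le] at b1 b2 b3
  rw [abs_lt]
  constructor <;> nlinarith

lemma p6_diff {S : Set ℂ} {γ κ : ℝ → ℂ} {L : ℝ} (h : P1D S γ κ L) {z : ℂ} (hz : z ∉ S) :
    DifferentiableAt ℂ (p6N γ κ) z := by
  have hSc : IsCompact S := by rw [← h.img]; exact isCompact_Icc.image h.lip.continuous
  obtain ⟨d, hd, hd2⟩ := Metric.isOpen_iff.1 hSc.isClosed.isOpen_compl z hz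
  have hi := p6_int h
  have e : p6N γ κ = fun z => (2 * π * Complex.I)⁻¹ * ∫ u in Set.Ioo 0 L, (γ u - z)⁻¹ • κ u := by
    ext z
    rw [p6N, setIntegral_eq_integral_of_forall_compl_eq_zero fun u hu => by simp [h.supp u hu]]
    simp [div_eq_inv_mul]
  rw [e]
  refine (p4_cauchyType hi.integrableOn h.lip.continuous.aemeasurable hd ?_).const_mul _
  filter_upwards [ae_restrict_mem measurableSet_Ioo] with u hu
  by_contra hlt
  push Not at hlt
  exact hd2 (by rwa [mem_ball_iff_norm]) (by rw [← h.img]; exact ⟨u, ⟨hu.1.le, hu.2.le⟩, rfl⟩)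

lemma p6_infty {S : Set ℂ} {γ κ : ℝ → ℂ} {L : ℝ} (h : P1D S γ κ L) :
    Tendsto (p6N γ κ) (Bornology.cobounded ℂ) (𝓝 0) := by
  obtain ⟨M, hM⟩ := (isCompact_Icc.image h.lip.continuous (s := Set.Icc 0 L)).isBounded.exists_norm_le
  have : (Bornology.cobounded ℂ).IsCountablyGenerated := by
    rw [← comap_norm_atTop]; infer_instance
  have : Tendsto (fun z => ∫ u, κ u / (γ u - z)) (Bornology.cobounded ℂ) (𝓝 (∫ u : ℝ, (0:ℂ))) := by
    refine tendsto_integral_filter_of_dominated_convergence (fun u => ‖κ u‖) ?_ ?_ (p6_int h).norm ?_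
    · exact Eventually.of_forall fun z => (h.meas.div (h.lip.continuous.measurable.sub_const z)).aestronglyMeasurable
    · filter_upwards [tendsto_norm_cobounded_atTop.eventually_ge_atTop (M + 1)] with z hz
      refine ae_of_all _ fun u => ?_
      by_cases hu : u ∈ Set.Ioo 0 L
      · rw [norm_div]
        refine div_le_self (norm_nonneg _) ?_
        have := hM _ ⟨u, ⟨hu.1.le, hu.2.le⟩, rfl⟩
        have := norm_sub_norm_le z (γ u)
        rw [norm_sub_rev]; linarith
      · simp [h.supp u hu]
    · refine ae_of_all _ fun u => ?_
      simp only [div_eq_mul_inv]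
      rw [← mul_zero (κ u)]
      refine (tendsto_inv₀_cobounded.comp ?_).const_mul _
      have := tendsto_const_sub_cobounded (γ u)
      exact this
  have h2 := this.const_mul (2 * π * Complex.I)⁻¹
  rwa [integral_zero, mul_zero] at h2

lemma p6_out {Ω : Set ℂ} {γ κ : ℝ → ℂ} {L : ℝ} (h : P1D (frontier Ω) γ κ L)
    (hN : ∀ z ∈ Ω, p6N γ κ z = 1) (ho : IsOpen Ω) (hb : Bornology.IsBounded Ω) (hne : Ω.Nonempty)
    (hpc : IsPreconnected (closure Ω)ᶜ) : ∀ z ∈ (closure Ω)ᶜ, p6N γ κ z = 0 := by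
  set W := (closure Ω)ᶜ with hW
  set N := p6N γ κ with hNN
  have hWo : IsOpen W := isClosed_closure.isOpen_compl
  have hfrW : ∀ p ∈ frontier Ω, p ∉ W := fun p hp hpW => hpW hp.1
  have hNd : DifferentiableOn ℂ N W := fun z hz =>
    (p6_diff h (fun hf => hfrW z hf hz)).differentiableWithinAt
  set D : ℕ → ℂ := TopologicalSpace.denseSeq ℂ with hD
  set Q : ℕ × ℕ × ℕ × ℕ → ℂ → Prop := fun i p => p ∈ frontier Ω ∧ D i.1 ≠ 0 ∧ ‖p - D i.2.1‖ < (1 / (i.2.2.1 + 1 : ℝ)) / 200 ∧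
    (∀ ζ : ℂ, ‖ζ‖ < 1 / (i.2.2.1 + 1 : ℝ) → |(ζ / D i.1).im| < 3 * (ζ / D i.1).re → p + ζ ∈ W ∧ ‖N (p + ζ) - i.2.2.2‖ ≤ 1) ∧
    Tendsto (fun ζ => N (p + ζ)) (𝓝[{ζ : ℂ | |(ζ / D i.1).im| < 3 * (ζ / D i.1).re}] 0) (𝓝 (i.2.2.2 : ℂ)) with hQ
  have hcov : Complex.re '' Ω ⊆ ((fun s => (γ s).re) '' {s | s ∈ Set.Icc 0 L ∧ ¬ (s ∈ Set.Ioo 0 L ∧ (∃ ω, HasDerivAt γ ω s ∧ ω.re ≠ 0) ∧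
      Tendsto (fun r => r⁻¹ * ∫ u in Metric.closedBall s r, ‖κ u - κ s‖) (𝓝[>] 0) (𝓝 0))}) ∪ ⋃ i, Complex.re '' {p | Q i p} := by
    intro x hx
    obtain ⟨p, hp, hpx, hup, hdown⟩ := p6_top ho hb hx
    obtain ⟨s, hs, rfl⟩ := (h.img ▸ hp : p ∈ γ '' Set.Icc 0 L)
    by_cases hg : s ∈ Set.Ioo 0 L ∧ (∃ ω, HasDerivAt γ ω s ∧ ω.re ≠ 0) ∧
      Tendsto (fun r => r⁻¹ * ∫ u in Metric.closedBall s r, ‖κ u - κ s‖) (𝓝[>] 0) (𝓝 0)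
    swap
    · left; exact ⟨s, ⟨hs, hg⟩, hpx⟩
    right
    obtain ⟨hs', ⟨ω, hω, hω0⟩, hL⟩ := hg
    obtain ⟨ν, hν, c, hc, r, hr, hout, hlim⟩ := p6_local h hN hs' hω hω0 hL hup hdown
    obtain ⟨k, rfl⟩ : ∃ k : ℕ, c = k := by
      rcases hc with rfl | rfl | rfl
      · exact ⟨0, by simp⟩
      · exact ⟨1, by simp⟩
      · exact ⟨2, by simp⟩
    have hνn : 0 < ‖ν‖ := norm_pos_iff.2 hν
    obtain ⟨i, hi⟩ := (TopologicalSpace.denseRange_denseSeq ℂ).exists_dist_lt ν (show 0 < ‖ν‖ / 32 by positivity)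
    rw [dist_comm, dist_eq_norm] at hi
    have hi0 : D i ≠ 0 := by
      intro h0
      rw [← hD, h0, zero_sub, norm_neg] at hi
      linarith
    have hcone : ∀ ζ : ℂ, |(ζ / D i).im| < 3 * (ζ / D i).re → |(ζ / ν).im| < 4 * (ζ / ν).re := fun ζ hζ =>
      p6_cone hν hi hi0 hζ
    have hlim' := hlim.mono_left (nhdsWithin_mono (0:ℂ) (fun ζ hζ => hcone ζ hζ : {ζ : ℂ | |(ζ / D i).im| < 3 * (ζ / D i).re} ⊆ _))
    have hev := hlim'.eventually (Metric.closedBall_mem_nhds _ one_pos)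
    rw [eventually_nhdsWithin_iff, Metric.eventually_nhds_iff] at hev
    obtain ⟨ε, hε, hev⟩ := hev
    obtain ⟨m, hm⟩ := exists_nat_one_div_lt (lt_min hr hε)
    have hm0 : 0 < 1 / (m + 1 : ℝ) / 200 := by positivity
    obtain ⟨j, hj⟩ := (TopologicalSpace.denseRange_denseSeq ℂ).exists_dist_lt (γ s) hm0
    rw [dist_eq_norm] at hj
    refine Set.mem_iUnion.2 ⟨(i, j, m, k), γ s, ⟨hp, hi0, hj, fun ζ h1 h2 => ⟨?_, ?_⟩, hlim'⟩, hpx⟩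
    · exact hout ζ (h1.trans (hm.trans_le (min_le_left _ _))) (hcone ζ h2)
    · have := hev (y := ζ) (by simpa using h1.trans (hm.trans_le (min_le_right _ _))) h2
      simpa [dist_eq_norm] using this
  obtain ⟨i, hi⟩ : ∃ i, volume (Complex.re '' {p | Q i p}) ≠ 0 := by
    by_contra! hall
    have h0 : volume (Complex.re '' Ω) = 0 :=
      measure_mono_null hcov (measure_union_null (p6_bad h) (measure_iUnion_null hall))
    exact ((Complex.isOpenMap_re _ ho).measure_pos volume (hne.image _)).ne' h0
  obtain ⟨i, j, m, k⟩ := i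
  simp only [hQ] at hi
  set r : ℝ := 1 / (m + 1 : ℝ) with hr
  have hr0 : 0 < r := by positivity
  set ν := D i with hν
  set q := D j with hq
  have hν0 : ν ≠ 0 := by
    intro h0; apply hi; simp [h0]
  have hνn : 0 < ‖ν‖ := norm_pos_iff.2 hν0
  set R : ℝ := r / (4 * ‖ν‖) with hR
  have hR0 : 0 < R := by positivity
  have hRν : R * ‖ν‖ = r / 4 := by rw [hR]; field_simp
  set c0 : ℂ := q + R * ν with hc0
  have hA : ∀ p, ‖p - q‖ < r / 200 → ‖(c0 - p) / ν - R‖ ≤ R / 50 := by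
    intro p hp
    have : (c0 - p) / ν - R = (q - p) / ν := by rw [hc0]; field_simp; ring
    rw [this, norm_div, div_le_iff₀ hνn, norm_sub_rev]
    nlinarith
  have hcp : ∀ p, ‖p - q‖ < r / 200 → ‖c0 - p‖ ≤ r / 4 + r / 200 := by
    intro p hp
    have : c0 - p = R * ν + (q - p) := by rw [hc0]; ring
    rw [this]
    refine (norm_add_le _ _).trans ?_
    rw [norm_mul, Complex.norm_real, Real.norm_of_nonneg hR0.le, hRν, norm_sub_rev]; linarith
  obtain ⟨hc0W, hev⟩ := p6_star (W := (fun z => c0 + z) ⁻¹' W) (E := (fun p => p - c0) '' {p | Q (i, j, m, k) p})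
    (f := fun z => N (c0 + z) - k) (hWo.preimage (by fun_prop))
    ((hNd.comp (by fun_prop) (Set.mapsTo_preimage _ _)).sub_const _) (M := r / 4 + r / 200)
    (by
      rintro _ ⟨p, hp, rfl⟩
      simp only [norm_sub_rev p c0]
      exact hcp p hp.2.2.1)
    (by
      rintro _ ⟨p, hp, rfl⟩ h0
      have := hA p hp.2.2.1
      rw [sub_eq_zero] at h0
      rw [← h0, sub_self, zero_div, zero_sub, norm_neg, Complex.norm_real, Real.norm_of_nonneg hR0.le] at this
      linarith)
    (by
      rintro _ ⟨p, hp, rfl⟩ h0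
      refine hfrW p hp.1 ?_
      simpa using h0)
    (by
      rintro _ ⟨p, hp, rfl⟩ x hx hx1
      have e : c0 + (p - c0) * x = p + (c0 - p) * (1 - x) := by ring
      have := hp.2.2.2.1 ((c0 - p) * (1 - x)) ?_ ?_
      · simpa only [Set.mem_preimage, e] using this
      · rw [norm_mul]
        have h1 := hcp p hp.2.2.1
        have h2 : ‖1 - x‖ ≤ 2 := (norm_sub_le _ _).trans (by rw [norm_one]; linarith)
        have : ‖c0 - p‖ * ‖1 - x‖ ≤ (r / 4 + r / 200) * 2 := by gcongr
        exact this.trans_lt (by linarith)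
      · have := p6_cone2 hR0 (hA p hp.2.2.1) hx
        rwa [div_mul_eq_mul_div] at this)
    (by
      rintro _ ⟨p, hp, rfl⟩
      have t1 : Tendsto (fun l : ℝ => (c0 - p) * (1 - l)) (𝓝[<] 1) (𝓝[{ζ : ℂ | |(ζ / ν).im| < 3 * (ζ / ν).re}] 0) := by
        refine tendsto_nhdsWithin_of_tendsto_nhds_of_eventually_within _ ?_ ?_
        · exact tendsto_nhdsWithin_of_tendsto_nhds (Continuous.tendsto' (by fun_prop) _ _ (by simp))
        · filter_upwards [self_mem_nhdsWithin] with l hl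
          have hl : l < 1 := hl
          have := p6_cone2 (x := l) hR0 (hA p hp.2.2.1) (by simpa using hl)
          rwa [div_mul_eq_mul_div] at this
      have := (hp.2.2.2.2.comp t1).sub_const (k:ℂ)
      rw [sub_self] at this
      refine this.congr fun l => ?_
      simp only [Function.comp]
      congr 2; ring)
    (by
      intro h0
      apply hi
      have e : Complex.re '' ((fun p => p - c0) '' {p | Q (i, j, m, k) p}) =
          (fun x => x + (-c0.re)) '' (Complex.re '' {p | Q (i, j, m, k) p}) := by
        simp only [Set.image_image, sub_eq_add_neg, Complex.add_re, Complex.neg_re]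
      rw [e, Set.image_add_right, measure_preimage_add_right] at h0
      exact h0)
  have hc0W : c0 ∈ W := by simpa using hc0W
  have hNk : Set.EqOn N (fun _ => (k:ℂ)) W := by
    refine AnalyticOnNhd.eqOn_of_preconnected_of_eventuallyEq (hNd.analyticOnNhd hWo) analyticOnNhd_const hpc hc0W ?_
    have : Tendsto (fun z => z - c0) (𝓝 c0) (𝓝 0) := Continuous.tendsto' (by fun_prop) _ _ (by simp)
    filter_upwards [this.eventually hev] with z hz
    simpa [sub_eq_zero] using hz
  have hk : (k:ℂ) = 0 := by
    refine tendsto_nhds_unique (tendsto_const_nhds.congr' ?_) (p6_infty h)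
    have : W ∈ Bornology.cobounded ℂ := by
      rw [← Bornology.isBounded_def]; exact hb.closure
    filter_upwards [this] with z hz using (hNk hz).symm
  intro z hz
  rw [hNk hz, hk]

noncomputable def p7d {E : Type*} [NormedAddCommGroup E] [NormedSpace ℂ E] (φ : ℂ → E) (z : ℂ) : E :=
  (1 / 2 : ℂ) • (fderiv ℝ φ z 1 + Complex.I • fderiv ℝ φ z Complex.I)

section
variable {E : Type*} [NormedAddCommGroup E] [NormedSpace ℂ E]

lemma p7_rot (D : ℂ →L[ℝ] E) (v : ℂ) : D v + Complex.I • D (Complex.I * v) =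
    (starRingEnd ℂ v) • (D 1 + Complex.I • D Complex.I) := by
  have hD : ∀ x y : ℝ, D (x + y * Complex.I) = (x : ℂ) • D 1 + (y : ℂ) • D Complex.I := by
    intro x y
    rw [map_add, ← Complex.real_smul, map_smul, Complex.coe_smul, Complex.coe_smul]
    congr 1
    rw [← mul_one (x:ℂ), ← Complex.real_smul, map_smul]
  have e1 : Complex.I * v = ((-v.im : ℝ) : ℂ) + (v.re : ℝ) * Complex.I := by
    apply Complex.ext <;> simp
  have e2 : starRingEnd ℂ v = v.re - v.im * Complex.I := by
    apply Complex.ext <;> simp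
  rw [e1, hD, e2]
  nth_rewrite 1 [← Complex.re_add_im v]
  rw [hD]
  have : (v.im * Complex.I * Complex.I : ℂ) = -v.im := by rw [mul_assoc, Complex.I_mul_I]; ring
  simp only [smul_add, smul_smul, Complex.ofReal_neg, sub_mul, this]
  module

lemma p7_cont {φ : ℂ → E} (hφ : ContDiff ℝ 1 φ) : Continuous (p7d φ) := by
  have := hφ.continuous_fderiv one_ne_zero
  unfold p7d
  fun_prop

lemma p7_supp {φ : ℂ → E} {M : ℝ} (hM : ∀ z, M < ‖z‖ → fderiv ℝ φ z = 0) {z : ℂ} (hz : M < ‖z‖) : p7d φ z = 0 := by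
  simp [p7d, hM z hz]

lemma p7_pompeiu [CompleteSpace E] {φ : ℂ → E} (hφ : ContDiff ℝ 1 φ) (hc : HasCompactSupport φ) (w : ℂ) :
    ∫ z, (z - w)⁻¹ • p7d φ z = (-π : ℂ) • φ w := by
  obtain ⟨M, hM0, hM⟩ : ∃ M, 0 < M ∧ ∀ z, M < ‖z - w‖ → φ z = 0 ∧ fderiv ℝ φ z = 0 := by
    obtain ⟨M, hM⟩ := hc.isCompact.isBounded.subset_closedBall w
    refine ⟨max M 1, by positivity, fun z hz => ?_⟩
    have hz' : z ∉ tsupport φ := fun h => by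
      have := hM h
      rw [mem_closedBall_iff_norm] at this
      exact absurd (this.trans (le_max_left _ 1)) (not_le.2 hz)
    exact ⟨image_eq_zero_of_notMem_tsupport hz', by
      by_contra h; exact hz' (support_fderiv_subset ℝ h)⟩
  set D := fderiv ℝ φ with hD
  have hDc : Continuous D := hφ.continuous_fderiv one_ne_zero
  have hφd : ∀ z, HasFDerivAt φ (D z) z := fun z => (hφ.differentiable one_ne_zero z).hasFDerivAt
  set e : ℝ → ℂ := fun θ => Complex.exp (θ * Complex.I) with he
  have hec : Continuous e := by fun_prop
  have hen : ∀ θ, ‖e θ‖ = 1 := fun θ => Complex.norm_exp_ofReal_mul_I θ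
  have hed : ∀ θ, HasDerivAt e (Complex.I * e θ) θ := fun θ => by
    have := ((Complex.ofRealCLM.hasDerivAt (x := θ)).mul_const Complex.I).cexp
    simpa [mul_comm, he] using this
  have hnrm : ∀ r θ : ℝ, 0 ≤ r → ‖w + r * e θ - w‖ = r := fun r θ hr => by
    rw [add_sub_cancel_left, norm_mul, hen, Complex.norm_real, Real.norm_of_nonneg hr, mul_one]
  have hint : ∀ g : ℝ → ℂ, Continuous g → IntegrableOn (fun p : ℝ × ℝ => D (w + p.1 * e p.2) (g p.2)) (Set.Ioi 0 ×ˢ Set.Ioo (-π) π) := by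
    intro g hg
    have h1 : Continuous (fun p : ℝ × ℝ => D (w + p.1 * e p.2) (g p.2)) := by fun_prop
    have h2 := h1.continuousOn.integrableOn_compact (μ := volume) ((isCompact_Icc (a := (0:ℝ)) (b := M)).prod (isCompact_Icc (a := -π) (b := π)))
    refine h2.of_forall_diff_eq_zero (measurableSet_Ioi.prod measurableSet_Ioo) ?_
    rintro ⟨r, θ⟩ ⟨⟨h3, h4⟩, h5⟩
    have hr : M < r := by
      by_contra hle
      exact h5 ⟨⟨(h3 : 0 < r).le, not_lt.1 hle⟩, ⟨h4.1.le, h4.2.le⟩⟩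
    simp only
    rw [(hM _ (by rw [hnrm _ _ (h3 : 0 < r).le]; exact hr)).2]; simp
  have h1 : ∫ p in Set.Ioi (0:ℝ) ×ˢ Set.Ioo (-π) π, D (w + p.1 * e p.2) (e p.2) = (-(2 * π) : ℂ) • φ w := by
    have hi := hint e hec
    rw [Measure.volume_eq_prod] at hi
    rw [Measure.volume_eq_prod, setIntegral_prod _ hi, integral_integral_swap (by rw [Measure.prod_restrict]; exact hi)]
    have h3 : ∀ θ, ∫ r in Set.Ioi (0:ℝ), D (w + r * e θ) (e θ) = - φ w := by
      intro θ
      have hd : ∀ r : ℝ, HasDerivAt (fun r : ℝ => φ (w + r * e θ)) (D (w + r * e θ) (e θ)) r := fun r => by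
        have := (hφd (w + r * e θ)).comp_hasDerivAt r (((Complex.ofRealCLM.hasDerivAt (x := r)).mul_const (e θ)).const_add w)
        simpa [Function.comp_def] using this
      have := integral_Ioi_of_hasDerivAt_of_tendsto' (a := 0) (m := 0) (fun r _ => hd r) ?_ ?_
      · simpa using this
      · have h1 : Continuous (fun r : ℝ => D (w + r * e θ) (e θ)) := by fun_prop
        refine (h1.continuousOn.integrableOn_compact (μ := volume) (isCompact_Icc (a := (0:ℝ)) (b := M))).of_forall_diff_eq_zero measurableSet_Ioi ?_
        rintro r ⟨h3, h5⟩
        have hr : M < r := by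
          by_contra hle
          exact h5 ⟨(h3 : 0 < r).le, not_lt.1 hle⟩
        rw [(hM _ (by rw [hnrm _ _ (h3 : 0 < r).le]; exact hr)).2]; simp
      · refine tendsto_const_nhds.congr' ?_
        filter_upwards [eventually_gt_atTop M] with r hr
        rw [(hM _ (by rw [hnrm _ _ (hM0.trans hr).le]; exact hr)).1]
    simp only [h3]
    rw [setIntegral_const]
    simp only [measureReal_def, Real.volume_Ioo]
    rw [ENNReal.toReal_ofReal (by linarith [Real.pi_pos]), ← Complex.coe_smul, smul_neg, ← neg_smul]
    congr 1; push_cast; ring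
  have h2 : ∫ p in Set.Ioi (0:ℝ) ×ˢ Set.Ioo (-π) π, D (w + p.1 * e p.2) (Complex.I * e p.2) = 0 := by
    rw [Measure.volume_eq_prod, setIntegral_prod _ (by rw [← Measure.volume_eq_prod]; exact hint (fun θ => Complex.I * e θ) (by fun_prop))]
    refine setIntegral_eq_zero_of_forall_eq_zero fun r hr => ?_
    have hr : 0 < r := hr
    have hd : ∀ θ, HasDerivAt (fun θ : ℝ => φ (w + r * e θ)) (D (w + r * e θ) (r * (Complex.I * e θ))) θ := fun θ =>
      (hφd _).comp_hasDerivAt θ (((hed θ).const_mul (r:ℂ)).const_add w)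
    have h3 := intervalIntegral.integral_eq_sub_of_hasDerivAt (a := -π) (b := π) (fun θ _ => hd θ)
      (Continuous.intervalIntegrable (by fun_prop) _ _)
    rw [intervalIntegral.integral_of_le (by linarith [Real.pi_pos]), integral_Ioc_eq_integral_Ioo] at h3
    have h4 : e π = e (-π) := by simp [he, Complex.exp_neg]
    rw [h4, sub_self] at h3
    simp only [← Complex.real_smul (x := r), map_smul, integral_smul] at h3
    simp only [Complex.real_smul] at h3
    exact (smul_eq_zero.1 h3).resolve_left hr.ne'
  rw [← integral_add_left_eq_self (μ := volume) (fun z => (z - w)⁻¹ • p7d φ z) w, ← Complex.integral_comp_polarCoord_symm, polarCoord_target]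
  have h3 : ∀ p ∈ Set.Ioi (0:ℝ) ×ˢ Set.Ioo (-π) π, p.1 • (fun z => (w + z - w)⁻¹ • p7d φ (w + z)) (Complex.polarCoord.symm p)
      = (1 / 2 : ℂ) • (D (w + p.1 * e p.2) (e p.2) + Complex.I • D (w + p.1 * e p.2) (Complex.I * e p.2)) := by
    rintro ⟨r, θ⟩ ⟨hr, -⟩
    have hr : 0 < r := hr
    have e1 : Complex.polarCoord.symm (r, θ) = r * e θ := by
      rw [Complex.polarCoord_symm_apply, he]; simp only; rw [Complex.exp_mul_I]; push_cast; rfl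
    simp only [e1]
    rw [p7_rot, p7d, ← Complex.coe_smul, smul_smul, smul_smul, smul_smul]
    congr 1
    have e2 : starRingEnd ℂ (e θ) = (e θ)⁻¹ := by
      rw [Complex.inv_def, Complex.normSq_eq_norm_sq, hen]; simp
    have hr' : (r:ℂ) ≠ 0 := by exact_mod_cast hr.ne'
    have : e θ ≠ 0 := Complex.exp_ne_zero _
    rw [e2, add_sub_cancel_left]
    field_simp
  have h5 : IntegrableOn (fun p : ℝ × ℝ => Complex.I • D (w + p.1 * e p.2) (Complex.I * e p.2)) (Set.Ioi 0 ×ˢ Set.Ioo (-π) π) :=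
    (hint (fun θ => Complex.I * e θ) (by fun_prop)).smul Complex.I
  rw [setIntegral_congr_fun (measurableSet_Ioi.prod measurableSet_Ioo) h3, integral_smul,
    integral_add (hint _ hec) h5, integral_smul, h1, h2, smul_zero, add_zero, smul_smul]
  congr 1; ring
end

lemma p7_ker (a z : ℂ) {ρ : ℝ} (hρ : 0 < ρ) : IntegrableOn (fun w => ‖w - z‖⁻¹) (Metric.ball a ρ) ∧
    ∫ w in Metric.ball a ρ, ‖w - z‖⁻¹ ≤ 3 * π * ρ := by
  have hm : ∀ z : ℂ, Measurable fun w : ℂ => ENNReal.ofReal ‖w - z‖⁻¹ := fun z => by fun_prop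
  have h0 : ∫⁻ w in Metric.ball (0:ℂ) ρ, ENNReal.ofReal ‖w‖⁻¹ ≤ ENNReal.ofReal (2 * π * ρ) := by
    rw [← lintegral_indicator Metric.isOpen_ball.measurableSet, ← Complex.lintegral_comp_polarCoord_symm, polarCoord_target]
    calc _ ≤ ∫⁻ p in Set.Ioi (0:ℝ) ×ˢ Set.Ioo (-π) π, (Set.Ioo (0:ℝ) ρ ×ˢ Set.Ioo (-π) π).indicator 1 p := by
          refine setLIntegral_mono' (measurableSet_Ioi.prod measurableSet_Ioo) ?_
          rintro ⟨r, θ⟩ ⟨hr, hθ⟩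
          have hr : 0 < r := hr
          have hn : ‖Complex.polarCoord.symm (r, θ)‖ = r := by
            rw [Complex.norm_polarCoord_symm]; exact abs_of_pos hr
          by_cases hrρ : r < ρ
          · rw [Set.indicator_of_mem (by rw [mem_ball_zero_iff, hn]; exact hrρ), Set.indicator_of_mem (show (r, θ) ∈ Set.Ioo (0:ℝ) ρ ×ˢ Set.Ioo (-π) π from ⟨⟨hr, hrρ⟩, hθ⟩), hn]
            simp only [smul_eq_mul]
            rw [← ENNReal.ofReal_mul hr.le, mul_inv_cancel₀ hr.ne']; simp
          · rw [Set.indicator_of_notMem (by rw [mem_ball_zero_iff, hn]; exact hrρ)]; simp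
      _ ≤ ∫⁻ p, (Set.Ioo (0:ℝ) ρ ×ˢ Set.Ioo (-π) π).indicator 1 p := setLIntegral_le_lintegral _ _
      _ = ENNReal.ofReal (2 * π * ρ) := by
          rw [lintegral_indicator_one (measurableSet_Ioo.prod measurableSet_Ioo), Measure.volume_eq_prod, Measure.prod_prod, Real.volume_Ioo, Real.volume_Ioo, ← ENNReal.ofReal_mul (by linarith)]
          congr 1; ring
  have h1 : ∫⁻ w in Metric.ball z ρ, ENNReal.ofReal ‖w - z‖⁻¹ ≤ ENNReal.ofReal (2 * π * ρ) := by
    refine le_trans (le_of_eq ?_) h0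
    rw [← lintegral_indicator Metric.isOpen_ball.measurableSet, ← lintegral_indicator Metric.isOpen_ball.measurableSet,
      ← lintegral_add_right_eq_self (μ := volume) _ z]
    congr 1; ext w
    by_cases hw : w ∈ Metric.ball (0:ℂ) ρ
    · rw [Set.indicator_of_mem hw, Set.indicator_of_mem (by simpa [dist_eq_norm] using hw)]; simp
    · rw [Set.indicator_of_notMem hw, Set.indicator_of_notMem (by simpa [dist_eq_norm] using hw)]
  have h2 : ∫⁻ w in Metric.ball a ρ, ENNReal.ofReal ‖w - z‖⁻¹ ≤ ENNReal.ofReal (3 * π * ρ) := by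
    rw [← lintegral_indicator Metric.isOpen_ball.measurableSet] at h1
    calc _ ≤ ∫⁻ w in Metric.ball a ρ, ((Metric.ball z ρ).indicator (fun w => ENNReal.ofReal ‖w - z‖⁻¹) w + ENNReal.ofReal ρ⁻¹) := by
          refine lintegral_mono fun w => ?_
          by_cases hw : w ∈ Metric.ball z ρ
          · rw [Set.indicator_of_mem hw]; exact le_self_add
          · rw [Set.indicator_of_notMem hw, zero_add]
            refine ENNReal.ofReal_le_ofReal ?_
            rw [mem_ball_iff_norm, not_lt] at hw
            gcongr
      _ ≤ ENNReal.ofReal (2 * π * ρ) + ENNReal.ofReal (π * ρ) := by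
          rw [lintegral_add_right _ measurable_const, setLIntegral_const, Complex.volume_ball]
          refine add_le_add ((setLIntegral_le_lintegral _ _).trans h1) (le_of_eq ?_)
          rw [← ENNReal.ofReal_pow hρ.le, show (NNReal.pi : ENNReal) = ENNReal.ofReal π by
            rw [← NNReal.coe_real_pi, ENNReal.ofReal_coe_nnreal], ← ENNReal.ofReal_mul (by positivity), ← ENNReal.ofReal_mul (by positivity)]
          congr 1; field_simp
      _ = _ := by
          rw [← ENNReal.ofReal_add (by positivity) (by positivity)]; congr 1; ring
  have hmm : AEStronglyMeasurable (fun w : ℂ => ‖w - z‖⁻¹) (volume.restrict (Metric.ball a ρ)) :=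
    (by fun_prop : Measurable fun w : ℂ => ‖w - z‖⁻¹).aestronglyMeasurable
  have hnn : 0 ≤ᵐ[volume.restrict (Metric.ball a ρ)] (fun w : ℂ => ‖w - z‖⁻¹) := ae_of_all _ fun w => by positivity
  refine ⟨⟨hmm, ?_⟩, ?_⟩
  · rw [hasFiniteIntegral_iff_ofReal hnn]
    exact h2.trans_lt ENNReal.ofReal_lt_top
  · rw [integral_eq_lintegral_of_nonneg_ae hnn hmm]
    exact ENNReal.toReal_le_of_le_ofReal (by positivity) h2

lemma p7_area {S : Set ℂ} {γ κ : ℝ → ℂ} {L : ℝ} (h : P1D S γ κ L) : volume S = 0 := by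
  have h1 : dimH S ≤ 1 := by
    rw [← h.img]
    exact (h.lip.dimH_image_le _).trans ((dimH_mono (Set.subset_univ _)).trans (by rw [Real.dimH_univ]))
  have h2 : (Measure.hausdorffMeasure 2 : Measure ℂ) S = 0 :=
    hausdorffMeasure_of_dimH_lt (d := 2) (h1.trans_lt (by norm_num))
  have : (Measure.hausdorffMeasure (Module.finrank ℝ ℂ) : Measure ℂ).IsAddHaarMeasure := isAddHaarMeasure_hausdorffMeasure
  rw [Complex.finrank_real_complex] at this
  have h3 : (volume : Measure ℂ) ≪ Measure.hausdorffMeasure ((2:ℕ):ℝ) := Measure.absolutelyContinuous_isAddHaarMeasure _ _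
  exact h3 (by simpa using h2)

section
variable {E : Type*} [NormedAddCommGroup E] [NormedSpace ℂ E]

lemma p7_fub [CompleteSpace E] {S : Set ℂ} {γ κ : ℝ → ℂ} {L : ℝ} (h : P1D S γ κ L) {P : ℝ → ℂ → E} {C ρ : ℝ} {a : ℂ} (hρ : 0 < ρ)
    (hP : AEStronglyMeasurable (Function.uncurry P) ((volume.restrict (Set.Ioo 0 L)).prod volume))
    (hC : ∀ u ∈ Set.Ioo 0 L, ∀ z, ‖P u z‖ ≤ C) (h0 : ∀ u, ∀ z ∉ Metric.ball a ρ, P u z = 0) :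
    ∫ z, ∫ u in Set.Ioo 0 L, (γ u - z)⁻¹ • P u z = ∫ u in Set.Ioo 0 L, ∫ z, (γ u - z)⁻¹ • P u z := by
  have hm : AEStronglyMeasurable (fun p : ℝ × ℂ => (γ p.1 - p.2)⁻¹ • P p.1 p.2) ((volume.restrict (Set.Ioo 0 L)).prod volume) := by
    refine AEStronglyMeasurable.smul (Measurable.aestronglyMeasurable ?_) hP
    have := h.lip.continuous
    fun_prop
  have hb : ∀ u ∈ Set.Ioo 0 L, ∀ z, ‖(γ u - z)⁻¹ • P u z‖ ≤ (Metric.ball a ρ).indicator (fun z => C * ‖z - γ u‖⁻¹) z := by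
    intro u hu z
    by_cases hz : z ∈ Metric.ball a ρ
    · rw [Set.indicator_of_mem hz, norm_smul, norm_inv, norm_sub_rev, mul_comm]
      gcongr; exact hC u hu z
    · rw [Set.indicator_of_notMem hz, h0 u z hz]; simp
  have hbi : ∀ u, Integrable ((Metric.ball a ρ).indicator (fun z => C * ‖z - γ u‖⁻¹)) := fun u => by
    rw [integrable_indicator_iff Metric.isOpen_ball.measurableSet]
    exact (p7_ker a (γ u) hρ).1.const_mul C
  refine (integral_integral_swap (f := fun u z => (γ u - z)⁻¹ • P u z) ?_).symm
  refine (integrable_prod_iff hm).2 ⟨?_, ?_⟩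
  · filter_upwards [ae_restrict_mem measurableSet_Ioo, hm.prodMk_left] with u hu hmu
    exact (hbi u).mono' hmu (ae_of_all _ (hb u hu))
  · refine Integrable.of_bound hm.norm.integral_prod_right' (C := C * (3 * π * ρ)) ?_
    filter_upwards [ae_restrict_mem measurableSet_Ioo, hm.prodMk_left] with u hu hmu
    have hC0 : 0 ≤ C := (norm_nonneg _).trans (hC u hu 0)
    rw [Real.norm_of_nonneg (integral_nonneg fun _ => norm_nonneg _)]
    refine (integral_mono_of_nonneg (ae_of_all _ fun _ => norm_nonneg _) (hbi u) (ae_of_all _ (hb u hu))).trans ?_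
    rw [integral_indicator Metric.isOpen_ball.measurableSet, integral_const_mul]
    exact mul_le_mul_of_nonneg_left (p7_ker a (γ u) hρ).2 hC0

lemma p7_green [CompleteSpace E] {Ω : Set ℂ} {γ κ : ℝ → ℂ} {L : ℝ} (h : P1D (frontier Ω) γ κ L) (ho : IsOpen Ω)
    (hN : ∀ z ∈ Ω, p6N γ κ z = 1) (hN0 : ∀ z ∈ (closure Ω)ᶜ, p6N γ κ z = 0) {φ : ℂ → E} (hφ : ContDiff ℝ 1 φ)
    (hc : HasCompactSupport φ) : ∫ u, κ u • φ (γ u) = (2 * Complex.I) • ∫ z in Ω, p7d φ z := by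
  have hpc := p7_cont hφ
  have hpc' : HasCompactSupport (p7d φ) := (hc.fderiv (𝕜 := ℝ)).mono' (by
    intro z hz
    by_contra h0
    have : fderiv ℝ φ z = 0 := image_eq_zero_of_notMem_tsupport h0
    exact hz (by simp [p7d, this]))
  obtain ⟨ρ, hρ0, hρ⟩ : ∃ ρ, 0 < ρ ∧ ∀ z ∉ Metric.ball (0:ℂ) ρ, p7d φ z = 0 := by
    obtain ⟨M, hM⟩ := hpc'.isCompact.isBounded.subset_ball 0
    refine ⟨max M 1, by positivity, fun z hz => ?_⟩
    refine image_eq_zero_of_notMem_tsupport fun h => hz ?_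
    exact Metric.ball_subset_ball (le_max_left _ _) (hM h)
  obtain ⟨C, hC⟩ := hpc'.exists_bound_of_continuous hpc
  have hf := p7_fub h (P := fun u z => κ u • p7d φ z) (C := C) (a := 0) hρ0
    ((h.meas.comp measurable_fst).aestronglyMeasurable.smul (hpc.comp continuous_snd).aestronglyMeasurable)
    (fun u _ z => by
      rw [norm_smul]
      exact (mul_le_of_le_one_left (norm_nonneg _) (h.bd u)).trans (hC z)) (fun u z hz => by simp [hρ z hz])
  have e1 : ∀ u, ∫ z, (γ u - z)⁻¹ • κ u • p7d φ z = (π : ℂ) • κ u • φ (γ u) := by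
    intro u
    have : ∀ z, (γ u - z)⁻¹ • κ u • p7d φ z = (-κ u) • (z - γ u)⁻¹ • p7d φ z := fun z => by
      rw [smul_smul, smul_smul, ← neg_sub z, inv_neg]; congr 1; ring
    simp only [this]
    rw [integral_smul, p7_pompeiu hφ hc, smul_smul, smul_smul]; congr 1; ring
  have e2 : ∀ z, ∫ u in Set.Ioo 0 L, (γ u - z)⁻¹ • κ u • p7d φ z = (2 * π * Complex.I * p6N γ κ z) • p7d φ z := by
    intro z
    simp only [smul_smul]
    rw [integral_smul_const]
    congr 1
    have h2 : (2 * π * Complex.I : ℂ) ≠ 0 := by simp [Real.pi_ne_zero]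
    rw [p6N, mul_inv_cancel_left₀ h2, setIntegral_eq_integral_of_forall_compl_eq_zero fun u hu => by simp [h.supp u hu]]
    simp [div_eq_inv_mul]
  simp only [e1, e2] at hf
  rw [integral_smul, setIntegral_eq_integral_of_forall_compl_eq_zero fun u hu => by simp [h.supp u hu]] at hf
  have hπ : (π:ℂ) ≠ 0 := by simp [Real.pi_ne_zero]
  have e3 : ∫ z, (2 * π * Complex.I * p6N γ κ z) • p7d φ z = (2 * π * Complex.I : ℂ) • ∫ z in Ω, p7d φ z := by
    rw [← integral_smul, ← integral_indicator ho.measurableSet]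
    refine integral_congr_ae ?_
    have : ∀ᵐ z, z ∉ frontier Ω := by
      rw [ae_iff]; simpa using p7_area h
    filter_upwards [this] with z hz
    by_cases hzΩ : z ∈ Ω
    · rw [Set.indicator_of_mem hzΩ, hN z hzΩ, mul_one]
    · rw [Set.indicator_of_notMem hzΩ, hN0 z, mul_zero, zero_smul]
      intro hcl; exact hz (ho.frontier_eq ▸ ⟨hcl, hzΩ⟩)
  rw [e3] at hf
  have := congrArg (fun x => (π:ℂ)⁻¹ • x) hf
  simp only [smul_smul, inv_mul_cancel₀ hπ, one_smul] at this
  rw [← this]; congr 1; field_simp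
end

structure P7X (l : ℂ) (C ε : ℝ) (X : ℂ → ℂ) : Prop where
  cd : ContDiff ℝ 1 X
  one : ∀ z, ‖z - l‖ < ε → X z = 1
  zero : ∀ z, 2 * ε ≤ ‖z - l‖ → X z = 0
  le : ∀ z, ‖1 - X z‖ ≤ 1
  dle : ∀ z, ‖p7d X z‖ ≤ C / ε
  d0 : ∀ z ∉ Metric.ball l (3 * ε), p7d X z = 0

lemma p7_congr {E : Type*} [NormedAddCommGroup E] [NormedSpace ℂ E] {f g : ℂ → E} {z : ℂ} (h : f =ᶠ[𝓝 z] g) :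
    p7d f z = p7d g z := by
  rw [p7d, p7d, h.fderiv_eq]

lemma p7_const {E : Type*} [NormedAddCommGroup E] [NormedSpace ℂ E] (c : E) (z : ℂ) : p7d (fun _ => c) z = 0 := by
  simp [p7d]

lemma p7_cut (l : ℂ) : ∃ C : ℝ, 0 ≤ C ∧ ∃ X : ℝ → ℂ → ℂ, ∀ ε > 0, P7X l C ε (X ε) := by
  let f : ContDiffBump (0:ℂ) := ⟨1, 2, one_pos, one_lt_two⟩
  have hfc : ContDiff ℝ 1 (fun z => (f z : ℂ)) := Complex.ofRealCLM.contDiff.comp f.contDiff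
  have hcs : HasCompactSupport (fun z => (f z : ℂ)) := f.hasCompactSupport.comp_left (g := fun x : ℝ => (x:ℂ)) (by simp)
  obtain ⟨C, hC⟩ := (hcs.fderiv (𝕜 := ℝ)).exists_bound_of_continuous (hfc.continuous_fderiv one_ne_zero)
  refine ⟨C, (norm_nonneg _).trans (hC 0), fun ε z => (f (ε⁻¹ • (z - l)) : ℂ), fun ε hε => ?_⟩
  have hz : ∀ z, 2 * ε ≤ ‖z - l‖ → (f (ε⁻¹ • (z - l)) : ℂ) = 0 := by
    intro z hz
    rw [f.zero_of_le_dist, Complex.ofReal_zero]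
    rw [dist_zero_right, norm_smul, norm_inv, Real.norm_of_nonneg hε.le, ← div_eq_inv_mul, le_div_iff₀ hε]
    exact hz
  refine ⟨hfc.comp (by fun_prop), ?_, hz, ?_, ?_, ?_⟩
  · intro z hz
    show (f (ε⁻¹ • (z - l)) : ℂ) = 1
    rw [f.one_of_mem_closedBall, Complex.ofReal_one]
    rw [mem_closedBall_zero_iff, norm_smul, norm_inv, Real.norm_of_nonneg hε.le, ← div_eq_inv_mul, div_le_iff₀ hε]
    show _ ≤ 1 * ε
    linarith
  · intro z
    rw [← Complex.ofReal_one, ← Complex.ofReal_sub, Complex.norm_real, Real.norm_of_nonneg (by linarith [f.le_one (x := ε⁻¹ • (z - l))])]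
    linarith [f.nonneg (x := ε⁻¹ • (z - l))]
  · intro z
    have hd : HasFDerivAt (fun z => (f (ε⁻¹ • (z - l)) : ℂ)) ((fderiv ℝ (fun z => (f z : ℂ)) (ε⁻¹ • (z - l))).comp (ε⁻¹ • ContinuousLinearMap.id ℝ ℂ)) z := by
      have h1 : HasFDerivAt (fun z : ℂ => ε⁻¹ • (z - l)) (ε⁻¹ • ContinuousLinearMap.id ℝ ℂ) z := ((hasFDerivAt_id z).sub_const l).const_smul ε⁻¹
      exact ((hfc.differentiable one_ne_zero) _).hasFDerivAt.comp z h1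
    have hb : ∀ v : ℂ, ‖v‖ = 1 → ‖fderiv ℝ (fun z => (f (ε⁻¹ • (z - l)) : ℂ)) z v‖ ≤ C / ε := by
      intro v hv
      rw [hd.fderiv]
      simp only [ContinuousLinearMap.comp_apply, ContinuousLinearMap.smul_apply, ContinuousLinearMap.id_apply, map_smul, norm_smul, norm_inv, Real.norm_of_nonneg hε.le]
      rw [div_eq_inv_mul]
      gcongr
      exact (ContinuousLinearMap.le_opNorm _ _).trans (by rw [hv, mul_one]; exact hC _)
    rw [p7d, norm_smul]
    have h1 := hb 1 (by simp)
    have h2 := hb Complex.I (by simp)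
    have h3 := norm_add_le (fderiv ℝ (fun z => (f (ε⁻¹ • (z - l)) : ℂ)) z 1) (Complex.I • fderiv ℝ (fun z => (f (ε⁻¹ • (z - l)) : ℂ)) z Complex.I)
    rw [norm_smul Complex.I, Complex.norm_I, one_mul] at h3
    have : ‖(1 / 2 : ℂ)‖ = 1 / 2 := by simp
    rw [this]
    linarith
  · intro z hz'
    refine (p7_congr ?_).trans (p7_const (0:ℂ) z)
    have : ∀ᶠ y in 𝓝 z, 2 * ε < ‖y - l‖ := by
      refine ContinuousAt.eventually_lt continuousAt_const (by fun_prop) ?_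
      rw [mem_ball_iff_norm, not_lt] at hz'
      linarith
    filter_upwards [this] with y hy using hz y hy.le

section
variable {E : Type*} [NormedAddCommGroup E] [NormedSpace ℂ E]

lemma p7_mul {s : ℂ → ℂ} {F : ℂ → E} {z : ℂ} (hs : DifferentiableAt ℝ s z) (hF : DifferentiableAt ℂ F z) :
    p7d (fun z => s z • F z) z = p7d s z • F z := by
  have h1 := hs.hasFDerivAt.smul (hF.hasFDerivAt.restrictScalars ℝ)
  rw [p7d, (show HasFDerivAt (fun z => s z • F z) _ z from h1).fderiv, p7d]
  have h2 : fderiv ℂ F z Complex.I = Complex.I • fderiv ℂ F z 1 := by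
    rw [← map_smul, smul_eq_mul, mul_one]
  simp only [ContinuousLinearMap.add_apply, ContinuousLinearMap.smul_apply, ContinuousLinearMap.coe_restrictScalars', ContinuousLinearMap.smulRight_apply, h2, smul_eq_mul]
  have h3 : (Complex.I * Complex.I : ℂ) = -1 := Complex.I_mul_I
  simp only [smul_add, smul_smul, add_smul, mul_add]
  have h4 : (1 / 2 * (Complex.I * (s z * Complex.I)) : ℂ) = - (1 / 2 * s z) := by linear_combination (1/2) * s z * h3
  rw [h4]
  module

lemma p7_cutgreen [CompleteSpace E] {Ω U : Set ℂ} {γ κ : ℝ → ℂ} {L : ℝ} (h : P1D (frontier Ω) γ κ L) (ho : IsOpen Ω)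
    (hb : Bornology.IsBounded Ω)
    (hN : ∀ z ∈ Ω, p6N γ κ z = 1) (hN0 : ∀ z ∈ (closure Ω)ᶜ, p6N γ κ z = 0) (hU : IsOpen U) {l : ℂ} (hΩU : closure Ω \ {l} ⊆ U)
    {F : ℂ → E} (hF : DifferentiableOn ℂ F U) {C ε : ℝ} (hε : 0 < ε) {X : ℂ → ℂ} (hX : P7X l C ε X) :
    ∫ u, κ u • (1 - X (γ u)) • F (γ u) = (-(2 * Complex.I)) • ∫ z in Ω, p7d X z • F z := by
  set K := closure Ω \ Metric.ball l ε with hK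
  have hKc : IsCompact K := (hb.isCompact_closure).diff Metric.isOpen_ball
  have hKU : K ⊆ U := fun z hz => hΩU ⟨hz.1, fun hzl => hz.2 (by rw [Set.mem_singleton_iff.1 hzl]; exact Metric.mem_ball_self hε)⟩
  obtain ⟨K', hK'c, hKK', hK'U⟩ := exists_compact_between hKc hU hKU
  obtain ⟨ψ, hψ1, hψ0, -⟩ := exists_contMDiffMap_one_nhds_of_subset_interior (modelWithCornersSelf ℝ ℂ) (n := 1) hKc.isClosed hKK'
  have hψc : ContDiff ℝ 1 (fun z => (ψ z : ℂ)) := Complex.ofRealCLM.contDiff.comp ψ.contMDiff.contDiff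
  have hts : tsupport (fun z => (ψ z : ℂ)) ⊆ K' := by
    refine closure_minimal (fun z hz => ?_) hK'c.isClosed
    by_contra hzK; exact hz (by simp [hψ0 z hzK])
  have hψcs : HasCompactSupport (fun z => (ψ z : ℂ)) := HasCompactSupport.of_support_subset_isCompact hK'c (subset_closure.trans hts)
  have hψK : ∀ z ∈ K, ∀ᶠ y in 𝓝 z, (ψ y : ℂ) = 1 := fun z hz => by
    filter_upwards [nhds_le_nhdsSet hz hψ1] with y hy; simp [hy]
  set φ : ℂ → E := fun z => (ψ z : ℂ) • ((1 - X z) • F z) with hφ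
  have hφc : ContDiff ℝ 1 φ := by
    rw [contDiff_iff_contDiffAt]
    intro z
    by_cases hz : z ∈ tsupport (fun z => (ψ z : ℂ))
    · have hzU := hU.mem_nhds (hK'U (hts hz))
      have : ContDiffAt ℝ 1 F z := (hF.contDiffOn hU (n := 1)).contDiffAt hzU |>.restrict_scalars ℝ
      exact hψc.contDiffAt.smul ((contDiffAt_const.sub hX.cd.contDiffAt).smul this)
    · have : φ =ᶠ[𝓝 z] fun _ => 0 := by
        filter_upwards [notMem_tsupport_iff_eventuallyEq.1 hz] with y hy
        simp only [hφ, hy]; simp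
      exact contDiffAt_const.congr_of_eventuallyEq this
  have hφcs : HasCompactSupport φ := hψcs.smul_right
  have hg := p7_green h ho hN hN0 hφc hφcs
  have e1 : ∀ u, κ u • φ (γ u) = κ u • (1 - X (γ u)) • F (γ u) := by
    intro u
    by_cases hu : u ∈ Set.Ioo 0 L
    · have hfr : γ u ∈ frontier Ω := h.img ▸ ⟨u, ⟨hu.1.le, hu.2.le⟩, rfl⟩
      by_cases hn : ‖γ u - l‖ < ε
      · simp [hφ, hX.one _ hn]
      · have := (hψK (γ u) ⟨hfr.1, by rwa [mem_ball_iff_norm]⟩).self_of_nhds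
        simp only [hφ, this, one_smul]
    · simp [h.supp u hu]
  simp only [e1] at hg
  rw [hg, neg_smul, ← smul_neg, ← integral_neg]
  congr 1
  refine setIntegral_congr_fun ho.measurableSet fun z hz => ?_
  by_cases hn : ‖z - l‖ < ε
  · have hev : ∀ᶠ y in 𝓝 z, ‖y - l‖ < ε := ContinuousAt.eventually_lt (by fun_prop) continuousAt_const hn
    have h1 : p7d φ z = 0 := by
      rw [← p7_const (0:E) z]; refine p7_congr ?_
      filter_upwards [hev] with y hy; simp [hφ, hX.one _ hy]
    have h2 : p7d X z = 0 := by
      rw [← p7_const (1:ℂ) z]; refine p7_congr ?_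
      filter_upwards [hev] with y hy using hX.one _ hy
    rw [h1, h2]; simp
  · have hzK : z ∈ K := ⟨subset_closure hz, by rwa [mem_ball_iff_norm]⟩
    have h1 : p7d φ z = p7d (fun z => (1 - X z) • F z) z := by
      refine p7_congr ?_
      filter_upwards [hψK z hzK] with y hy; simp only [hφ, hy, one_smul]
    have hXd := hX.cd.differentiable one_ne_zero z
    rw [h1, p7_mul (hXd.const_sub 1) (hF.differentiableAt (hU.mem_nhds (hKU hzK))), ← neg_smul]
    congr 1
    rw [p7d, p7d, fderiv_const_sub]
    simp only [ContinuousLinearMap.neg_apply]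
    module
end

section
variable {E : Type*} [NormedAddCommGroup E] [NormedSpace ℂ E]

structure P8S (Ω : Set ℂ) (l : ℂ) (γ κ : ℝ → ℂ) (L : ℝ) : Prop where
  d : P1D (frontier Ω) γ κ L
  z : γ 0 = l
  o : IsOpen Ω
  b : Bornology.IsBounded Ω
  i : ∀ z ∈ Ω, p6N γ κ z = 1
  e : ∀ z ∈ (closure Ω)ᶜ, p6N γ κ z = 0

lemma P8S.mem {Ω : Set ℂ} {l : ℂ} {γ κ : ℝ → ℂ} {L : ℝ} (h : P8S Ω l γ κ L) {u : ℝ} (hu : u ∈ Set.Ioo 0 L) :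
    γ u ∈ frontier Ω \ {l} := by
  refine ⟨by rw [← h.d.img]; exact ⟨u, ⟨hu.1.le, hu.2.le⟩, rfl⟩, fun he => ?_⟩
  have he : γ u = γ 0 := by rw [h.z]; exact he
  exact hu.1.ne' (h.d.inj ⟨hu.1.le, hu.2⟩ ⟨le_rfl, h.d.pos⟩ he)

lemma P8S.nl {Ω : Set ℂ} {l : ℂ} {γ κ : ℝ → ℂ} {L : ℝ} (h : P8S Ω l γ κ L) : l ∈ frontier Ω := by
  rw [← h.d.img]; exact ⟨0, ⟨le_rfl, h.d.pos.le⟩, h.z⟩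

lemma P8S.fr {Ω : Set ℂ} {l : ℂ} {γ κ : ℝ → ℂ} {L : ℝ} (h : P8S Ω l γ κ L) {w : ℂ} (hw : w ∈ frontier Ω) : w ∉ Ω :=
  fun hw' => Set.disjoint_left.1 h.o.frontier_eq.subset.disjoint_compl_right hw (by
    simp only [Set.mem_compl_iff, Set.mem_diff, not_and, not_not]; exact fun _ => hw') 

lemma p8_meas {Ω : Set ℂ} {l : ℂ} {γ κ : ℝ → ℂ} {L : ℝ} (h : P8S Ω l γ κ L) {F : ℂ → E}
    (hF : ContinuousOn F (frontier Ω \ {l})) : AEStronglyMeasurable (fun u => F (γ u)) (volume.restrict (Set.Ioo 0 L)) :=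
  (hF.comp h.d.lip.continuous.continuousOn (fun _ hu => h.mem hu)).aestronglyMeasurable measurableSet_Ioo

lemma p8_io {Ω : Set ℂ} {l : ℂ} {γ κ : ℝ → ℂ} {L : ℝ} (h : P8S Ω l γ κ L) (G : ℝ → E) :
    ∫ u, κ u • G u = ∫ u in Set.Ioo 0 L, κ u • G u := by
  rw [setIntegral_eq_integral_of_forall_compl_eq_zero]
  intro u hu; rw [h.d.supp u hu, zero_smul]

lemma p8_int {Ω : Set ℂ} {l : ℂ} {γ κ : ℝ → ℂ} {L : ℝ} (h : P8S Ω l γ κ L) {F : ℂ → E}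
    (hF : ContinuousOn F (frontier Ω \ {l})) {M : ℝ} (hM : ∀ z ∈ frontier Ω \ {l}, ‖F z‖ ≤ M) :
    Integrable (fun u => κ u • F (γ u)) := by
  have : IntegrableOn (fun u => κ u • F (γ u)) (Set.Ioo 0 L) := by
    refine IntegrableOn.of_bound (by simp) (h.d.meas.aestronglyMeasurable.smul (p8_meas h hF)) M ?_
    filter_upwards [ae_restrict_mem measurableSet_Ioo] with u hu
    rw [norm_smul]
    nlinarith [h.d.bd u, hM _ (h.mem hu), norm_nonneg (F (γ u)), norm_nonneg (κ u)]
  refine this.integrable_of_forall_notMem_eq_zero fun u hu => ?_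
  rw [h.d.supp u hu, zero_smul]

lemma p8_lim {Ω : Set ℂ} {l : ℂ} {γ κ : ℝ → ℂ} {L : ℝ} (h : P8S Ω l γ κ L) {F : ℂ → E}
    (hF : ContinuousOn F (frontier Ω \ {l})) {M : ℝ} (hM : ∀ z ∈ frontier Ω \ {l}, ‖F z‖ ≤ M)
    {C : ℝ} {X : ℝ → ℂ → ℂ} (hX : ∀ ε > 0, P7X l C ε (X ε)) :
    Tendsto (fun ε => ∫ u, κ u • (1 - X ε (γ u)) • F (γ u)) (𝓝[>] 0) (𝓝 (∫ u, κ u • F (γ u))) := by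
  have hi := p8_int h hF hM
  refine tendsto_integral_filter_of_dominated_convergence (fun u => ‖κ u • F (γ u)‖) ?_ ?_ hi.norm ?_
  · filter_upwards [self_mem_nhdsWithin] with ε hε
    have : (fun u => κ u • (1 - X ε (γ u)) • F (γ u)) = fun u => (1 - X ε (γ u)) • κ u • F (γ u) := by
      funext u; rw [smul_comm]
    rw [this]
    refine AEStronglyMeasurable.smul (Continuous.aestronglyMeasurable ?_) hi.aestronglyMeasurable
    exact continuous_const.sub ((hX ε hε).cd.continuous.comp h.d.lip.continuous)
  · filter_upwards [self_mem_nhdsWithin] with ε hε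
    refine Eventually.of_forall fun u => ?_
    rw [smul_comm, norm_smul]
    exact mul_le_of_le_one_left (norm_nonneg _) ((hX ε hε).le _)
  · refine Eventually.of_forall fun u => ?_
    by_cases hu : u ∈ Set.Ioo 0 L
    · have hne := (h.mem hu).2
      have hp : 0 < ‖γ u - l‖ := norm_pos_iff.2 (sub_ne_zero.2 hne)
      refine tendsto_const_nhds.congr' ?_
      filter_upwards [Ioo_mem_nhdsGT (half_pos hp)] with ε hε
      rw [(hX ε hε.1).zero _ (by linarith [hε.2])]; simp
    · simp [h.d.supp u hu]

lemma p8_sm {l : ℂ} {C ε M : ℝ} (hM : 0 ≤ M) (hε : 0 < ε) {X : ℂ → ℂ} (hX : P7X l C ε X) {D : Set ℂ} {F : ℂ → E} (hD : MeasurableSet D)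
    (hF : ∀ z ∈ D, z ≠ l → ‖F z‖ ≤ M) : ‖∫ z in D, p7d X z • F z‖ ≤ 9 * π * C * M * ε := by
  have h0 : 0 ≤ C / ε := (norm_nonneg _).trans (hX.dle 0)
  have hl : p7d X l = 0 := by
    have : X =ᶠ[𝓝 l] fun _ => 1 := by
      filter_upwards [Metric.ball_mem_nhds l hε] with z hz
      exact hX.one z (by rwa [mem_ball_iff_norm] at hz)
    rw [p7_congr this, p7_const]
  rw [setIntegral_eq_of_subset_of_forall_diff_eq_zero (s := D ∩ Metric.ball l (3 * ε)) hD Set.inter_subset_left]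
  · refine (norm_setIntegral_le_of_norm_le_const (C := C / ε * M) ?_ ?_).trans ?_
    · exact (measure_mono Set.inter_subset_right).trans_lt measure_ball_lt_top
    · intro z hz
      by_cases hzl : z = l
      · rw [hzl, hl, zero_smul, norm_zero]; positivity
      rw [norm_smul]
      have := hX.dle z
      have := hF z hz.1 hzl
      gcongr
    · have : volume.real (D ∩ Metric.ball l (3 * ε)) ≤ π * (3 * ε) ^ 2 := by
        refine (measureReal_mono Set.inter_subset_right measure_ball_lt_top.ne).trans ?_
        rw [Measure.real, Complex.volume_ball]
        simp [hε.le, mul_comm]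
      calc _ ≤ C / ε * M * (π * (3 * ε) ^ 2) := by gcongr
        _ = _ := by field_simp; ring
  · intro z hz
    rw [hX.d0 z (fun hb => hz.2 ⟨hz.1, hb⟩), zero_smul]

/-- bound for the area Cauchy transform -/
lemma p8_k {ε B : ℝ} {l : ℂ} (hB : 0 ≤ B) (hε : 0 < ε) {G : ℂ → ℂ} (hG : ∀ z, ‖G z‖ ≤ B) (h0 : ∀ z ∉ Metric.ball l (3 * ε), G z = 0) (w : ℂ) :
    ‖∫ z, (w - z)⁻¹ * G z‖ ≤ B * (9 * π * ε) ∧ (6 * ε ≤ ‖w - l‖ → ‖∫ z, (w - z)⁻¹ * G z‖ ≤ B * ((2 / ‖w - l‖) * (9 * π * ε ^ 2))) := by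
  rw [← setIntegral_eq_integral_of_forall_compl_eq_zero (s := Metric.ball l (3 * ε)) (fun z hz => by rw [h0 z hz, mul_zero])]
  constructor
  · obtain ⟨h1, h2⟩ := p7_ker l w (ρ := 3 * ε) (by positivity)
    refine (norm_integral_le_of_norm_le (h1.const_mul B) (Eventually.of_forall fun z => ?_)).trans ?_
    · rw [norm_mul, norm_inv, norm_sub_rev, mul_comm]; gcongr; exact hG z
    · rw [integral_const_mul]; gcongr; linarith
  · intro hw
    refine (norm_setIntegral_le_of_norm_le_const (C := 2 / ‖w - l‖ * B) measure_ball_lt_top ?_).trans ?_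
    · intro z hz
      rw [mem_ball_iff_norm] at hz
      have hp : 0 < ‖w - l‖ := by linarith
      have : ‖w - l‖ / 2 ≤ ‖w - z‖ := by
        have := norm_sub_le_norm_sub_add_norm_sub w z l
        linarith
      rw [norm_mul, norm_inv]
      have h3 : ‖w - z‖⁻¹ ≤ 2 / ‖w - l‖ := by
        rw [← inv_div]; gcongr
      have := hG z
      gcongr
    · rw [Measure.real, Complex.volume_ball]
      simp [hε.le]
      apply le_of_eq; ring
end

section
variable {E : Type*} [NormedAddCommGroup E] [NormedSpace ℂ E]

lemma p8_dint {Ω U : Set ℂ} {l : ℂ} (hb : Bornology.IsBounded Ω) (hU : closure Ω \ {l} ⊆ U)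
    {F : ℂ → E} (hF : ContinuousOn F U) {C ε : ℝ} (hε : 0 < ε) {X : ℂ → ℂ} (hX : P7X l C ε X) :
    IntegrableOn (fun z => p7d X z • F z) Ω := by
  have hK : IsCompact (closure Ω \ Metric.ball l ε) := hb.isCompact_closure.diff Metric.isOpen_ball
  have hKU : closure Ω \ Metric.ball l ε ⊆ U := fun z hz => hU ⟨hz.1, fun hzl => hz.2 (by rw [Set.mem_singleton_iff.1 hzl]; exact Metric.mem_ball_self hε)⟩
  have h1 : IntegrableOn (fun z => p7d X z • F z) (closure Ω \ Metric.ball l ε) :=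
    ContinuousOn.integrableOn_compact hK ((p7_cont hX.cd).continuousOn.smul (hF.mono hKU))
  have h2 : IntegrableOn (fun z => p7d X z • F z) (Metric.ball l ε) := by
    refine (integrableOn_zero (ε' := E)).congr_fun (fun z hz => ?_) measurableSet_ball
    have : X =ᶠ[𝓝 z] fun _ => 1 := by
      filter_upwards [Metric.isOpen_ball.mem_nhds hz] with y hy
      exact hX.one y (by rwa [mem_ball_iff_norm] at hy)
    simp only [p7_congr this, p7_const, zero_smul]
  refine (h1.union h2).mono_set fun z hz => ?_
  by_cases hzb : z ∈ Metric.ball l ε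
  · exact Or.inr hzb
  · exact Or.inl ⟨subset_closure hz, hzb⟩

lemma p8_tz {v : ℝ → E} {K : ℝ} (hv : ∀ ε > 0, ‖v ε‖ ≤ K * ε) : Tendsto v (𝓝[>] 0) (𝓝 0) := by
  refine squeeze_zero_norm' (a := fun ε => K * ε) ?_ ?_
  · filter_upwards [self_mem_nhdsWithin] with ε hε using hv ε hε
  · have : Tendsto (fun ε : ℝ => K * ε) (𝓝 0) (𝓝 (K * 0)) := by
      apply Continuous.tendsto; fun_prop
    rw [mul_zero] at this
    exact this.mono_left nhdsWithin_le_nhds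

lemma p8_clo {Ω U : Set ℂ} {l : ℂ} {γ κ : ℝ → ℂ} {L : ℝ} (h : P8S Ω l γ κ L) (hU : closure Ω \ {l} ⊆ U) : Ω ⊆ U :=
  fun z hz => hU ⟨subset_closure hz, fun hzl => h.fr h.nl (by rwa [← Set.mem_singleton_iff.1 hzl])⟩

lemma p8_zero [CompleteSpace E] {Ω U : Set ℂ} {l : ℂ} {γ κ : ℝ → ℂ} {L : ℝ} (h : P8S Ω l γ κ L) (hUo : IsOpen U) (hU : closure Ω \ {l} ⊆ U)
    {F : ℂ → E} (hF : DifferentiableOn ℂ F U) {M : ℝ} (hM0 : 0 ≤ M) (hM : ∀ z ∈ closure Ω \ {l}, ‖F z‖ ≤ M) :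
    ∫ u, κ u • F (γ u) = 0 := by
  obtain ⟨C, hC, X, hX⟩ := p7_cut l
  have hs : frontier Ω \ {l} ⊆ closure Ω \ {l} := Set.diff_subset_diff_left frontier_subset_closure
  refine tendsto_nhds_unique (p8_lim h (hF.continuousOn.mono (hs.trans hU)) (fun z hz => hM z (hs hz)) hX) ?_
  refine p8_tz (K := 2 * (9 * π * C * M)) fun ε hε => ?_
  rw [p7_cutgreen h.d h.o h.b h.i h.e hUo hU hF hε (hX ε hε), norm_smul]
  have := p8_sm hM0 hε (hX ε hε) h.o.measurableSet (F := F) (fun z hz hzl => hM z ⟨subset_closure hz, hzl⟩)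
  simp only [norm_neg, norm_mul, Complex.norm_ofNat, Complex.norm_I]
  linarith

lemma p8_I [CompleteSpace E] {Ω Ω₀ U : Set ℂ} {l : ℂ} {γ κ γ₀ κ₀ : ℝ → ℂ} {L L₀ : ℝ} (h : P8S Ω l γ κ L) (h0 : P8S Ω₀ l γ₀ κ₀ L₀)
    (hs : closure Ω \ {l} ⊆ Ω₀) (hUo : IsOpen U) (hU : closure Ω₀ \ {l} ⊆ U)
    {F : ℂ → E} (hF : DifferentiableOn ℂ F U) {M : ℝ} (hM0 : 0 ≤ M) (hM : ∀ z ∈ closure Ω₀ \ ({l} ∪ Ω), ‖F z‖ ≤ M) :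
    ∫ u, κ u • F (γ u) = ∫ u, κ₀ u • F (γ₀ u) := by
  obtain ⟨C, hC, X, hX⟩ := p7_cut l
  have hsub := p8_clo h hs
  have hU1 : closure Ω \ {l} ⊆ U := fun z hz => hU ⟨subset_closure (hs hz), hz.2⟩
  have hb1 : ∀ z ∈ frontier Ω \ {l}, ‖F z‖ ≤ M := fun z hz => hM z ⟨subset_closure (hs ⟨hz.1.1, hz.2⟩), by
    rintro (h1 | h1)
    · exact hz.2 h1
    · exact h.fr hz.1 h1⟩
  have hb0 : ∀ z ∈ frontier Ω₀ \ {l}, ‖F z‖ ≤ M := fun z hz => hM z ⟨hz.1.1, by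
    rintro (h1 | h1)
    · exact hz.2 h1
    · exact h0.fr hz.1 (hsub h1)⟩
  have t1 := p8_lim h (hF.continuousOn.mono (fun z hz => hU1 ⟨hz.1.1, hz.2⟩)) hb1 hX
  have t0 := p8_lim h0 (hF.continuousOn.mono (fun z hz => hU ⟨hz.1.1, hz.2⟩)) hb0 hX
  refine sub_eq_zero.1 (tendsto_nhds_unique (t1.sub t0) ?_)
  refine p8_tz (K := 2 * (9 * π * C * M)) fun ε hε => ?_
  rw [p7_cutgreen h.d h.o h.b h.i h.e hUo hU1 hF hε (hX ε hε), p7_cutgreen h0.d h0.o h0.b h0.i h0.e hUo hU hF hε (hX ε hε),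
    ← smul_sub, norm_smul, norm_sub_rev, ← integral_diff h.o.measurableSet (p8_dint h0.b hU hF.continuousOn hε (hX ε hε)) hsub]
  have := p8_sm hM0 hε (hX ε hε) (h0.o.measurableSet.diff h.o.measurableSet) (F := F) (fun z hz hzl => hM z ⟨subset_closure hz.1, by
    rintro (h1 | h1)
    · exact hzl h1
    · exact hz.2 h1⟩)
  simp only [norm_neg, norm_mul, Complex.norm_ofNat, Complex.norm_I]
  linarith

lemma p8_II {Ω U : Set ℂ} {l : ℂ} {γ κ : ℝ → ℂ} {L : ℝ} (h : P8S Ω l γ κ L) (hUo : IsOpen U) (hU : closure Ω \ {l} ⊆ U)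
    {f : ℂ → ℂ} (hF : DifferentiableOn ℂ f U) {M : ℝ} (hM : ∀ z ∈ U, ‖f z‖ ≤ M) {w : ℂ} (hw : w ∈ Ω) :
    ∫ u, κ u • ((γ u - w)⁻¹ * f (γ u)) = 2 * π * Complex.I * f w := by
  have hwU := p8_clo h hU hw
  have hd : DifferentiableOn ℂ (dslope f w) U := (Complex.differentiableOn_dslope (hUo.mem_nhds hwU)).2 hF
  obtain ⟨r, hr, hrU⟩ := Metric.nhds_basis_closedBall.mem_iff.1 (hUo.mem_nhds hwU)
  obtain ⟨K, hK⟩ := (isCompact_closedBall w r).exists_bound_of_continuousOn (hd.continuousOn.mono hrU)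
  have hM0 : 0 ≤ M := (norm_nonneg _).trans (hM w hwU)
  have hK0 : 0 ≤ K := (norm_nonneg _).trans (hK w (Metric.mem_closedBall_self hr.le))
  have hwf : ∀ z ∈ frontier Ω, z ≠ w := fun z hz hzw => h.fr hz (by rwa [hzw])
  have hbd : ∀ z ∈ closure Ω \ {l}, ‖dslope f w z‖ ≤ K + r⁻¹ * (M + M) := fun z hz => by
    by_cases hzb : z ∈ Metric.closedBall w r
    · have := hK z hzb
      have : 0 ≤ r⁻¹ * (M + M) := by positivity
      linarith
    · rw [mem_closedBall_iff_norm, not_le] at hzb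
      have hne : z ≠ w := by rintro rfl; simp at hzb; linarith
      rw [dslope_of_ne _ hne, slope_def_module, norm_smul, norm_inv]
      have h1 : ‖f z - f w‖ ≤ M + M := (norm_sub_le _ _).trans (add_le_add (hM z (hU hz)) (hM w hwU))
      have h2 : ‖z - w‖⁻¹ * ‖f z - f w‖ ≤ r⁻¹ * (M + M) := by gcongr
      linarith
  have hz := p8_zero h hUo hU hd (by positivity) hbd
  have hN := h.i w hw
  rw [p6N] at hN
  have hN : ∫ u, κ u / (γ u - w) = 2 * π * Complex.I := by
    have : (2 * π * Complex.I : ℂ) ≠ 0 := Complex.two_pi_I_ne_zero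
    field_simp at hN
    linear_combination hN
  have he : ∀ u, κ u • ((γ u - w)⁻¹ * f (γ u)) = κ u • dslope f w (γ u) + κ u / (γ u - w) * f w := by
    intro u
    by_cases hu : u ∈ Set.Ioo 0 L
    · have hne := hwf _ (h.mem hu).1
      have := sub_ne_zero.2 hne
      rw [dslope_of_ne _ hne, slope_def_field, smul_eq_mul, smul_eq_mul]
      field_simp
      ring
    · simp [h.d.supp u hu]
  have hs : frontier Ω \ {l} ⊆ closure Ω \ {l} := Set.diff_subset_diff_left frontier_subset_closure
  have hi1 : Integrable (fun u => κ u • dslope f w (γ u)) := p8_int h (hd.continuousOn.mono (hs.trans hU)) (fun z hz => hbd z (hs hz))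
  have hi2 : Integrable (fun u => κ u / (γ u - w)) := by
    by_contra hc
    rw [integral_undef hc] at hN
    exact Complex.two_pi_I_ne_zero hN.symm
  simp_rw [he]
  rw [integral_add hi1 (hi2.mul_const _), hz, integral_mul_const, hN, zero_add]
end

section
variable {E : Type*} [NormedAddCommGroup E] [NormedSpace ℂ E]

lemma p8_III [CompleteSpace E] {Ω Ω₀ : Set ℂ} {l : ℂ} {γ κ γ₀ κ₀ : ℝ → ℂ} {L L₀ : ℝ} (h : P8S Ω l γ κ L) (h0 : P8S Ω₀ l γ₀ κ₀ L₀)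
    (hs : closure Ω \ {l} ⊆ Ω₀) {f : ℂ → ℂ} (hf : DifferentiableOn ℂ f Ω₀) {M M₁ M₂ : ℝ} (hM0 : 0 ≤ M) (hM : ∀ z ∈ Ω₀, ‖f z‖ ≤ M)
    {G : ℂ → E} (hG : ContinuousOn G (frontier Ω₀ \ {l})) (hM1 : ∀ z ∈ frontier Ω₀ \ {l}, ‖G z‖ ≤ M₁)
    {Q : ℂ → E} (hQ : ∀ z, Q z = ∫ u in Set.Ioo 0 L₀, (γ₀ u - z)⁻¹ • κ₀ u • G (γ₀ u))
    (hM2 : ∀ z ∈ frontier Ω \ {l}, ‖f z • Q z‖ ≤ M₂) :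
    ∫ u, κ u • f (γ u) • Q (γ u) = 0 := by
  obtain ⟨C, hC, X, hX⟩ := p7_cut l
  have hi := p8_int h0 hG hM1
  have hsub := p8_clo h hs
  have hQd : DifferentiableOn ℂ Q Ω₀ := fun z hz => by
    obtain ⟨d, hd, hdz⟩ := Metric.isOpen_iff.1 h0.o z hz
    have : Q = fun z => ∫ u in Set.Ioo 0 L₀, (γ₀ u - z)⁻¹ • κ₀ u • G (γ₀ u) := funext hQ
    rw [this]
    refine (p4_cauchyType hi.integrableOn h0.d.lip.continuous.aemeasurable hd ?_).differentiableWithinAt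
    filter_upwards [ae_restrict_mem measurableSet_Ioo] with u hu
    by_contra hlt
    push Not at hlt
    exact h0.fr (h0.mem hu).1 (hdz (by rwa [mem_ball_iff_norm]))
  have hfr : frontier Ω \ {l} ⊆ Ω₀ := fun z hz => hs ⟨hz.1.1, hz.2⟩
  have t := p8_lim h (F := fun z => f z • Q z) ((hf.smul hQd).continuousOn.mono hfr) hM2 hX
  refine tendsto_nhds_unique t ?_
  set k : ℝ → ℂ → ℂ := fun ε => Ω.indicator (fun z => p7d (X ε) z * f z) with hk
  have hkm : ∀ ε > 0, Measurable (k ε) := fun ε hε => by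
    classical
    rw [hk]
    simp only [← Set.piecewise_eq_indicator]
    exact ContinuousOn.measurable_piecewise ((p7_cont (hX ε hε).cd).continuousOn.mul (hf.continuousOn.mono hsub))
      continuousOn_const h.o.measurableSet
  have hkb : ∀ ε > 0, ∀ z, ‖k ε z‖ ≤ C / ε * M := fun ε hε z => by
    rw [hk]
    by_cases hz : z ∈ Ω
    · simp only [Set.indicator_of_mem hz]
      rw [norm_mul]
      have := (hX ε hε).dle z
      have := hM z (hsub hz)
      gcongr
    · simp only [Set.indicator_of_notMem hz, norm_zero]; positivity
  have hk0 : ∀ ε > 0, ∀ z ∉ Metric.ball l (3 * ε), k ε z = 0 := fun ε hε z hz => by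
    rw [hk]
    by_cases hz' : z ∈ Ω
    · simp only [Set.indicator_of_mem hz', (hX ε hε).d0 z hz, zero_mul]
    · simp only [Set.indicator_of_notMem hz']
  have hM1' : ∀ u ∈ Set.Ioo 0 L₀, ‖κ₀ u • G (γ₀ u)‖ ≤ M₁ := fun u hu => by
    rw [norm_smul]
    nlinarith [h0.d.bd u, hM1 _ (h0.mem hu), norm_nonneg (G (γ₀ u)), norm_nonneg (κ₀ u)]
  have key : ∀ ε > 0, ∫ u, κ u • (1 - X ε (γ u)) • f (γ u) • Q (γ u) =
      (-(2 * Complex.I)) • ∫ u in Set.Ioo 0 L₀, (∫ z, (γ₀ u - z)⁻¹ * k ε z) • κ₀ u • G (γ₀ u) := fun ε hε => by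
    rw [p7_cutgreen h.d h.o h.b h.i h.e h0.o hs (F := fun z => f z • Q z) (hf.smul hQd) hε (hX ε hε)]
    congr 1
    have hfub := p7_fub h0.d (P := fun u z => k ε z • κ₀ u • G (γ₀ u)) (C := C / ε * M * M₁) (ρ := 3 * ε) (a := l) (by positivity) ?_ ?_ ?_
    · have e1 : ∫ z in Ω, p7d (X ε) z • f z • Q z = ∫ z, ∫ u in Set.Ioo 0 L₀, (γ₀ u - z)⁻¹ • k ε z • κ₀ u • G (γ₀ u) := by
        rw [← integral_indicator h.o.measurableSet]
        congr 1; funext z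
        simp_rw [smul_comm _ (k ε z)]
        rw [integral_smul, ← hQ, hk]
        by_cases hz : z ∈ Ω
        · simp only [Set.indicator_of_mem hz, mul_smul]
        · simp only [Set.indicator_of_notMem hz, zero_smul]
      rw [e1, hfub]
      congr 1; funext u
      rw [← integral_smul_const]
      simp only [mul_smul]
    · refine AEStronglyMeasurable.smul (((hkm ε hε).comp measurable_snd).aestronglyMeasurable) ?_
      exact (hi.aestronglyMeasurable.restrict (s := Set.Ioo 0 L₀)).comp_fst
    · intro u hu z
      rw [norm_smul]
      have := hkb ε hε z
      have := hM1' u hu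
      have := (norm_nonneg _).trans (hkb ε hε z)
      gcongr
    · intro u z hz
      rw [hk0 ε hε z hz, zero_smul]
  have hlim : Tendsto (fun ε => ∫ u in Set.Ioo 0 L₀, (∫ z, (γ₀ u - z)⁻¹ * k ε z) • κ₀ u • G (γ₀ u)) (𝓝[>] 0) (𝓝 (∫ u in Set.Ioo 0 L₀, (0:E))) := by
    refine tendsto_integral_filter_of_dominated_convergence (fun u => (C * M * (9 * π)) * ‖κ₀ u • G (γ₀ u)‖) ?_ ?_ (hi.integrableOn.norm.const_mul _) ?_
    · filter_upwards [self_mem_nhdsWithin] with ε hε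
      refine AEStronglyMeasurable.smul (StronglyMeasurable.aestronglyMeasurable ?_) hi.aestronglyMeasurable.restrict
      refine StronglyMeasurable.integral_prod_right (f := fun u z => (γ₀ u - z)⁻¹ * k ε z) (Measurable.stronglyMeasurable ?_)
      have h1 := h0.d.lip.continuous
      have h2 := hkm ε hε
      unfold Function.uncurry
      fun_prop
    · filter_upwards [self_mem_nhdsWithin] with ε (hε : 0 < ε)
      refine Eventually.of_forall fun u => ?_
      rw [norm_smul]
      have := (p8_k (by positivity) hε (hkb ε hε) (hk0 ε hε) (γ₀ u)).1
      have e : C / ε * M * (9 * π * ε) = C * M * (9 * π) := by field_simp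
      rw [e] at this
      gcongr
    · filter_upwards [ae_restrict_mem measurableSet_Ioo] with u hu
      have hp : 0 < ‖γ₀ u - l‖ := norm_pos_iff.2 (sub_ne_zero.2 (h0.mem hu).2)
      rw [← zero_smul ℂ (κ₀ u • G (γ₀ u))]
      refine Tendsto.smul_const ?_ _
      refine squeeze_zero_norm' (a := fun ε => (C * M * (2 / ‖γ₀ u - l‖ * (9 * π))) * ε) ?_ ?_
      · filter_upwards [Ioo_mem_nhdsGT (show 0 < ‖γ₀ u - l‖ / 6 by positivity)] with ε hε
        refine ((p8_k (by have := hε.1; positivity) hε.1 (hkb ε hε.1) (hk0 ε hε.1) (γ₀ u)).2 (by linarith [hε.2])).trans (le_of_eq ?_)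
        have := hε.1.ne'
        field_simp
      · have : Tendsto (fun ε : ℝ => (C * M * (2 / ‖γ₀ u - l‖ * (9 * π))) * ε) (𝓝 0) (𝓝 ((C * M * (2 / ‖γ₀ u - l‖ * (9 * π))) * 0)) := by
          apply Continuous.tendsto; fun_prop
        rw [mul_zero] at this
        exact this.mono_left nhdsWithin_le_nhds
  rw [integral_zero] at hlim
  have := hlim.const_smul (-(2 * Complex.I))
  rw [smul_zero] at this
  refine this.congr' ?_
  filter_upwards [self_mem_nhdsWithin] with ε hε
  exact (key ε hε).symm
end

section
variable {A : Type*} [NormedRing A] [NormedAlgebra ℂ A] [CompleteSpace A]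

lemma p8_res {T : A} {z w : ℂ} (hz : z ∈ resolventSet ℂ T) (hw : w ∈ resolventSet ℂ T) (hne : z ≠ w) :
    resolvent T w * resolvent T z = (z - w)⁻¹ • (resolvent T w - resolvent T z) := by
  have h1 : resolvent T z = Ring.inverse (algebraMap ℂ A z - T) := rfl
  have h2 : resolvent T w = Ring.inverse (algebraMap ℂ A w - T) := rfl
  have e1 := Ring.mul_inverse_cancel _ (spectrum.mem_resolventSet_iff.1 hz)
  have e2 := Ring.inverse_mul_cancel _ (spectrum.mem_resolventSet_iff.1 hw)
  rw [← h1] at e1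
  rw [← h2] at e2
  rw [eq_inv_smul_iff₀ (sub_ne_zero.2 hne)]
  have e3 : resolvent T w * ((algebraMap ℂ A z - T) - (algebraMap ℂ A w - T)) * resolvent T z = resolvent T w - resolvent T z := by
    rw [mul_sub, sub_mul, mul_assoc, e1, e2, mul_one, one_mul]
  rw [← e3, sub_sub_sub_cancel_right, ← map_sub, ← Algebra.commutes, mul_assoc, ← Algebra.smul_def]

lemma p8_mul {Ω Ω₀ U : Set ℂ} {l : ℂ} {γ κ γ₀ κ₀ : ℝ → ℂ} {L L₀ : ℝ} (h : P8S Ω l γ κ L) (h0 : P8S Ω₀ l γ₀ κ₀ L₀)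
    (hs : closure Ω \ {l} ⊆ Ω₀) (hUo : IsOpen U) (hU : closure Ω₀ \ {l} ⊆ U) (T : A) (hT : ∀ z ∈ U, z ∈ resolventSet ℂ T)
    {f₁ f₂ : ℂ → ℂ} (hf₁ : DifferentiableOn ℂ f₁ U) (hf₂ : DifferentiableOn ℂ f₂ U) {M : ℝ} (hM0 : 0 ≤ M)
    (hM₁ : ∀ z ∈ U, ‖f₁ z‖ ≤ M) (hM₂ : ∀ z ∈ U, ‖f₂ z‖ ≤ M)
    (hR₁ : ∀ z ∈ closure Ω₀ \ ({l} ∪ Ω), ‖f₁ z • resolvent T z‖ ≤ M)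
    (hR₂ : ∀ z ∈ closure Ω₀ \ ({l} ∪ Ω), ‖f₂ z • resolvent T z‖ ≤ M) :
    (∫ u, κ u • f₂ (γ u) • resolvent T (γ u)) * (∫ u, κ u • f₁ (γ u) • resolvent T (γ u)) =
      (2 * π * Complex.I : ℂ) • ∫ u, κ u • (f₁ (γ u) * f₂ (γ u)) • resolvent T (γ u) := by
  set R : ℂ → A := resolvent T with hR
  have hRd : DifferentiableOn ℂ R U := fun z hz =>
    (spectrum.hasDerivAt_resolvent (hT z hz)).differentiableAt.differentiableWithinAt
  have hsub := p8_clo h hs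
  have hΩU := p8_clo h0 hU
  have hfr0 : frontier Ω₀ \ {l} ⊆ U := fun z hz => hU ⟨hz.1.1, hz.2⟩
  have hfr : frontier Ω \ {l} ⊆ Ω₀ := fun z hz => hs ⟨hz.1.1, hz.2⟩
  have hcl : ∀ z ∈ frontier Ω \ {l}, z ∈ closure Ω₀ \ ({l} ∪ Ω) := fun z hz => ⟨subset_closure (hfr hz), by
    rintro (h1 | h1)
    · exact hz.2 h1
    · exact h.fr hz.1 h1⟩
  have hcl0 : ∀ z ∈ frontier Ω₀ \ {l}, z ∈ closure Ω₀ \ ({l} ∪ Ω) := fun z hz => ⟨hz.1.1, by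
    rintro (h1 | h1)
    · exact hz.2 h1
    · exact h0.fr hz.1 (hsub h1)⟩
  have hI := p8_I h h0 hs hUo hU (F := fun z => f₁ z • R z) (hf₁.smul hRd) hM0 hR₁
  have hi0 := p8_int h0 (F := fun z => f₁ z • R z) ((hf₁.smul hRd).continuousOn.mono hfr0) (fun z hz => hR₁ z (hcl0 z hz))
  set I₁ := ∫ u, κ u • f₁ (γ u) • R (γ u) with hI1
  set Q : ℂ → A := fun z => ∫ u in Set.Ioo 0 L₀, (γ₀ u - z)⁻¹ • κ₀ u • f₁ (γ₀ u) • R (γ₀ u) with hQ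
  have hRI : ∀ w ∈ Ω₀, R w * I₁ = (2 * π * Complex.I * f₁ w) • R w - Q w := fun w hw => by
    obtain ⟨d, hd, hdz⟩ := Metric.isOpen_iff.1 h0.o w hw
    have hdist : ∀ z ∈ frontier Ω₀ \ {l}, d ≤ ‖z - w‖ := fun z hz => by
      by_contra hlt
      push Not at hlt
      exact h0.fr hz.1 (hdz (by rwa [mem_ball_iff_norm]))
    have hne : ∀ z ∈ frontier Ω₀ \ {l}, z ≠ w := fun z hz hzw => h0.fr hz.1 (by rwa [hzw])
    have hinvc : ContinuousOn (fun z => (z - w)⁻¹) (frontier Ω₀ \ {l}) :=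
      (continuousOn_id.sub continuousOn_const).inv₀ fun z hz => sub_ne_zero.2 (hne z hz)
    have hinvb : ∀ z ∈ frontier Ω₀ \ {l}, ‖(z - w)⁻¹‖ ≤ d⁻¹ := fun z hz => by
      rw [norm_inv]; have := hdist z hz; gcongr
    have i1 : Integrable (fun u => κ₀ u • ((γ₀ u - w)⁻¹ * f₁ (γ₀ u))) :=
      p8_int h0 (F := fun z => (z - w)⁻¹ * f₁ z) (M := d⁻¹ * M) (hinvc.mul (hf₁.continuousOn.mono hfr0)) (fun z hz => by
        rw [norm_mul]
        have := hinvb z hz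
        have := hM₁ z (hfr0 hz)
        gcongr)
    have i2 : Integrable (fun u => κ₀ u • (γ₀ u - w)⁻¹ • f₁ (γ₀ u) • R (γ₀ u)) :=
      p8_int h0 (F := fun z => (z - w)⁻¹ • f₁ z • R z) (M := d⁻¹ * M) (hinvc.smul ((hf₁.smul hRd).continuousOn.mono hfr0)) (fun z hz => by
        rw [norm_smul]
        have := hinvb z hz
        have := hR₁ z (hcl0 z hz)
        gcongr)
    have e1 : R w * I₁ = ∫ u, ((κ₀ u • ((γ₀ u - w)⁻¹ * f₁ (γ₀ u))) • R w - κ₀ u • (γ₀ u - w)⁻¹ • f₁ (γ₀ u) • R (γ₀ u)) := by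
      rw [hI, ← integral_const_mul_of_integrable hi0]
      congr 1; funext u
      by_cases hu : u ∈ Set.Ioo 0 L₀
      · have hm := h0.mem hu
        rw [mul_smul_comm, mul_smul_comm, hR, p8_res (hT _ (hfr0 hm)) (hT _ (hΩU hw)) (hne _ hm), smul_eq_mul,
          smul_comm (γ₀ u - w)⁻¹ (f₁ (γ₀ u)), mul_smul, mul_comm (γ₀ u - w)⁻¹, mul_smul, ← smul_sub, ← smul_sub, ← smul_sub]
      · simp [h0.d.supp u hu]
    rw [e1, integral_sub (i1.smul_const _) i2, integral_smul_const, p8_II h0 hUo hU hf₁ hM₁ hw, hQ]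
    simp only
    rw [p8_io h0 (fun u => (γ₀ u - w)⁻¹ • f₁ (γ₀ u) • R (γ₀ u))]
    simp_rw [smul_comm (κ₀ _)]
  have hfQ : ∀ z ∈ frontier Ω \ {l}, f₂ z • Q z = (2 * π * Complex.I * f₁ z) • f₂ z • R z - (f₂ z • R z) * I₁ := fun z hz => by
    rw [smul_mul_assoc, hRI z (hfr hz), smul_sub, smul_comm]; abel
  have hfrU : frontier Ω \ {l} ⊆ U := hfr.trans hΩU
  have hfQb : ∀ z ∈ frontier Ω \ {l}, ‖f₂ z • Q z‖ ≤ 2 * π * M * M + M * ‖I₁‖ := fun z hz => by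
    rw [hfQ z hz]
    refine (norm_sub_le _ _).trans (add_le_add ?_ ((norm_mul_le _ _).trans ?_))
    · rw [norm_smul, norm_mul]
      have e : ‖(2 * π * Complex.I : ℂ)‖ = 2 * π := by simp [abs_of_pos Real.pi_pos]
      rw [e]
      have := hM₁ z (hfrU hz)
      have := hR₂ z (hcl z hz)
      gcongr
    · have := hR₂ z (hcl z hz)
      gcongr
  have hJ := p8_III h h0 hs (hf₂.mono hΩU) hM0 (fun z hz => hM₂ z (hΩU hz)) (G := fun z => f₁ z • R z)
    ((hf₁.smul hRd).continuousOn.mono hfr0) (fun z hz => hR₁ z (hcl0 z hz)) (Q := Q) (fun z => rfl) hfQb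
  have i2 := p8_int h (F := fun z => f₂ z • R z) ((hf₂.smul hRd).continuousOn.mono hfrU) (fun z hz => hR₂ z (hcl z hz))
  have i3 := p8_int h (F := fun z => (f₁ z * f₂ z) • R z) (M := M * M) (((hf₁.mul hf₂).smul hRd).continuousOn.mono hfrU) (fun z hz => by
    rw [mul_smul, norm_smul]
    have := hM₁ z (hfrU hz)
    have := hR₂ z (hcl z hz)
    gcongr)
  have e4 : ∀ u, κ u • f₂ (γ u) • Q (γ u) = (2 * π * Complex.I : ℂ) • κ u • (f₁ (γ u) * f₂ (γ u)) • R (γ u) - (κ u • f₂ (γ u) • R (γ u)) * I₁ := by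
    intro u
    by_cases hu : u ∈ Set.Ioo 0 L
    · rw [hfQ _ (h.mem hu), smul_sub, smul_mul_assoc (κ u), mul_smul, smul_comm (κ u), mul_smul (f₁ _), smul_comm (κ u)]
    · simp [h.d.supp u hu]
  simp_rw [e4] at hJ
  have i3' : Integrable (fun u => (2 * π * Complex.I : ℂ) • κ u • (f₁ (γ u) * f₂ (γ u)) • R (γ u)) := i3.smul (2 * π * Complex.I : ℂ)
  rw [integral_sub i3' (i2.mul_const _), integral_smul, integral_mul_const_of_integrable i2, sub_eq_zero] at hJ
  exact hJ.symm
end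

section
lemma p9_setup {Γ : ℝ → ℂ} {Ω : Set ℂ} {l : ℂ} (hc : ContinuousOn Γ (Set.Icc 0 1)) (hinj : Set.InjOn Γ (Set.Ico 0 1))
    (h0 : Γ 0 = l) (h1 : Γ 1 = l) (hr : eVariationOn Γ (Set.Icc 0 1) ≠ ⊤) (ho : IsOpen Ω) (hb : Bornology.IsBounded Ω)
    (hfr : frontier Ω = Γ '' Set.Icc 0 1)
    (hor : ∀ z ∈ Ω, (2 * π * Complex.I)⁻¹ * ∫ t in (0:ℝ)..1, deriv Γ t / (Γ t - z) = 1)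
    (E : Type*) [NormedAddCommGroup E] [NormedSpace ℂ E] :
    ∃ γ κ L, P8S Ω l γ κ L ∧ ∀ F : ℂ → E, ∫ t in (0:ℝ)..1, deriv Γ t • F (Γ t) = ∫ s, κ s • F (γ s) := by
  have h01 : Γ 0 = Γ 1 := by rw [h0, h1]
  obtain ⟨γ, κ, L, hd, hz, hC, hE⟩ := p1_exists hc hinj h01 hr E
  rw [← hfr] at hd
  have hN : ∀ z ∈ Ω, p6N γ κ z = 1 := fun z hz => by
    have := hC (fun w => (w - z)⁻¹)
    rw [p6N, ← hor z hz]
    simp only [smul_eq_mul, ← div_eq_mul_inv] at this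
    rw [this]
  have hne : Ω.Nonempty := by
    by_contra hn
    rw [Set.not_nonempty_iff_eq_empty] at hn
    have : Γ 0 ∈ frontier Ω := by rw [hfr]; exact ⟨0, by simp, rfl⟩
    rw [hn] at this; simp at this
  exact ⟨γ, κ, L, ⟨hd, by rw [hz, h0], ho, hb, hN, p6_out hd hN ho hb hne (p5_conn hc hinj h01 ho hb hne hfr)⟩, hE⟩

lemma p9_comm {A : Type*} [NormedRing A] [NormedAlgebra ℂ A] {T B : A} (h : T * B = B * T) (z : ℂ) (hz : z ∈ resolventSet ℂ T) :
    resolvent T z * B = B * resolvent T z := by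
  have h1 : resolvent T z = Ring.inverse (algebraMap ℂ A z - T) := rfl
  have e1 := Ring.mul_inverse_cancel _ (spectrum.mem_resolventSet_iff.1 hz)
  have e2 := Ring.inverse_mul_cancel _ (spectrum.mem_resolventSet_iff.1 hz)
  rw [← h1] at e1 e2
  have e3 : (algebraMap ℂ A z - T) * B = B * (algebraMap ℂ A z - T) := by
    rw [sub_mul, mul_sub, h, Algebra.commutes]
  calc resolvent T z * B = resolvent T z * (B * (algebraMap ℂ A z - T)) * resolvent T z := by
        rw [mul_assoc, mul_assoc B, e1, mul_one]
    _ = B * resolvent T z := by rw [← e3, ← mul_assoc, e2, one_mul]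

def P9G {A : Type*} [NormedRing A] [NormedAlgebra ℂ A] (U K : Set ℂ) (T : A) (f : ℂ → ℂ) : Prop :=
  DifferentiableOn ℂ f U ∧ ∃ M, 0 ≤ M ∧ (∀ z ∈ U, ‖f z‖ ≤ M) ∧ ∀ z ∈ K, ‖f z • resolvent T z‖ ≤ M

lemma p9_mul {A : Type*} [NormedRing A] [NormedAlgebra ℂ A] {U K : Set ℂ} (hK : K ⊆ U) {T : A} {g f : ℂ → ℂ}
    (hg : DifferentiableOn ℂ g U) (hgb : ∃ C : ℝ, ∀ z ∈ U, ‖g z‖ ≤ C) (hf : P9G U K T f) : P9G U K T (fun z => g z * f z) := by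
  obtain ⟨C, hC⟩ := hgb
  obtain ⟨hd, M, hM, h1, h2⟩ := hf
  have hC' : ∀ z ∈ U, ‖g z‖ ≤ |C| := fun z hz => (hC z hz).trans (le_abs_self C)
  refine ⟨hg.mul hd, |C| * M, by positivity, fun z hz => ?_, fun z hz => ?_⟩
  · rw [norm_mul]
    have := hC' z hz
    have := h1 z hz
    gcongr
  · rw [mul_smul, norm_smul]
    have := hC' z (hK hz)
    have := h2 z hz
    gcongr
end

end

/-- In the setting of the contour-deformation lemma: for `h ∈ H^∞(U)` and `T` with
`σ(T) ∩ U = ∅` and `|h| ‖(z-T)⁻¹‖` bounded on `(clos Ω₀) \ ({λ₀} ∪ Ω)`, the operators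
`A_g = (2πi)⁻¹ ∫_Γ g h (z-T)⁻¹ dz` lie in the double commutant of `T` and multiply as
`A_{g₁}A_{g₂} = A_{g₂}A_{g₁} = (2πi)⁻¹ ∫_Γ g₁ g₂ h² (z-T)⁻¹ dz`; in particular
`(A_1)ⁿ = (2πi)⁻¹ ∫_Γ hⁿ (z-T)⁻¹ dz`. -/
theorem stmt8 (T : H →L[ℂ] H) (lam₀ : ℂ) (Γ Γ₀ : ℝ → ℂ) (Ω Ω₀ : Set ℂ)
    (hΓc : ContinuousOn Γ (Set.Icc 0 1)) (hΓ0c : ContinuousOn Γ₀ (Set.Icc 0 1))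
    (hΓinj : Set.InjOn Γ (Set.Ico 0 1)) (hΓ0inj : Set.InjOn Γ₀ (Set.Ico 0 1))
    (hΓrect : eVariationOn Γ (Set.Icc 0 1) ≠ ⊤)
    (hΓ0rect : eVariationOn Γ₀ (Set.Icc 0 1) ≠ ⊤)
    (hends : Γ 0 = lam₀ ∧ Γ 1 = lam₀ ∧ Γ₀ 0 = lam₀ ∧ Γ₀ 1 = lam₀)
    (hΩo : IsOpen Ω) (hΩb : Bornology.IsBounded Ω) (hΩfr : frontier Ω = Γ '' Set.Icc 0 1)
    (hΩ0o : IsOpen Ω₀) (hΩ0b : Bornology.IsBounded Ω₀)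
    (hΩ0fr : frontier Ω₀ = Γ₀ '' Set.Icc 0 1)
    (horient : ∀ z ∈ Ω, (2 * π * Complex.I)⁻¹ *
      ∫ t in (0:ℝ)..1, deriv Γ t / (Γ t - z) = 1)
    (horient₀ : ∀ z ∈ Ω₀, (2 * π * Complex.I)⁻¹ *
      ∫ t in (0:ℝ)..1, deriv Γ₀ t / (Γ₀ t - z) = 1)
    (hsub : closure Ω \ {lam₀} ⊆ Ω₀)
    (t₀ t₁ : ℕ → ℝ) (γ₀ γ₁ : ℕ → ℝ → ℂ)
    (ht₀ : StrictAnti t₀) (ht₁ : StrictMono t₁)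
    (htmem : ∀ n, t₀ n ∈ Set.Ioo (0:ℝ) 1 ∧ t₁ n ∈ Set.Ioo (0:ℝ) 1)
    (htord : t₀ 0 < t₁ 0)
    (ht₀lim : Tendsto t₀ atTop (nhds 0)) (ht₁lim : Tendsto t₁ atTop (nhds 1))
    (hγc : ∀ n, ContinuousOn (γ₀ n) (Set.Icc 0 1) ∧ ContinuousOn (γ₁ n) (Set.Icc 0 1))
    (hγends : ∀ n, γ₀ n 0 = Γ (t₀ n) ∧ γ₀ n 1 = Γ₀ (t₀ n) ∧
      γ₁ n 0 = Γ₀ (t₁ n) ∧ γ₁ n 1 = Γ (t₁ n))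
    (hγmem : ∀ n, γ₀ n '' Set.Icc 0 1 ⊆ closure Ω₀ \ Ω ∧
      γ₁ n '' Set.Icc 0 1 ⊆ closure Ω₀ \ Ω)
    (hγint : ∀ n, γ₀ n '' Set.Ioo 0 1 ⊆ Ω₀ \ closure Ω ∧
      γ₁ n '' Set.Ioo 0 1 ⊆ Ω₀ \ closure Ω)
    (hγlen : Tendsto (fun n => eVariationOn (γ₀ n) (Set.Icc 0 1)) atTop (nhds 0) ∧
      Tendsto (fun n => eVariationOn (γ₁ n) (Set.Icc 0 1)) atTop (nhds 0))
    (hγdisj : ∀ (k l : Bool) (m n : ℕ), ∀ t ∈ Set.Icc (0:ℝ) 1, ∀ s ∈ Set.Icc (0:ℝ) 1,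
      (if k then γ₁ m else γ₀ m) t = (if l then γ₁ n else γ₀ n) s →
      k = l ∧ m = n ∧ t = s)
    (U : Set ℂ) (hUo : IsOpen U) (hUsub : closure Ω₀ \ {lam₀} ⊆ U)
    (h : ℂ → ℂ) (hh : DifferentiableOn ℂ h U) (hhbd : ∃ C : ℝ, ∀ z ∈ U, ‖h z‖ ≤ C)
    (hTU : spectrum ℂ T ∩ U = ∅)
    (hbd : ∃ C : ℝ, ∀ z ∈ closure Ω₀ \ ({lam₀} ∪ Ω), ‖h z‖ * ‖resolvent T z‖ ≤ C)
    (A : (ℂ → ℂ) → (H →L[ℂ] H))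
    (hA : ∀ g : ℂ → ℂ, A g = (2 * π * Complex.I)⁻¹ •
      ∫ t in (0:ℝ)..1, (g (Γ t) * h (Γ t) * deriv Γ t) • resolvent T (Γ t)) :
    (∀ g : ℂ → ℂ, DifferentiableOn ℂ g U → (∃ C : ℝ, ∀ z ∈ U, ‖g z‖ ≤ C) →
      A g ∈ bicommutant T) ∧
    (∀ g₁ g₂ : ℂ → ℂ,
      DifferentiableOn ℂ g₁ U → (∃ C : ℝ, ∀ z ∈ U, ‖g₁ z‖ ≤ C) →
      DifferentiableOn ℂ g₂ U → (∃ C : ℝ, ∀ z ∈ U, ‖g₂ z‖ ≤ C) →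
      A g₁ * A g₂ = A g₂ * A g₁ ∧
      A g₁ * A g₂ = (2 * π * Complex.I)⁻¹ •
        ∫ t in (0:ℝ)..1,
          (g₁ (Γ t) * g₂ (Γ t) * (h (Γ t))^2 * deriv Γ t) • resolvent T (Γ t)) ∧
    (∀ n : ℕ, 1 ≤ n → (A (fun _ => 1)) ^ n = (2 * π * Complex.I)⁻¹ •
      ∫ t in (0:ℝ)..1, ((h (Γ t)) ^ n * deriv Γ t) • resolvent T (Γ t)) := by
  obtain ⟨γ, κ, L, hS, hI⟩ := p9_setup hΓc hΓinj hends.1 hends.2.1 hΓrect hΩo hΩb hΩfr horient (H →L[ℂ] H)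
  obtain ⟨γ', κ', L', hS0, -⟩ := p9_setup hΓ0c hΓ0inj hends.2.2.1 hends.2.2.2 hΓ0rect hΩ0o hΩ0b hΩ0fr horient₀ (H →L[ℂ] H)
  have hT : ∀ z ∈ U, z ∈ resolventSet ℂ T := fun z hz => by
    by_contra hn
    have : z ∈ spectrum ℂ T ∩ U := ⟨hn, hz⟩
    rw [hTU] at this; exact this
  set K : Set ℂ := closure Ω₀ \ ({lam₀} ∪ Ω) with hK
  have hKU : K ⊆ U := fun z hz => hUsub ⟨hz.1, fun h1 => hz.2 (Or.inl h1)⟩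
  have hhG : P9G U K T h := by
    obtain ⟨C, hC⟩ := hhbd
    obtain ⟨C', hC'⟩ := hbd
    refine ⟨hh, |C| + |C'|, by positivity, fun z hz => ?_, fun z hz => ?_⟩
    · have := hC z hz
      have := le_abs_self C
      have := abs_nonneg C'
      linarith
    · have := hC' z hz
      rw [norm_smul]
      have := le_abs_self C'
      have := abs_nonneg C
      linarith
  obtain ⟨B, hB⟩ : ∃ B : (ℂ → ℂ) → (H →L[ℂ] H), ∀ f, B f = ∫ u, κ u • f (γ u) • resolvent T (γ u) := ⟨_, fun _ => rfl⟩
  set c : ℂ := 2 * π * Complex.I with hc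
  have hc0 : c ≠ 0 := Complex.two_pi_I_ne_zero
  have hmul : ∀ f₁ f₂ : ℂ → ℂ, P9G U K T f₁ → P9G U K T f₂ → B f₂ * B f₁ = c • B (fun z => f₁ z * f₂ z) := by
    rintro f₁ f₂ ⟨d1, M1, p1, a1, b1⟩ ⟨d2, M2, p2, a2, b2⟩
    rw [hB, hB, hB]
    exact p8_mul hS hS0 hsub hUo hUsub T hT d1 d2 (M := max M1 M2) (le_max_of_le_left p1)
      (fun z hz => (a1 z hz).trans (le_max_left _ _)) (fun z hz => (a2 z hz).trans (le_max_right _ _))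
      (fun z hz => (b1 z hz).trans (le_max_left _ _)) (fun z hz => (b2 z hz).trans (le_max_right _ _))
  have hBI : ∀ f : ℂ → ℂ, ∫ t in (0:ℝ)..1, (f (Γ t) * deriv Γ t) • resolvent T (Γ t) = B f := fun f => by
    rw [hB, ← hI (fun z => f z • resolvent T z)]
    congr 1; funext t
    rw [mul_comm, mul_smul]
  have hAB : ∀ g, A g = c⁻¹ • B (fun z => g z * h z) := fun g => by
    rw [hA g, hBI (fun z => g z * h z)]
  refine ⟨fun g hg hgb => ?_, fun g₁ g₂ hg₁ hb₁ hg₂ hb₂ => ?_, ?_⟩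
  · obtain ⟨gd, M, gp, ga, gb⟩ := p9_mul hKU hg hgb hhG
    intro S hSc
    have hcm : S * T = T * S := hSc
    have hfr : frontier Ω \ {lam₀} ⊆ U := fun z hz => hUsub ⟨subset_closure (hsub ⟨hz.1.1, hz.2⟩), hz.2⟩
    have hRd : DifferentiableOn ℂ (resolvent T : ℂ → H →L[ℂ] H) U := fun z hz =>
      (spectrum.hasDerivAt_resolvent (hT z hz)).differentiableAt.differentiableWithinAt
    have hi := p8_int hS (F := fun z => (g z * h z) • resolvent T z) ((gd.smul hRd).continuousOn.mono hfr)
      (M := M) (fun z hz => gb z ⟨subset_closure (hsub ⟨hz.1.1, hz.2⟩), by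
        rintro (h1 | h1)
        · exact hz.2 h1
        · exact hS.fr hz.1 h1⟩)
    rw [hAB, smul_mul_assoc, mul_smul_comm, hB]
    congr 1
    rw [← integral_mul_const_of_integrable hi, ← integral_const_mul_of_integrable hi]
    congr 1; funext u
    by_cases hu : u ∈ Set.Ioo 0 L
    · rw [smul_mul_assoc, smul_mul_assoc, mul_smul_comm, mul_smul_comm, p9_comm hcm.symm _ (hT _ (hfr (hS.mem hu)))]
    · simp [hS.d.supp u hu]
  · have G1 := p9_mul hKU hg₁ hb₁ hhG
    have G2 := p9_mul hKU hg₂ hb₂ hhG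
    have key : ∀ a b : ℂ → ℂ, P9G U K T (fun z => a z * h z) → P9G U K T (fun z => b z * h z) →
        A a * A b = c⁻¹ • B (fun z => (b z * h z) * (a z * h z)) := fun a b ha hb => by
      rw [hAB, hAB, smul_mul_assoc, mul_smul_comm, hmul _ _ hb ha, inv_smul_smul₀ hc0]
    rw [hBI (fun z => g₁ z * g₂ z * h z ^ 2), key g₁ g₂ G1 G2, key g₂ g₁ G2 G1]
    have hcg : ∀ f f' : ℂ → ℂ, (∀ z, f z = f' z) → c⁻¹ • B f = c⁻¹ • B f' := fun f f' hff => by rw [funext hff]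
    exact ⟨hcg _ _ fun z => by ring, hcg _ _ fun z => by ring⟩
  · have key : ∀ n : ℕ, P9G U K T (fun z => h z ^ (n + 1)) ∧ A (fun _ => 1) ^ (n + 1) = c⁻¹ • B (fun z => h z ^ (n + 1)) := by
      intro n
      induction n with
      | zero => simpa [hAB] using hhG
      | succ n ih =>
        refine ⟨?_, ?_⟩
        · have := p9_mul hKU hh hhbd ih.1
          simpa only [pow_succ'] using this
        · rw [pow_succ, ih.2, hAB, smul_mul_assoc, mul_smul_comm]
          simp only [one_mul]
          rw [hmul _ _ hhG ih.1, inv_smul_smul₀ hc0]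
          simp only [pow_succ']
    intro n hn
    obtain ⟨m, rfl⟩ := Nat.exists_eq_add_of_le' hn
    rw [hBI (fun z => h z ^ (m + 1)), (key m).2]
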